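/- Let k be a field of prime characteristic p and let t be an integer with p ≤ t ≤ 2p−1. Then the Schur algebra S_k(t, 2p) has global dimension exactly 4(p−1); that is, every finitely generated S_k(t, 2p)-module has projective dimension at most 4(p−1), and there exists a finitely generated S_k(t, 2p)-module whose projective dimension is exactly 4(p−1). -/

import Mathlib

universe u

/-- `PDimLE A n M`: the `A`-module `M` has projective dimension at most `n`,
witnessed by a projective resolution of length at most `n`. -/
def PDimLE (A : Type u) [Ring A] : ℕ → (M : Type u) → [AddCommGroup M] → [Module A M] → Prop
  | 0, M, _, _ => Module.Projective A M
  | n + 1, M, _, _ =>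
      ∃ (P : Type u) (_ : AddCommGroup P) (_ : Module A P) (f : P →ₗ[A] M),
        Module.Projective A P ∧ Function.Surjective f ∧ PDimLE A n (LinearMap.ker f)

/-- The representation of the symmetric group `S_d` on the `d`-th tensor power of `V = k^n`
by place permutations; the tensor power `V^{⊗ d}` is realised as the free `k`-module on the
set of multi-indices `Fin d → Fin n`, i.e. as the functions `(Fin d → Fin n) → k`. -/
def placePerm (k : Type u) [Field k] (n d : ℕ) :
    Representation k (Equiv.Perm (Fin d)) ((Fin d → Fin n) → k) where
  toFun σ :=
    { toFun := fun f v => f (v ∘ σ)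
      map_add' := fun _ _ => rfl
      map_smul' := fun _ _ => rfl }
  map_one' := by ext f v; rfl
  map_mul' := fun σ τ => by ext f v; rfl

/-- The group algebra of the symmetric group on `d` letters over `k`. -/
abbrev SymGroupAlgebra (k : Type u) [Field k] (d : ℕ) : Type u :=
  MonoidAlgebra k (Equiv.Perm (Fin d))

/-- The tensor space `V^{⊗ d}`, `V = k^n`, as a module over the group algebra of `S_d`
(the symmetric group acting by place permutations). -/
def TensorSpace (k : Type u) [Field k] (n d : ℕ) : Type u := (Fin d → Fin n) → k

instance (k : Type u) [Field k] (n d : ℕ) : AddCommGroup (TensorSpace k n d) :=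
  inferInstanceAs (AddCommGroup ((Fin d → Fin n) → k))

instance (k : Type u) [Field k] (n d : ℕ) : Module k (TensorSpace k n d) :=
  inferInstanceAs (Module k ((Fin d → Fin n) → k))

noncomputable instance (k : Type u) [Field k] (n d : ℕ) :
    Module (SymGroupAlgebra k d) (TensorSpace k n d) where
  smul r t := (placePerm k n d).asAlgebraHom r t
  one_smul t := by show (placePerm k n d).asAlgebraHom 1 t = t; rw [map_one]; rfl
  mul_smul r s t := by
    show (placePerm k n d).asAlgebraHom (r * s) t
      = (placePerm k n d).asAlgebraHom r ((placePerm k n d).asAlgebraHom s t)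
    rw [map_mul]; rfl
  smul_zero r := map_zero ((placePerm k n d).asAlgebraHom r)
  smul_add r t₁ t₂ := map_add ((placePerm k n d).asAlgebraHom r) t₁ t₂
  add_smul r s t := by
    show (placePerm k n d).asAlgebraHom (r + s) t
      = (placePerm k n d).asAlgebraHom r t + (placePerm k n d).asAlgebraHom s t
    rw [map_add]; rfl
  zero_smul t := by show (placePerm k n d).asAlgebraHom 0 t = 0; rw [map_zero]; rfl

lemma tensorSpace_smul_def (k : Type u) [Field k] {n d : ℕ} (r : SymGroupAlgebra k d)
    (t : TensorSpace k n d) : r • t = (placePerm k n d).asAlgebraHom r t := rfl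

/-- The Schur algebra `S_k(n, d)`: the endomorphism algebra of the tensor space
`(k^n)^{⊗ d}` as a module over the group algebra of the symmetric group `S_d`.
The tensor space is a left module over it by evaluation. -/
noncomputable abbrev SchurAlgebra (k : Type u) [Field k] (n d : ℕ) : Type u :=
  Module.End (SymGroupAlgebra k d) (TensorSpace k n d)

open CategoryTheory CategoryTheory.Abelian

open Function (Surjective Exact comp_assoc Bijective)
open ModuleCat (ofHom ofHom_comp hom_ext hom_sum hom_ofHom hom_ext_iff)
open Finset (sum_eq_zero sum_smul sum_ite_eq mem_univ smul_sum sum_congr sum_const_zero sum_ite_eq' sum_add_distrib univ induction_on sum_insert sum_mul mul_sum sum_comm sum_involution sum_neg_distrib sum_bij sum_eq_single card_bij card_univ sum_sub_distrib card_filter_add_card_filter_not filter_filter filter_congr mem_filter eq_of_subset_of_card_le disjoint_left mem_union card_le_card card_union_of_disjoint le_sup card_pos card_lt_card ssubset_iff_of_subset mem_image mem_range card_range coe_filter sum_empty add_sum_erase mem_erase mem_insert mem_product eq_empty_of_forall_notMem card_erase_add_one mem_singleton)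
open Submodule (mem_span_singleton_self subset_span span_mono span_le span_induction mem_span_singleton coe_sum smul_mem inclusion_injective topEquiv)
open LinearMap (toSpanSingleton surjective_rangeRestrict ker_rangeRestrict mem_ker)

section HA

variable (R : Type u) [Ring R]

abbrev Xt (Z M : Type u) [AddCommGroup Z] [Module R Z] [AddCommGroup M] [Module R M] (i : ℕ) :
    Type u :=
  Ext (ModuleCat.of R Z) (ModuleCat.of R M) i

def EV (Z M : Type u) [AddCommGroup Z] [Module R Z] [AddCommGroup M] [Module R M] (i : ℕ) : Prop :=
  ∀ e : Xt R Z M i, e = 0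

variable {R}
variable {Z M MA ML MC : Type u} [AddCommGroup Z] [Module R Z] [AddCommGroup M] [Module R M]
  [AddCommGroup MA] [Module R MA] [AddCommGroup ML] [Module R ML] [AddCommGroup MC] [Module R MC]

structure SES (f : MA →ₗ[R] ML) (g : ML →ₗ[R] MC) : Prop where
  inj : Function.Injective f
  exact : Exact f g
  surj : Surjective g

abbrev SES.sc {f : MA →ₗ[R] ML} {g : ML →ₗ[R] MC} (h : SES f g) :
    ShortComplex (ModuleCat.{u} R) :=
  ShortComplex.mk (ofHom f) (ofHom g)
    (by ext x; exact (h.exact (f x)).2 ⟨x, rfl⟩)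

lemma SES.se {f : MA →ₗ[R] ML} {g : ML →ₗ[R] MC} (h : SES f g) : h.sc.ShortExact where
  exact := (ShortComplex.ShortExact.moduleCat_exact_iff_function_exact _).mpr h.exact
  mono_f := (ModuleCat.mono_iff_injective _).2 h.inj
  epi_g := (ModuleCat.epi_iff_surjective _).2 h.surj

lemma SES.ofKer {g : ML →ₗ[R] MC} (h : Surjective g) : SES (LinearMap.ker g).subtype g :=
  ⟨Subtype.val_injective, LinearMap.exact_subtype_ker_map g, h⟩

lemma SES.ofSub (N : Submodule R M) : SES N.subtype N.mkQ :=
  ⟨Subtype.val_injective, LinearMap.exact_subtype_mkQ N, N.mkQ_surjective⟩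

variable {f : MA →ₗ[R] ML} {g : ML →ₗ[R] MC}

lemma SES.cov1 (h : SES f g) {i : ℕ} (wh : EV R Z ML (i + 1)) (wr : EV R Z MC i) :
    EV R Z MA (i + 1) := fun e => by
  obtain ⟨x, hx⟩ := Ext.covariant_sequence_exact₁ _ h.se e (wh _) rfl
  rw [← hx, wr x, Ext.zero_comp]

lemma SES.cov2 (h : SES f g) {i : ℕ} (hh : EV R Z MA i) (wr : EV R Z MC i) :
    EV R Z ML i := fun e => by
  obtain ⟨x, hx⟩ := Ext.covariant_sequence_exact₂ _ h.se e (wr _)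
  rw [← hx, hh x, Ext.zero_comp]

lemma SES.cov3 (h : SES f g) {i : ℕ} (hh : EV R Z MA (i + 1)) (wh : EV R Z ML i) :
    EV R Z MC i := fun e => by
  obtain ⟨x, hx⟩ := Ext.covariant_sequence_exact₃ _ h.se e rfl (hh _)
  rw [← hx, wh x, Ext.zero_comp]

lemma SES.con1 (h : SES f g) {i : ℕ} (wh : EV R ML Z i) (wr : EV R MC Z (i + 1)) :
    EV R MA Z i := fun e => by
  obtain ⟨x, hx⟩ := Ext.contravariant_sequence_exact₁ h.se _ e (add_comm 1 i) (wr _)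
  rw [← hx, wh x, Ext.comp_zero]

lemma SES.con2 (h : SES f g) {i : ℕ} (hh : EV R MA Z i) (wr : EV R MC Z i) :
    EV R ML Z i := fun e => by
  obtain ⟨x, hx⟩ := Ext.contravariant_sequence_exact₂ h.se _ e (hh _)
  rw [← hx, wr x, Ext.comp_zero]

lemma SES.con3 (h : SES f g) {i : ℕ} (hh : EV R MA Z i) (wh : EV R ML Z (i + 1)) :
    EV R MC Z (i + 1) := fun e => by
  obtain ⟨x, hx⟩ := Ext.contravariant_sequence_exact₃ h.se _ e (wh _) (add_comm 1 i)
  rw [← hx, hh x, Ext.comp_zero]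

lemma EV.proj [Module.Projective R Z] (i : ℕ) : EV R Z M (i + 1) := fun e => by
  have : Projective (ModuleCat.of R Z) := inferInstance
  exact Ext.eq_zero_of_projective e

lemma EV.retr_left (i : ℕ) (a : MA →ₗ[R] ML) (b : ML →ₗ[R] MA) (hab : b ∘ₗ a = LinearMap.id)
    (h : EV R ML Z i) : EV R MA Z i := fun e => by
  have hh := Ext.mk₀_id_comp e
  have : 𝟙 (ModuleCat.of R MA) = ofHom a ≫ ofHom b := by
    rw [← ofHom_comp, hab]; rfl
  rw [this, ← Ext.mk₀_comp_mk₀_assoc, h ((Ext.mk₀ (ofHom b)).comp e _),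
    Ext.comp_zero] at hh
  exact hh.symm

lemma EV.retr_right (i : ℕ) (a : MA →ₗ[R] ML) (b : ML →ₗ[R] MA) (hab : b ∘ₗ a = LinearMap.id)
    (h : EV R Z ML i) : EV R Z MA i := fun e => by
  have hh := Ext.comp_mk₀_id e
  have : 𝟙 (ModuleCat.of R MA) = ofHom a ≫ ofHom b := by
    rw [← ofHom_comp, hab]; rfl
  rw [this, ← Ext.mk₀_comp_mk₀, ← Ext.comp_assoc (a₁₂ := i) (a₂₃ := 0) _ _ _ (by simp) (by simp) (by simp),
    h (e.comp (Ext.mk₀ (ofHom a)) (add_zero i)), Ext.zero_comp] at hh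
  exact hh.symm

lemma EV.equiv_left (i : ℕ) (a : MA ≃ₗ[R] ML) (h : EV R ML Z i) : EV R MA Z i :=
  EV.retr_left i a.toLinearMap a.symm.toLinearMap (by ext; simp) h

lemma EV.equiv_right (i : ℕ) (a : MA ≃ₗ[R] ML) (h : EV R Z ML i) : EV R Z MA i :=
  EV.retr_right i a.toLinearMap a.symm.toLinearMap (by ext; simp) h

lemma pi_id (n : ℕ) : 𝟙 (ModuleCat.of R (Fin n → M)) = ∑ j : Fin n,
    ofHom (LinearMap.proj j) ≫ ofHom (LinearMap.single R (fun _ => M) j) := by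
  apply hom_ext
  apply LinearMap.ext
  intro x
  simp only [← ofHom_comp, hom_sum, LinearMap.sum_apply, hom_ofHom,
    ModuleCat.hom_id]
  funext l
  rw [Finset.sum_apply]
  simp [Pi.single_apply]

lemma EV.pi_left (n i : ℕ) (h : EV R M Z i) : EV R (Fin n → M) Z i := fun e => by
  have hh := Ext.mk₀_id_comp e
  have : 𝟙 (ModuleCat.of R (Fin n → M)) = ∑ j : Fin n, ofHom (LinearMap.proj j) ≫
      ofHom (LinearMap.single R (fun _ => M) j) := by
    exact pi_id n
  rw [this, Ext.mk₀_sum, Ext.sum_comp] at hh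
  rw [← hh]
  refine sum_eq_zero fun j _ => ?_
  rw [← Ext.mk₀_comp_mk₀_assoc,
    h ((Ext.mk₀ (ofHom (LinearMap.single R (fun _ => M) j))).comp e _), Ext.comp_zero]

lemma EV.pi_right (n i : ℕ) (h : EV R Z M i) : EV R Z (Fin n → M) i := fun e => by
  have hh := Ext.comp_mk₀_id e
  have : 𝟙 (ModuleCat.of R (Fin n → M)) = ∑ j : Fin n, ofHom (LinearMap.proj j) ≫
      ofHom (LinearMap.single R (fun _ => M) j) := by
    exact pi_id n
  rw [this, Ext.mk₀_sum, Ext.comp_sum] at hh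
  rw [← hh]
  refine sum_eq_zero fun j _ => ?_
  rw [← Ext.mk₀_comp_mk₀, ← Ext.comp_assoc (a₁₂ := i) (a₂₃ := 0) _ _ _ (by simp) (by simp) (by simp),
    h (e.comp (Ext.mk₀ (ofHom (LinearMap.proj j))) (add_zero i)), Ext.zero_comp]

lemma EV.zero_iff : EV R Z M 0 ↔ ∀ f : Z →ₗ[R] M, f = 0 := by
  constructor
  · intro h f
    have := h (Ext.mk₀ (ofHom f))
    rw [Ext.mk₀_eq_zero_iff] at this
    exact hom_ext_iff.1 this
  · intro h e
    obtain ⟨f, rfl⟩ := Ext.mk₀_bijective _ _ |>.2 e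
    rw [Ext.mk₀_eq_zero_iff]
    ext x
    exact LinearMap.congr_fun (h f.hom) x

lemma EV.sub_left [Subsingleton Z] (i : ℕ) : EV R Z M i :=  fun e => by
  have hh := Ext.mk₀_id_comp e
  rw [show 𝟙 (ModuleCat.of R Z) = 0 by ext x; exact Subsingleton.elim (α := Z) _ _,
    Ext.mk₀_zero, Ext.zero_comp] at hh
  exact hh.symm

lemma EV.sub_right [Subsingleton M] (i : ℕ) : EV R Z M i :=  fun e => by
  have hh := Ext.comp_mk₀_id e
  rw [show 𝟙 (ModuleCat.of R M) = 0 by ext x; exact Subsingleton.elim (α := M) _ _,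
    Ext.mk₀_zero, Ext.comp_zero] at hh
  exact hh.symm

lemma SES.ext_of_EV (h : SES f g) (wr : EV R MC Z 1) (q : MA →ₗ[R] Z) :
    ∃ r : ML →ₗ[R] Z, r ∘ₗ f = q := by
  obtain ⟨x, hx⟩ := Ext.contravariant_sequence_exact₁ h.se (ModuleCat.of R Z)
    (Ext.mk₀ (ofHom q)) (add_comm 1 0) (wr _)
  obtain ⟨r, rfl⟩ := Ext.mk₀_bijective _ _ |>.2 x
  rw [Ext.mk₀_comp_mk₀] at hx
  have := (Ext.mk₀_bijective _ _).1 hx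
  exact ⟨r.hom, hom_ext_iff.1 this⟩

lemma SES.EV_of_ext (h : SES f g) (wh : EV R ML Z 1)
    (H : ∀ q : MA →ₗ[R] Z, ∃ r : ML →ₗ[R] Z, r ∘ₗ f = q) : EV R MC Z 1 := fun e => by
  obtain ⟨x, hx⟩ := Ext.contravariant_sequence_exact₃ h.se (ModuleCat.of R Z) e (wh _) (add_comm 1 0)
  obtain ⟨q, rfl⟩ := Ext.mk₀_bijective _ _ |>.2 x
  obtain ⟨r, hr⟩ := H q.hom
  have : q = ofHom f ≫ ofHom r := by
    rw [← ofHom_comp, hr]; rfl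
  rw [← hx, this]
  rw [← Ext.mk₀_comp_mk₀]
  exact h.se.extClass_comp_assoc (Ext.mk₀ (ofHom r)) (n' := 1) (h := rfl)

/-- free cover -/
lemma exists_cover (R : Type u) [Ring R] (M : Type u) [AddCommGroup M] [Module R M]
    [Module.Finite R M] :
    ∃ (n : ℕ) (f : (Fin n → R) →ₗ[R] M), Surjective f := Module.Finite.exists_fin' R M

lemma PDimLE.ev {n : ℕ} : ∀ {M : Type u} [AddCommGroup M] [Module R M], PDimLE R n M →
    ∀ (Z : Type u) [AddCommGroup Z] [Module R Z] (i : ℕ), n < i → EV R M Z i := by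
  induction n with
  | zero =>
    intro M _ _ h Z _ _ i hi
    obtain ⟨i, rfl⟩ := Nat.exists_eq_add_of_lt hi
    have : Module.Projective R M := h
    rw [zero_add]
    exact EV.proj _
  | succ n ih =>
    intro M _ _ h Z _ _ i hi
    obtain ⟨P, _, _, f, hP, hf, hk⟩ := h
    obtain ⟨i, rfl⟩ := Nat.exists_eq_add_of_lt hi
    exact (SES.ofKer hf).con3 (ih hk Z _ (by omega)) (EV.proj _)

lemma PDimLE.of_EV [IsNoetherianRing R] (n : ℕ) : ∀ {M : Type u} [AddCommGroup M] [Module R M],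
    Module.Finite R M →
    (∀ (Z : Type u) [AddCommGroup Z] [Module R Z], Module.Finite R Z → EV R M Z (n + 1)) →
    PDimLE R n M := by
  induction n with
  | zero =>
    intro M _ _ hM h
    obtain ⟨n, f, hf⟩ := exists_cover R M
    obtain ⟨r, hr⟩ := (SES.ofKer hf).ext_of_EV (h _ inferInstance) LinearMap.id
    have hs : ∃ s : M →ₗ[R] (Fin n → R), f ∘ₗ s = LinearMap.id := by
      refine ⟨(LinearMap.ker f).liftQ (LinearMap.id - (LinearMap.ker f).subtype ∘ₗ r) ?_ ∘ₗ
        (f.quotKerEquivOfSurjective hf).symm.toLinearMap, ?_⟩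
      · intro x hx
        have := LinearMap.congr_fun hr ⟨x, hx⟩
        simp only [LinearMap.comp_apply, Submodule.subtype_apply, LinearMap.id_apply] at this
        simp [this]
      · ext m
        obtain ⟨x, rfl⟩ := hf m
        have : (f.quotKerEquivOfSurjective hf).symm (f x) = Submodule.Quotient.mk x := by
          rw [LinearEquiv.symm_apply_eq]; rfl
        simp [this]
    obtain ⟨s, hs⟩ := hs
    exact Module.Projective.of_split s f hs
  | succ n ih =>
    intro M _ _ hM h
    obtain ⟨m, f, hf⟩ := exists_cover R M
    refine ⟨Fin m → R, inferInstance, inferInstance, f, inferInstance, hf, ih inferInstance ?_⟩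
    intro Z _ _ hZ
    exact (SES.ofKer hf).con1 (EV.proj _) (h Z hZ)

end HA

class SA (k R : Type u) [Field k] [Ring R] [Algebra k R] [StarRing R] : Prop where
  star_map : ∀ c : k, star (algebraMap k R c) = algebraMap k R c

def Dl (k R M : Type u) [Field k] [Ring R] [Algebra k R] [AddCommGroup M] [Module R M] : Type u :=
  { f : M →+ k // ∀ (c : k) (m : M), f (algebraMap k R c • m) = c * f m }

section DU


variable {k R : Type u} [Field k] [Ring R] [Algebra k R] [StarRing R] [SA k R]
variable {Z M N P MA ML MC : Type u} [AddCommGroup Z] [Module R Z] [AddCommGroup M] [Module R M]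
  [AddCommGroup N] [Module R N] [AddCommGroup P] [Module R P]
  [AddCommGroup MA] [Module R MA] [AddCommGroup ML] [Module R ML] [AddCommGroup MC] [Module R MC]

lemma Dl.ext' {f g : Dl k R M} (h : ∀ m, f.1 m = g.1 m) : f = g :=
  Subtype.ext (AddMonoidHom.ext h)

instance : AddCommGroup (Dl k R M) :=
  inferInstanceAs (AddCommGroup (AddSubgroup.mk (AddSubmonoid.mk (AddSubsemigroup.mk
    {f : M →+ k | ∀ (c : k) (m : M), f (algebraMap k R c • m) = c * f m}
    (by intro f g hf hg c m
        rw [AddMonoidHom.add_apply, AddMonoidHom.add_apply, hf, hg, mul_add]))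
    (by intro c m; simp))
    (by intro f hf c m
        rw [AddMonoidHom.neg_apply, AddMonoidHom.neg_apply, hf, mul_neg])))

instance : Module R (Dl k R M) where
  smul a f := ⟨⟨⟨fun m => f.1 (star a • m), by simp⟩, by intro x y; simp⟩, fun c m => by
    have := f.2 c (star a • m)
    simp only [AddMonoidHom.coe_mk, ZeroHom.coe_mk]
    rw [← this, ← mul_smul, ← mul_smul, Algebra.commutes]⟩
  one_smul f := Dl.ext' fun m => by
    show f.1 (star (1 : R) • m) = f.1 m
    simp
  mul_smul a b f := Dl.ext' fun m => by
    show f.1 (star (a * b) • m) = f.1 (star b • star a • m)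
    rw [star_mul, mul_smul]
  smul_zero a := Dl.ext' fun m => rfl
  smul_add a f g := Dl.ext' fun m => rfl
  add_smul a b f := Dl.ext' fun m => by
    show f.1 (star (a + b) • m) = f.1 (star a • m) + f.1 (star b • m)
    rw [star_add, add_smul, map_add]
  zero_smul f := Dl.ext' fun m => by
    show f.1 (star (0 : R) • m) = 0
    rw [star_zero, zero_smul, map_zero]

lemma Dl.smul_apply (a : R) (f : Dl k R M) (m : M) : (a • f).1 m = f.1 (star a • m) := rfl
lemma Dl.add_apply (f g : Dl k R M) (m : M) : (f + g).1 m = f.1 m + g.1 m := rfl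
lemma Dl.zero_apply (m : M) : (0 : Dl k R M).1 m = 0 := rfl

variable (k) in
def Dl.map (g : M →ₗ[R] N) : Dl k R N →ₗ[R] Dl k R M where
  toFun f := ⟨f.1.comp g.toAddMonoidHom, fun c m => by
    show f.1 (g (algebraMap k R c • m)) = c * f.1 (g m)
    rw [map_smul, f.2]⟩
  map_add' _ _ := rfl
  map_smul' a f := Dl.ext' fun m => by
    show f.1 (star a • g m) = f.1 (g (star a • m))
    rw [LinearMap.map_smul g]

lemma Dl.map_apply (g : M →ₗ[R] N) (f : Dl k R N) (m : M) : (Dl.map k g f).1 m = f.1 (g m) := rfl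

lemma Dl.exists_ext (f : M →ₗ[R] N) (hf : Function.Injective f) (q : Dl k R M) :
    ∃ r : Dl k R N, ∀ m, r.1 (f m) = q.1 m := by
  let _ : Module k M := Module.compHom M (algebraMap k R)
  let _ : Module k N := Module.compHom N (algebraMap k R)
  let f' : M →ₗ[k] N := ⟨f.toAddHom, fun c m => map_smul f (algebraMap k R c) m⟩
  obtain ⟨s, hs⟩ := f'.exists_leftInverse_of_injective (LinearMap.ker_eq_bot.2 hf)
  refine ⟨⟨q.1.comp s.toAddMonoidHom, fun c m => ?_⟩, fun m => ?_⟩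
  · have := s.map_smul c m
    show q.1 (s (algebraMap k R c • m)) = c * q.1 (s m)
    rw [← q.2]
    exact congrArg q.1 this
  · show q.1 (s (f' m)) = _
    rw [← LinearMap.comp_apply, hs]; rfl

lemma SES.dual {f : MA →ₗ[R] ML} {g : ML →ₗ[R] MC} (h : SES f g) :
    SES (Dl.map k g) (Dl.map k f) := by
  refine ⟨?_, ?_, ?_⟩
  · intro a b hab
    apply Dl.ext'
    intro m
    obtain ⟨x, rfl⟩ := h.surj m
    exact DFunLike.congr_fun (congrArg Subtype.val hab) x
  · intro q
    constructor
    · intro hq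
      have hq' : ∀ x, q.1 (f x) = 0 := fun x => DFunLike.congr_fun (congrArg Subtype.val hq) x
      have key : ∀ x y, g x = g y → q.1 x = q.1 y := by
        intro x y hxy
        have : g (x - y) = 0 := by rw [map_sub, hxy, sub_self]
        obtain ⟨z, hz⟩ := (h.exact _).1 this
        have := hq' z
        rw [hz, map_sub] at this
        exact sub_eq_zero.1 this
      choose s hs using h.surj
      refine ⟨⟨⟨⟨fun m => q.1 (s m), ?_⟩, ?_⟩, ?_⟩, ?_⟩
      · rw [← map_zero q.1]; exact key _ _ (by rw [hs, map_zero])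
      · intro x y
        show q.1 (s (x + y)) = q.1 (s x) + q.1 (s y)
        rw [← map_add]; exact key _ _ (by rw [map_add, hs, hs, hs])
      · intro c x
        show q.1 (s (algebraMap k R c • x)) = c * q.1 (s x)
        rw [← q.2]; exact key _ _ (by rw [map_smul, hs, hs])
      · apply Dl.ext'
        intro m
        exact key _ _ (hs _)
    · rintro ⟨r, rfl⟩
      apply Dl.ext'
      intro m
      show r.1 (g (f m)) = 0
      rw [(h.exact (f m)).2 ⟨m, rfl⟩, map_zero]
  · intro q
    obtain ⟨r, hr⟩ := Dl.exists_ext f h.inj q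
    exact ⟨r, Dl.ext' hr⟩

def Dl.flip (φ : M →ₗ[R] Dl k R N) : N →ₗ[R] Dl k R M where
  toFun n := ⟨⟨⟨fun m => (φ m).1 n, by rw [map_zero]; rfl⟩, fun x y => by
      show (φ (x + y)).1 n = _
      rw [map_add]; rfl⟩, fun c m => by
      show (φ (algebraMap k R c • m)).1 n = c * (φ m).1 n
      rw [map_smul, Dl.smul_apply, SA.star_map, (φ m).2]⟩
  map_add' x y := Dl.ext' fun m => by
    show (φ m).1 (x + y) = (φ m).1 x + (φ m).1 y
    rw [map_add]
  map_smul' a x := Dl.ext' fun m => by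
    show (φ m).1 (a • x) = (φ (star a • m)).1 x
    rw [LinearMap.map_smul φ, Dl.smul_apply, star_star]

lemma Dl.flip_apply (φ : M →ₗ[R] Dl k R N) (m : M) (n : N) : ((Dl.flip φ) n).1 m = (φ m).1 n := rfl

lemma Dl.ev_proj [Module.Projective R P] (i : ℕ) : ∀ (X : Type u) [AddCommGroup X] [Module R X],
    EV R X (Dl k R P) (i + 1) := by
  induction i with
  | zero =>
    intro X _ _
    have hs := SES.ofKer (Finsupp.linearCombination_id_surjective R X)
    refine hs.EV_of_ext (EV.proj _) fun q => ?_
    obtain ⟨r, hr⟩ := Module.projective_lifting_property _ (Dl.flip q) (hs.dual (k := k)).surj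
    refine ⟨Dl.flip r, ?_⟩
    apply LinearMap.ext
    intro x
    apply Dl.ext'
    intro y
    have := LinearMap.congr_fun hr y
    exact DFunLike.congr_fun (congrArg Subtype.val this) x
  | succ i ih =>
    intro X _ _
    have hs := SES.ofKer (Finsupp.linearCombination_id_surjective R X)
    exact hs.con3 (ih _) (EV.proj _)

lemma PDimLE.ev_dual {n : ℕ} : ∀ {M : Type u} [AddCommGroup M] [Module R M], PDimLE R n M →
    ∀ (Z : Type u) [AddCommGroup Z] [Module R Z] (i : ℕ), n < i → EV R Z (Dl k R M) i := by
  induction n with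
  | zero =>
    intro M _ _ h Z _ _ i hi
    obtain ⟨i, rfl⟩ := Nat.exists_eq_add_of_lt hi
    have : Module.Projective R M := h
    rw [zero_add]
    exact Dl.ev_proj _ _
  | succ n ih =>
    intro M _ _ h Z _ _ i hi
    obtain ⟨P, _, _, f, hP, hf, hk⟩ := h
    obtain ⟨i, rfl⟩ := Nat.exists_eq_add_of_lt hi
    exact (SES.ofKer hf).dual.cov1 (Dl.ev_proj _ _) (ih hk Z _ (by omega))

end DU

structure QH (k R : Type u) [Field k] [Ring R] [Algebra k R] [StarRing R] (n : ℕ) where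
  ξ : Fin n → R
  idem : ∀ i, ξ i * ξ i = ξ i
  sum : ∑ i, ξ i = 1
  star : ∀ i, star (ξ i) = ξ i
  Y : Fin n → ModuleCat.{u} R
  y : ∀ i, Y i
  yw : ∀ i, ξ i • y i = y i
  one : ∀ i (z : Y i), ∃ c : k, ξ i • z = algebraMap k R c • y i
  top : ∀ i j, i < j → ∀ z : Y i, ξ j • z = 0
  ker : ∀ i (a : R), a • y i = 0 →
    a * ξ i ∈ Submodule.span R {m : R | ∃ j : Fin n, i.val + 1 ≤ j.val ∧ ξ j • m = m}

section QHS


variable {k R : Type u} [Field k] [Ring R] [Algebra k R] [StarRing R] [SA k R]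
variable {Z M N P MA ML MC : Type u} [AddCommGroup Z] [Module R Z] [AddCommGroup M] [Module R M]
  [AddCommGroup N] [Module R N] [AddCommGroup P] [Module R P]
  [AddCommGroup MA] [Module R MA] [AddCommGroup ML] [Module R ML] [AddCommGroup MC] [Module R MC]
variable {n : ℕ} (Q : QH k R n)

namespace QH

def Tn (M : Type u) [AddCommGroup M] [Module R M] (c : ℕ) : Submodule R M :=
  Submodule.span R {m : M | ∃ j : Fin n, c ≤ j.val ∧ Q.ξ j • m = m}

def Good (M : Type u) [AddCommGroup M] [Module R M] : Prop :=
  ∀ (i : Fin n) (m : M), Q.ξ i • m = m → (∀ φ : M →ₗ[R] Q.Y i, φ m = 0) → m ∈ Q.Tn M (i.val + 1)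

def Low (M : Type u) [AddCommGroup M] [Module R M] (c : ℕ) : Prop :=
  ∀ (j : Fin n), c ≤ j.val → ∀ m : M, Q.ξ j • m = 0

def De (i : Fin n) : Type u := ↥(Submodule.span R {Q.y i})

instance (i : Fin n) : AddCommGroup (Q.De i) :=
  inferInstanceAs (AddCommGroup (Submodule.span R {Q.y i}))
instance (i : Fin n) : Module R (Q.De i) :=
  inferInstanceAs (Module R (Submodule.span R {Q.y i}))

def dy (i : Fin n) : Q.De i := ⟨Q.y i, mem_span_singleton_self _⟩

variable {Q}

lemma xi_idem (i : Fin n) (m : M) : Q.ξ i • Q.ξ i • m = Q.ξ i • m := by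
  rw [← mul_smul, Q.idem]

lemma mem_Tn {c : ℕ} {j : Fin n} (h : c ≤ j.val) (m : M) : Q.ξ j • m ∈ Q.Tn M c :=
  subset_span ⟨j, h, xi_idem j m⟩

lemma Tn_zero : Q.Tn M 0 = ⊤ := by
  rw [eq_top_iff]
  intro m _
  have : m = ∑ i, Q.ξ i • m := by rw [← sum_smul, Q.sum, one_smul]
  rw [this]
  exact Submodule.sum_mem _ fun i _ => mem_Tn (Nat.zero_le _) m

lemma Tn_anti {c c' : ℕ} (h : c ≤ c') : Q.Tn M c' ≤ Q.Tn M c :=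
  span_mono fun _ ⟨j, hj, hm⟩ => ⟨j, h.trans hj, hm⟩

lemma Tn_map (f : M →ₗ[R] N) {c : ℕ} {m : M} (hm : m ∈ Q.Tn M c) : f m ∈ Q.Tn N c := by
  have : Q.Tn M c ≤ (Q.Tn N c).comap f := by
    refine span_le.2 ?_
    rintro x ⟨j, hj, hx⟩
    show f x ∈ Q.Tn N c
    rw [← hx, map_smul]
    exact mem_Tn hj _
  exact this hm

lemma Low.Tn_eq {c : ℕ} (h : Q.Low N c) : Q.Tn N c = ⊥ := by
  rw [eq_bot_iff]
  refine span_le.2 ?_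
  rintro x ⟨j, hj, hx⟩
  rw [← hx, h j hj]
  exact Submodule.zero_mem _

lemma Low.Tn_n : Q.Tn N n = ⊥ :=
  Low.Tn_eq fun j hj => absurd j.2 (by omega)

lemma Low.hom_zero {c : ℕ} (h : Q.Low N c) (f : Q.Tn M c →ₗ[R] N) : f = 0 := by
  ext ⟨x, hx⟩
  show f _ = 0
  induction hx using span_induction with
  | mem x hx =>
    obtain ⟨j, hj, hxx⟩ := hx
    have : (⟨x, subset_span ⟨j, hj, hxx⟩⟩ : Q.Tn M c) =
      Q.ξ j • ⟨x, subset_span ⟨j, hj, hxx⟩⟩ := Subtype.ext hxx.symm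
    rw [this, map_smul, h j hj]
  | zero => exact map_zero f
  | add x y hx hy hh wh =>
    have := map_add f ⟨x, hx⟩ ⟨y, hy⟩
    rw [hh, wh, add_zero] at this
    exact this
  | smul a x hx hh =>
    have := map_smul f a ⟨x, hx⟩
    rw [hh, smul_zero] at this
    exact this

lemma Low.sub {c : ℕ} (h : Q.Low N c) (S : Submodule R N) : Q.Low S c :=
  fun j hj m => Subtype.ext (h j hj m.1)

lemma Low.quot {c : ℕ} (h : Q.Low N c) (S : Submodule R N) : Q.Low (N ⧸ S) c := by
  intro j hj m
  obtain ⟨m, rfl⟩ := Submodule.Quotient.mk_surjective _ m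
  rw [← Submodule.Quotient.mk_smul, h j hj, Submodule.Quotient.mk_zero]

lemma Low.mono {c c' : ℕ} (h : Q.Low N c) (hc : c ≤ c') : Q.Low N c' :=
  fun j hj m => h j (hc.trans hj) m

lemma Low.pi {c h : ℕ} (hN : Q.Low N c) : Q.Low (Fin h → N) c :=
  fun j hj m => funext fun s => hN j hj (m s)

lemma Low.dual {c : ℕ} (h : Q.Low N c) : Q.Low (Dl k R N) c := by
  intro j hj m
  apply Dl.ext'
  intro x
  rw [Dl.smul_apply, Q.star, h j hj, map_zero]; rfl

lemma low_Y (i : Fin n) : Q.Low (Q.Y i) (i.val + 1) := fun j hj z => Q.top i j hj z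

lemma low_De (i : Fin n) : Q.Low (Q.De i) (i.val + 1) := (low_Y i).sub _

lemma ker' (i : Fin n) (a : R) (h : a • Q.y i = 0) (m : M) (hm : Q.ξ i • m = m) :
    a • m ∈ Q.Tn M (i.val + 1) := by
  have := Tn_map (Q := Q) (toSpanSingleton R M m) (Q.ker i a h)
  rwa [LinearMap.toSpanSingleton_apply, mul_smul, hm] at this

lemma De_surj (i : Fin n) (z : Q.De i) : ∃ a : R, a • Q.dy i = z := by
  obtain ⟨z, hz⟩ := z
  obtain ⟨a, ha⟩ := mem_span_singleton.1 hz
  exact ⟨a, Subtype.ext ha⟩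

lemma dy_smul (i : Fin n) (a : R) : a • Q.dy i = 0 ↔ a • Q.y i = 0 := Subtype.ext_iff

lemma dyw (i : Fin n) : Q.ξ i • Q.dy i = Q.dy i := Subtype.ext (Q.yw i)

lemma done (i : Fin n) (z : Q.De i) : ∃ c : k, Q.ξ i • z = algebraMap k R c • Q.dy i := by
  obtain ⟨c, hc⟩ := Q.one i z.1
  exact ⟨c, Subtype.ext hc⟩

lemma exists_hom (i : Fin n) (hM : Q.Low M (i.val + 1)) (m : M) (hm : Q.ξ i • m = m) :
    ∃ f : Q.De i →ₗ[R] M, f (Q.dy i) = m := by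
  have hwd : ∀ a b : R, a • Q.dy i = b • Q.dy i → a • m = b • m := by
    intro a b hab
    rw [← sub_eq_zero, ← sub_smul, dy_smul] at hab
    have := ker' i (a - b) hab m hm
    rw [hM.Tn_eq, Submodule.mem_bot, sub_smul, sub_eq_zero] at this
    exact this
  choose s hs using De_surj (Q := Q) i
  refine ⟨⟨⟨fun z => s z • m, ?_⟩, ?_⟩, ?_⟩
  · intro x y
    rw [← add_smul]; exact hwd _ _ (by rw [add_smul, hs, hs, hs])
  · intro a x
    show s (a • x) • m = a • s x • m
    rw [← mul_smul]; exact hwd _ _ (by rw [mul_smul, hs, hs])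
  · show s _ • m = m
    conv_rhs => rw [← one_smul R m]
    exact hwd _ _ (by rw [hs, one_smul])

lemma Good.retr (a : MA →ₗ[R] ML) (b : ML →ₗ[R] MA) (hab : b ∘ₗ a = LinearMap.id)
    (h : Q.Good ML) : Q.Good MA := by
  intro i m hm hφ
  have := Tn_map b (h i (a m) (by rw [← map_smul, hm]) fun φ => hφ (φ ∘ₗ a))
  rwa [← LinearMap.comp_apply, hab] at this

def Pr (Q : QH k R n) (i : Fin n) : Type u := ↥(Submodule.span R {Q.ξ i})

instance (i : Fin n) : AddCommGroup (Q.Pr i) :=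
  inferInstanceAs (AddCommGroup (Submodule.span R {Q.ξ i}))
instance (i : Fin n) : Module R (Q.Pr i) :=
  inferInstanceAs (Module R (Submodule.span R {Q.ξ i}))

def prin (i : Fin n) : Q.Pr i →ₗ[R] R := (Submodule.span R {Q.ξ i}).subtype

lemma prin_inj (i : Fin n) : Function.Injective (prin (Q := Q) i) := Subtype.val_injective

lemma prin_mul (i : Fin n) (x : Q.Pr i) : prin i x * Q.ξ i = prin i x := by
  obtain ⟨x, hx⟩ := x
  obtain ⟨a, rfl⟩ := mem_span_singleton.1 hx
  show (a * Q.ξ i) * Q.ξ i = a * Q.ξ i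
  rw [mul_assoc, Q.idem]

def prr (i : Fin n) : R →ₗ[R] Q.Pr i :=
  (toSpanSingleton R R (Q.ξ i)).codRestrict (Submodule.span R {Q.ξ i})
    fun a => mem_span_singleton.2 ⟨a, rfl⟩

lemma prin_prr (i : Fin n) (a : R) : prin i (prr (Q := Q) i a) = a * Q.ξ i := rfl

lemma prr_prin (i : Fin n) : prr (Q := Q) i ∘ₗ prin i = LinearMap.id := by
  ext x
  apply prin_inj
  rw [LinearMap.comp_apply, prin_prr, prin_mul]; rfl

instance (i : Fin n) : Module.Projective R (Q.Pr i) :=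
  Module.Projective.of_split (prin i) (prr i) (prr_prin i)

def prde (i : Fin n) : Q.Pr i →ₗ[R] Q.De i :=
  toSpanSingleton R (Q.De i) (Q.dy i) ∘ₗ prin i

lemma prde_surj (i : Fin n) : Surjective (prde (Q := Q) i) := by
  intro z
  obtain ⟨a, rfl⟩ := De_surj i z
  refine ⟨prr i a, ?_⟩
  show (prin (Q := Q) i (prr i a)) • Q.dy i = _
  rw [prin_prr, mul_smul, dyw]

lemma prde_ker (i : Fin n) : LinearMap.ker (prde (Q := Q) i) = Q.Tn (Q.Pr i) (i.val + 1) := by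
  apply le_antisymm
  · intro x hx
    have hh : prin (Q := Q) i x • Q.dy i = 0 := hx
    have wh := Tn_map (Q := Q) (prr (Q := Q) i) (Q.ker i _ ((dy_smul (Q := Q) i _).1 hh))
    rw [prin_mul] at wh
    have wr := LinearMap.congr_fun (prr_prin (Q := Q) i) x
    rw [LinearMap.comp_apply] at wr
    rw [wr] at wh
    exact wh
  · intro x hx
    have := Tn_map (prde (Q := Q) i) hx
    rwa [(low_De i).Tn_eq] at this

lemma ses_De (i : Fin n) : SES (Q.Tn (Q.Pr i) (i.val + 1)).subtype (prde (Q := Q) i) := by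
  have := SES.ofKer (prde_surj (Q := Q) i)
  rwa [prde_ker] at this

end QH

end QHS

section QHT


variable {k R : Type u} [Field k] [Ring R] [Algebra k R] [StarRing R] [SA k R] [Module.Finite k R]
variable {Z M N P MA ML MC : Type u} [AddCommGroup Z] [Module R Z] [AddCommGroup M] [Module R M]
  [AddCommGroup N] [Module R N] [AddCommGroup P] [Module R P]
  [AddCommGroup MA] [Module R MA] [AddCommGroup ML] [Module R ML] [AddCommGroup MC] [Module R MC]
variable {n : ℕ} {Q : QH k R n}

namespace QH

lemma kfin [Module.Finite R M] : ∃ b : ℕ, ∀ (h : ℕ) (m : Fin h → M),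
    (∀ c : Fin h → k, ∑ s, algebraMap k R (c s) • m s = 0 → ∀ s, c s = 0) → h ≤ b := by
  let _ : Module k M := Module.compHom M (algebraMap k R)
  have : IsScalarTower k R M := ⟨fun c r m => by
    show (c • r) • m = algebraMap k R c • r • m
    rw [Algebra.smul_def, mul_smul]⟩
  have : Module.Finite k M := Module.Finite.trans R M
  refine ⟨Module.finrank k M, fun h m hm => ?_⟩
  have : LinearIndependent k m := Fintype.linearIndependent_iff.2 hm
  simpa using this.fintype_card_le_finrank

lemma kbasis [Module.Finite R M] (i : Fin n) : ∃ (h : ℕ) (m : Fin h → M),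
    (∀ s, Q.ξ i • m s = m s) ∧
    (∀ c : Fin h → k, ∑ s, algebraMap k R (c s) • m s = 0 → ∀ s, c s = 0) ∧
    ∀ x : M, Q.ξ i • x = x → ∃ c : Fin h → k, x = ∑ s, algebraMap k R (c s) • m s := by
  let _ : Module k M := Module.compHom M (algebraMap k R)
  have : IsScalarTower k R M := ⟨fun c r m => by
    show (c • r) • m = algebraMap k R c • r • m
    rw [Algebra.smul_def, mul_smul]⟩
  have : Module.Finite k M := Module.Finite.trans R M
  let V : Submodule k M :=
    { carrier := {x | Q.ξ i • x = x}
      add_mem' := by intro a b ha hb; show _ • _ = _; rw [smul_add, ha, hb]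
      zero_mem' := smul_zero _
      smul_mem' := by
        intro c x hx
        show Q.ξ i • algebraMap k R c • x = algebraMap k R c • x
        rw [← mul_smul, ← Algebra.commutes, mul_smul]
        rw [show Q.ξ i • x = x from hx] }
  let b := Module.finBasis k V
  refine ⟨_, fun s => (b s).1, fun s => (b s).2, fun c hc => ?_, fun x hx => ?_⟩
  · have := Fintype.linearIndependent_iff.1 b.linearIndependent c
    apply this
    apply Subtype.ext
    rw [coe_sum]
    exact hc
  · refine ⟨fun s => b.repr ⟨x, hx⟩ s, ?_⟩
    have := congrArg Subtype.val (b.sum_repr ⟨x, hx⟩)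
    rw [coe_sum] at this
    exact this.symm

lemma hom_coef (i : Fin n) (φ : M →ₗ[R] Q.Y i) (m : M) (hm : Q.ξ i • m = m) :
    ∃ c : k, φ m = algebraMap k R c • Q.y i := by
  obtain ⟨c, hc⟩ := Q.one i (φ m)
  exact ⟨c, by rw [← hc, ← map_smul, hm]⟩

def scal (c : k) (φ : M →ₗ[R] N) : M →ₗ[R] N where
  toFun m := algebraMap k R c • φ m
  map_add' x y := by rw [map_add, smul_add]
  map_smul' a x := by
    rw [map_smul, ← mul_smul, Algebra.commutes, mul_smul]; rfl

lemma scal_apply (c : k) (φ : M →ₗ[R] N) (m : M) : scal c φ m = algebraMap k R c • φ m := rfl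

variable (Q) in
structure Sys (M : Type u) [AddCommGroup M] [Module R M] (i : Fin n) (h : ℕ) where
  m : Fin h → M
  φ : Fin h → (M →ₗ[R] Q.Y i)
  mw : ∀ s, Q.ξ i • m s = m s
  bi : ∀ s s', φ s (m s') = if s = s' then Q.y i else 0

lemma Sys.bound [Module.Finite R M] (i : Fin n) (hy : Q.y i ≠ 0) : ∃ b : ℕ, ∀ h, Nonempty (Sys Q M i h) → h ≤ b := by
  obtain ⟨b, hb⟩ := kfin (k := k) (R := R) (M := M)
  refine ⟨b, fun h ⟨S⟩ => hb h S.m fun c hc s => ?_⟩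
  have := congrArg (S.φ s) hc
  rw [map_sum, map_zero] at this
  simp only [map_smul, S.bi, smul_ite, smul_zero] at this
  rw [sum_ite_eq, if_pos (mem_univ _)] at this
  by_contra hcs
  apply hy
  have wh := congrArg (fun x => algebraMap k R (c s)⁻¹ • x) this
  simp only [← mul_smul, ← map_mul, smul_zero] at wh
  rwa [inv_mul_cancel₀ hcs, map_one, one_smul] at wh

lemma Sys.step (hM : Q.Good M) (i : Fin n) {h : ℕ} (S : Sys Q M i h)
    (m : M) (hm : Q.ξ i • m = m)
    (hbad : ∀ c : Fin h → k, m - ∑ s, algebraMap k R (c s) • S.m s ∉ Q.Tn M (i.val + 1)) :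
    Q.y i ≠ 0 ∧ Nonempty (Sys Q M i (h + 1)) := by
  choose c hc using fun s => hom_coef i (S.φ s) m hm
  set m' := m - ∑ s, algebraMap k R (c s) • S.m s with hm'
  have hw : Q.ξ i • m' = m' := by
    rw [hm', smul_sub, hm, smul_sum]
    congr 1
    refine sum_congr rfl fun s _ => ?_
    rw [← mul_smul, ← Algebra.commutes, mul_smul, S.mw]
  have gr : ∀ s, S.φ s m' = 0 := by
    intro s
    rw [hm', map_sub, hc, map_sum]
    simp only [map_smul, S.bi, smul_ite, smul_zero]
    rw [sum_ite_eq, if_pos (mem_univ _), sub_self]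
  have hh : ∃ φ : M →ₗ[R] Q.Y i, φ m' ≠ 0 := by
    by_contra hcon
    push Not at hcon
    exact hbad c (hM i m' hw hcon)
  obtain ⟨φ, hφ⟩ := hh
  obtain ⟨e, he⟩ := hom_coef i φ m' hw
  have hy : Q.y i ≠ 0 := by
    intro h; rw [h, smul_zero] at he; exact hφ he
  have he0 : e ≠ 0 := by
    intro h; rw [h, map_zero, zero_smul] at he; exact hφ he
  choose d hd using fun s => hom_coef i φ (S.m s) (S.mw s)
  refine ⟨hy, ⟨⟨Fin.cons m' S.m, Fin.cons (scal e⁻¹ (φ - ∑ s, scal (d s) (S.φ s))) S.φ, ?_, ?_⟩⟩⟩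
  · intro s
    refine Fin.cases ?_ (fun s => ?_) s
    · simpa using hw
    · simpa using S.mw s
  · intro s s'
    refine Fin.cases ?_ (fun s => ?_) s <;> refine Fin.cases ?_ (fun s' => ?_) s'
    · simp only [Fin.cons_zero, if_true, scal_apply, LinearMap.sub_apply, LinearMap.sum_apply, gr,
        smul_zero, sum_const_zero, sub_zero, he]
      rw [← mul_smul, ← map_mul, inv_mul_cancel₀ he0, map_one, one_smul]
    · simp only [Fin.cons_zero, Fin.cons_succ, scal_apply, LinearMap.sub_apply, LinearMap.sum_apply,
        S.bi, smul_ite, smul_zero, hd]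
      rw [sum_ite_eq', if_pos (mem_univ _), sub_self, smul_zero,
        if_neg (Fin.succ_ne_zero _).symm]
    · simp only [Fin.cons_zero, Fin.cons_succ, gr]
      rw [if_neg (Fin.succ_ne_zero _)]
    · simp only [Fin.cons_succ, S.bi, Fin.succ_inj]

lemma Sys.exists [Module.Finite R M] (hM : Q.Good M) (i : Fin n) : ∃ (h : ℕ) (S : Sys Q M i h),
    ∀ m : M, Q.ξ i • m = m →
      ∃ c : Fin h → k, m - ∑ s, algebraMap k R (c s) • S.m s ∈ Q.Tn M (i.val + 1) := by
  by_contra hcon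
  push Not at hcon
  have hh : ∀ h, Nonempty (Sys Q M i h) → Q.y i ≠ 0 ∧ Nonempty (Sys Q M i (h + 1)) := by
    rintro h ⟨S⟩
    obtain ⟨m, hm, hb⟩ := hcon h S
    exact S.step hM i m hm hb
  have gr : Nonempty (Sys Q M i 0) := ⟨⟨Fin.elim0, Fin.elim0, fun s => s.elim0, fun s => s.elim0⟩⟩
  obtain ⟨b, hb⟩ := Sys.bound (M := M) i (hh 0 gr).1
  have wh : ∀ h, Nonempty (Sys Q M i h) := fun h => by
    induction h with
    | zero => exact gr
    | succ h ih => exact (hh h ih).2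
  have := hb _ (wh (b + 1))
  omega

lemma Tn_Y (i : Fin n) {z : Q.Y i} (hz : z ∈ Q.Tn (Q.Y i) i.val) :
    z ∈ Submodule.span R {Q.y i} := by
  have : Q.Tn (Q.Y i) i.val ≤ Submodule.span R {Q.y i} := by
    refine span_le.2 ?_
    rintro x ⟨j, hj, hx⟩
    rcases Nat.lt_or_eq_of_le hj with h | h
    · rw [← hx, Q.top i j h]; exact Submodule.zero_mem _
    · have : i = j := Fin.ext h
      subst this
      obtain ⟨c, hc⟩ := Q.one i x
      rw [← hx, hc]
      exact smul_mem _ _ (mem_span_singleton_self _)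
  exact this hz

lemma ses_Tn [Module.Finite R M] (hM : Q.Good M) (i : Fin n) :
    ∃ (h : ℕ) (g : Q.Tn M i.val →ₗ[R] (Fin h → Q.De i)),
      SES (Submodule.inclusion (Tn_anti (Q := Q) (M := M) (Nat.le_succ i.val))) g := by
  obtain ⟨h, S, hS⟩ := Sys.exists hM i
  let g : Q.Tn M i.val →ₗ[R] (Fin h → Q.De i) := LinearMap.pi fun s =>
    LinearMap.codRestrict (Submodule.span R {Q.y i}) (S.φ s ∘ₗ (Q.Tn M i.val).subtype)
      fun x => Tn_Y i (Tn_map (S.φ s) x.2)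
  have hg : ∀ x s, (g x s).1 = S.φ s x.1 := fun x s => rfl
  have hmem : ∀ s, S.m s ∈ Q.Tn M i.val := fun s => subset_span ⟨i, le_rfl, S.mw s⟩
  have hspan : ∀ x : M, x ∈ Q.Tn M i.val →
      ∃ a : Fin h → R, x - ∑ s, a s • S.m s ∈ Q.Tn M (i.val + 1) := by
    intro x hx
    induction hx using span_induction with
    | mem x hx =>
      obtain ⟨j, hj, hx⟩ := hx
      rcases Nat.lt_or_eq_of_le hj with h | h
      · refine ⟨0, ?_⟩
        simp only [Pi.zero_apply, zero_smul, sum_const_zero, sub_zero]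
        exact subset_span ⟨j, h, hx⟩
      · have : i = j := Fin.ext h
        subst this
        obtain ⟨c, hc⟩ := hS x hx
        exact ⟨_, hc⟩
    | zero => exact ⟨0, by simp⟩
    | add x y _ _ hx hy =>
      obtain ⟨a, ha⟩ := hx
      obtain ⟨b, hb⟩ := hy
      refine ⟨a + b, ?_⟩
      have := Submodule.add_mem _ ha hb
      simp only [Pi.add_apply, add_smul, sum_add_distrib]
      convert this using 1
      abel
    | smul r x _ hx =>
      obtain ⟨a, ha⟩ := hx
      refine ⟨fun s => r * a s, ?_⟩
      have := smul_mem _ r ha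
      simp only [mul_smul, ← smul_sum, ← smul_sub]
      exact this
  refine ⟨h, g, inclusion_injective _, ?_, ?_⟩
  · intro x
    constructor
    · intro hx
      obtain ⟨a, ha⟩ := hspan x.1 x.2
      have hh : ∀ s, a s • Q.y i = 0 := by
        intro s
        have wh : S.φ s (x.1 - ∑ s, a s • S.m s) = 0 := by
          have := Tn_map (S.φ s) ha
          rwa [(low_Y i).Tn_eq] at this
        rw [map_sub, ← hg, hx, map_sum] at wh
        simp only [map_smul, S.bi, smul_ite, smul_zero] at wh
        rw [sum_ite_eq, if_pos (mem_univ _)] at wh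
        have wr : ((0 : Fin h → Q.De i) s).1 = (0 : Q.Y i) := rfl
        rw [wr, zero_sub, neg_eq_zero] at wh
        exact wh
      have wh : x.1 ∈ Q.Tn M (i.val + 1) := by
        have wr := Submodule.add_mem _ ha
          (Submodule.sum_mem (Q.Tn M (i.val + 1)) (t := univ) fun s _ => ker' i (a s) (hh s) (S.m s) (S.mw s))
        rwa [sub_add_cancel] at wr
      exact ⟨⟨x.1, wh⟩, rfl⟩
    · rintro ⟨y, rfl⟩
      funext s
      apply Subtype.ext
      rw [hg]
      have := Tn_map (S.φ s) y.2
      rwa [(low_Y i).Tn_eq] at this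
  · intro z
    choose a ha using fun s => De_surj i (z s)
    refine ⟨∑ s, a s • ⟨S.m s, hmem s⟩, ?_⟩
    funext s
    apply Subtype.ext
    rw [hg, ← ha s, coe_sum]
    simp only [Submodule.coe_smul, map_sum, map_smul, S.bi, smul_ite, smul_zero]
    rw [sum_ite_eq, if_pos (mem_univ _)]
    rfl

lemma EV_Tn [Module.Finite R M] (hM : Q.Good M) (a : ℕ) (m : ℕ) : ∀ c, n ≤ c + m →
    (∀ i : Fin n, c ≤ i.val → EV R (Q.De i) Z a) → EV R (Q.Tn M c) Z a := by
  induction m with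
  | zero =>
    intro c hc _
    have : Subsingleton (Q.Tn M c) := by
      have : Q.Tn M c = ⊥ := by
        rw [eq_bot_iff, ← Low.Tn_n (Q := Q)]; exact Tn_anti hc
      rw [this]; infer_instance
    exact EV.sub_left a
  | succ m ih =>
    intro c hc H
    by_cases hcn : c < n
    · obtain ⟨h, g, hs⟩ := ses_Tn hM ⟨c, hcn⟩
      exact hs.con2 (ih (c + 1) (by omega) fun i hi => H i (by omega))
        (EV.pi_left h a (H ⟨c, hcn⟩ le_rfl))
    · exact ih c (by omega) H

lemma EV_pi_dual (h a : ℕ) (H : EV R Z (Dl k R M) a) : EV R Z (Dl k R (Fin h → M)) a := by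
  refine EV.retr_right a
    (LinearMap.pi fun s => Dl.map k (LinearMap.single R (fun _ => M) s))
    (∑ s, Dl.map k (LinearMap.proj (R := R) (φ := fun _ : Fin h => M) s) ∘ₗ LinearMap.proj s) ?_
    (EV.pi_right h a H)
  apply LinearMap.ext
  intro f
  apply Dl.ext'
  intro m
  rw [LinearMap.comp_apply, LinearMap.sum_apply, LinearMap.id_apply]
  have hh : ∀ (S : Finset (Fin h)) (F : Fin h → Dl k R (Fin h → M)),
      (∑ s ∈ S, F s).1 m = ∑ s ∈ S, (F s).1 m := by
    intro S F
    classical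
    induction S using induction_on with
    | empty => rfl
    | insert x S hx ih => rw [sum_insert hx, sum_insert hx, Dl.add_apply, ih]
  rw [hh]
  have wh : m = ∑ s, LinearMap.single R (fun _ => M) s (m s) := by
    funext l
    rw [Finset.sum_apply]
    simp [Pi.single_apply]
  conv_rhs => rw [wh, map_sum]
  rfl

lemma EV_Tn_dual [Module.Finite R M] (hM : Q.Good M) (a : ℕ) (m : ℕ) : ∀ c, n ≤ c + m →
    (∀ i : Fin n, c ≤ i.val → EV R Z (Dl k R (Q.De i)) a) → EV R Z (Dl k R (Q.Tn M c)) a := by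
  induction m with
  | zero =>
    intro c hc _
    have : Subsingleton (Q.Tn M c) := by
      have : Q.Tn M c = ⊥ := by
        rw [eq_bot_iff, ← Low.Tn_n (Q := Q)]; exact Tn_anti hc
      rw [this]; infer_instance
    have : Subsingleton (Dl k R (Q.Tn M c)) := ⟨fun f g => Dl.ext' fun m => by
      rw [Subsingleton.elim m 0, map_zero, map_zero]⟩
    exact EV.sub_right a
  | succ m ih =>
    intro c hc H
    by_cases hcn : c < n
    · obtain ⟨h, g, hs⟩ := ses_Tn hM ⟨c, hcn⟩
      exact hs.dual.cov2 (EV_pi_dual h a (H ⟨c, hcn⟩ le_rfl))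
        (ih (c + 1) (by omega) fun i hi => H i (by omega))
    · exact ih c (by omega) H

instance (i : Fin n) : Module.Finite R (Q.Pr i) :=
  Module.Finite.of_surjective (prr i) fun x => ⟨prin i x, LinearMap.congr_fun (prr_prin i) x⟩

instance (i : Fin n) : Module.Finite R (Q.De i) :=
  Module.Finite.of_surjective (prde i) (prde_surj i)

lemma good_Pr (hR : Q.Good R) (i : Fin n) : Q.Good (Q.Pr i) := hR.retr (prin i) (prr i) (prr_prin i)

lemma E1 (hR : Q.Good R) (a : ℕ) : ∀ (i : Fin n) (N : Type u) [AddCommGroup N] [Module R N],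
    Q.Low N (i.val + 1) → EV R (Q.De i) N (a + 1) := by
  induction a with
  | zero =>
    intro i N _ _ hN
    exact (ses_De i).con3 (EV.zero_iff.2 fun f => hN.hom_zero f) (EV.proj _)
  | succ a ih =>
    intro i N _ _ hN
    refine (ses_De i).con3 (EV_Tn (good_Pr hR i) _ n _ (by omega) fun j hj => ?_) (EV.proj _)
    exact ih j N (hN.mono (by omega))

lemma E2 (hR : Q.Good R) (a : ℕ) : ∀ (j : Fin n) (M : Type u) [AddCommGroup M] [Module R M],
    Q.Low M (j.val + 1) → EV R M (Dl k R (Q.De j)) (a + 1) := by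
  induction a with
  | zero =>
    intro i N _ _ hN
    refine (ses_De i).dual.cov1 (Dl.ev_proj _ _) (EV.zero_iff.2 fun f => ?_)
    have := hN.dual.hom_zero (Dl.flip f)
    apply LinearMap.ext
    intro m
    apply Dl.ext'
    intro x
    rw [← Dl.flip_apply f, this]; rfl
  | succ a ih =>
    intro i N _ _ hN
    refine (ses_De i).dual.cov1 (Dl.ev_proj _ _)
      (EV_Tn_dual (good_Pr hR i) _ n _ (by omega) fun j hj => ?_)
    exact ih j N (hN.mono (by omega))

theorem EV_good (hR : Q.Good R) [Module.Finite R M] [Module.Finite R N] (hM : Q.Good M)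
    (hN : Q.Good N) (a : ℕ) : EV R M (Dl k R N) (a + 1) := by
  have hh : EV R (Q.Tn M 0) (Dl k R (Q.Tn N 0)) (a + 1) := by
    refine EV_Tn hM _ n _ (by omega) fun i _ => ?_
    refine EV_Tn_dual hN _ n _ (by omega) fun j _ => ?_
    rcases le_total i.val j.val with h | h
    · exact E2 hR a j _ ((low_De i).mono (by omega))
    · exact E1 hR a i _ ((low_De j).dual.mono (by omega))
  rw [Tn_zero, Tn_zero] at hh
  have es := topEquiv (R := R) (M := M)
  have e2 := topEquiv (R := R) (M := N)
  refine EV.equiv_left _ es.symm (EV.retr_right _ (Dl.map k e2.toLinearMap)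
    (Dl.map k e2.symm.toLinearMap) ?_ hh)
  apply LinearMap.ext
  intro f
  apply Dl.ext'
  intro m
  show f.1 (e2 (e2.symm m)) = f.1 m
  simp

lemma EV_De (hR : Q.Good R) (m : ℕ) : ∀ (i : Fin n), n ≤ i.val + m → ∀ a, m < a →
    EV R (Q.De i) Z a := by
  induction m with
  | zero => intro i hi; omega
  | succ m ih =>
    intro i hi a ha
    obtain ⟨a, rfl⟩ : ∃ a', a = a' + 1 := ⟨a - 1, by omega⟩
    exact (ses_De i).con3 (EV_Tn (good_Pr hR i) _ n _ (by omega)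
      fun j hj => ih j (by omega) a (by omega)) (EV.proj _)

lemma EV_Low (hR : Q.Good R) (c : ℕ) : ∀ (M : Type u) [AddCommGroup M] [Module R M],
    Module.Finite R M → Q.Low M c → ∀ a, n + c < a → EV R M Z a := by
  have : IsNoetherianRing R := isNoetherian_of_tower k inferInstance
  induction c with
  | zero =>
    intro M _ _ _ hM a _
    have : Subsingleton M := by
      refine subsingleton_of_forall_eq 0 fun m => ?_
      rw [← one_smul R m, ← Q.sum, sum_smul]
      exact sum_eq_zero fun i _ => hM i (Nat.zero_le _) m
    exact EV.sub_left a
  | succ c ih =>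
    intro M _ _ hfin hM a ha
    by_cases hcn : c < n
    · obtain ⟨a, rfl⟩ : ∃ a', a = a' + 1 := ⟨a - 1, by omega⟩
      obtain ⟨h, m, hm, hind, hsp⟩ := kbasis (Q := Q) (M := M) ⟨c, hcn⟩
      choose f hf using fun s => exists_hom (Q := Q) ⟨c, hcn⟩ hM (m s) (hm s)
      let F : (Fin h → Q.De ⟨c, hcn⟩) →ₗ[R] M := ∑ s, f s ∘ₗ LinearMap.proj s
      have hF : ∀ z, F z = ∑ s, f s (z s) := fun z => by
        simp [F, LinearMap.sum_apply]
      have hk : Q.Low (LinearMap.ker F) c := by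
        intro j hj z
        rcases Nat.lt_or_eq_of_le hj with h | h
        · exact ((low_De ⟨c, hcn⟩).pi.sub _) j h z
        · have : j = ⟨c, hcn⟩ := Fin.ext h.symm
          subst this
          apply Subtype.ext
          choose e he using fun s => done (Q := Q) _ (z.1 s)
          have hh : F (Q.ξ ⟨c, hcn⟩ • z.1) = 0 := by
            rw [map_smul, show F z.1 = 0 from z.2, smul_zero]
          rw [hF] at hh
          have wh : ∑ s, algebraMap k R (e s) • m s = 0 := by
            rw [← hh]
            refine sum_congr rfl fun s _ => ?_
            rw [Pi.smul_apply, he s, map_smul, hf]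
          funext s
          show Q.ξ _ • z.1 s = 0
          rw [he s, hind e wh s, map_zero, zero_smul]
      have hc : Q.Low (M ⧸ LinearMap.range F) c := by
        intro j hj z
        rcases Nat.lt_or_eq_of_le hj with h | h
        · exact (hM.quot _) j h z
        · have : j = ⟨c, hcn⟩ := Fin.ext h.symm
          subst this
          obtain ⟨x, rfl⟩ := Submodule.Quotient.mk_surjective _ z
          rw [← Submodule.Quotient.mk_smul, Submodule.Quotient.mk_eq_zero]
          obtain ⟨e, he⟩ := hsp _ (xi_idem (Q := Q) ⟨c, hcn⟩ x)
          rw [he]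
          refine ⟨fun s => algebraMap k R (e s) • Q.dy _, ?_⟩
          rw [hF]
          refine sum_congr rfl fun s _ => ?_
          rw [map_smul, hf]
      have s1 := SES.ofKer (surjective_rangeRestrict F)
      rw [ker_rangeRestrict] at s1
      have hh : EV R (LinearMap.range F) Z (a + 1) :=
        s1.con3 (ih _ inferInstance hk a (by omega))
          (EV.pi_left h _ (EV_De hR n _ (by omega) _ (by omega)))
      exact (SES.ofSub (LinearMap.range F)).con2 hh (ih _ inferInstance hc _ (by omega))
    · exact ih M hfin (fun j hj => by omega) a (by omega)

theorem EV_fin (hR : Q.Good R) [hM : Module.Finite R M] (a : ℕ) (ha : n + n < a) :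
    EV R M Z a := EV_Low hR n M hM (fun j hj => by omega) a ha

end QH

end QHT

/-- place-permutation invariant matrices -/
def Bs (k : Type u) [Field k] (d t : ℕ) :
    Subalgebra k (Matrix (Fin d → Fin t) (Fin d → Fin t) k) where
  carrier := {a | ∀ (σ : Equiv.Perm (Fin d)) (i j : Fin d → Fin t), a (i ∘ σ) (j ∘ σ) = a i j}
  mul_mem' := by
    intro a b ha hb σ i j
    rw [Matrix.mul_apply, Matrix.mul_apply]
    rw [← Equiv.sum_comp (Equiv.arrowCongr σ.symm (Equiv.refl (Fin t)))]
    refine sum_congr rfl fun l _ => ?_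
    have : (Equiv.arrowCongr σ.symm (Equiv.refl (Fin t))) l = l ∘ σ := rfl
    rw [this, ha, hb]
  add_mem' := by
    intro a b ha hb σ i j
    rw [Matrix.add_apply, Matrix.add_apply, ha, hb]
  algebraMap_mem' := by
    intro c σ i j
    rw [Matrix.algebraMap_matrix_apply, Matrix.algebraMap_matrix_apply]
    have : i ∘ σ = j ∘ σ ↔ i = j := (Equiv.arrowCongr σ.symm (Equiv.refl (Fin t))).injective.eq_iff
    simp only [this]

def BB (k : Type u) [Field k] (d t : ℕ) : Type u := ↥(Bs k d t)

abbrev XX (k : Type u) (d t : ℕ) : Type u := (Fin d → Fin t) → k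

section SB

variable {k : Type u} [Field k] {d t : ℕ}

lemma sum_perm {W : Type*} [AddCommMonoid W] {A : Type*} [Fintype A] (σ : Equiv.Perm (Fin d))
    (f : (Fin d → A) → W) : ∑ i, f (i ∘ σ) = ∑ i, f i :=
  Equiv.sum_comp (Equiv.arrowCongr σ.symm (Equiv.refl A)) f

lemma comp_perm_eq {A : Type*} (σ : Equiv.Perm (Fin d)) {i j : Fin d → A} :
    i ∘ σ = j ∘ σ ↔ i = j :=
  (Equiv.arrowCongr σ.symm (Equiv.refl A)).injective.eq_iff

instance : Ring (BB k d t) := inferInstanceAs (Ring (Bs k d t))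
instance : Algebra k (BB k d t) := inferInstanceAs (Algebra k (Bs k d t))
instance : Module.Finite k (BB k d t) := inferInstanceAs (Module.Finite k (Bs k d t))
instance : IsNoetherianRing (BB k d t) := isNoetherian_of_tower k inferInstance

def BB.mk (a : Matrix (Fin d → Fin t) (Fin d → Fin t) k)
    (h : ∀ (σ : Equiv.Perm (Fin d)) (i j : Fin d → Fin t), a (i ∘ σ) (j ∘ σ) = a i j) : BB k d t :=
  ⟨a, h⟩

def BB.e (a : BB k d t) (i j : Fin d → Fin t) : k :=
  (show Matrix (Fin d → Fin t) (Fin d → Fin t) k from Subtype.val a) i j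

lemma BB.ext' {a b : BB k d t} (h : ∀ i j, a.e i j = b.e i j) : a = b :=
  Subtype.ext (Matrix.ext h)

lemma BB.inv (a : BB k d t) (σ : Equiv.Perm (Fin d)) (i j : Fin d → Fin t) :
    a.e (i ∘ σ) (j ∘ σ) = a.e i j := a.2 σ i j

lemma BB.mul_apply (a b : BB k d t) (i j) : (a * b).e i j = ∑ l, a.e i l * b.e l j := rfl
lemma BB.add_apply (a b : BB k d t) (i j) : (a + b).e i j = a.e i j + b.e i j := rfl
lemma BB.one_apply (i j) : (1 : BB k d t).e i j = if i = j then 1 else 0 := rfl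
lemma BB.algebraMap_apply (c : k) (i j) :
    (algebraMap k (BB k d t) c).e i j = if i = j then c else 0 :=
  Matrix.algebraMap_matrix_apply

instance : StarRing (BB k d t) where
  star a := ⟨a.1.transpose, fun σ i j => a.2 σ j i⟩
  star_involutive a := BB.ext' fun _ _ => rfl
  star_mul a b := Subtype.ext (Matrix.transpose_mul _ _)
  star_add a b := BB.ext' fun _ _ => rfl

lemma BB.star_apply (a : BB k d t) (i j) : (star a).e i j = a.e j i := rfl

instance : SA k (BB k d t) where
  star_map c := BB.ext' fun i j => by
    rw [BB.star_apply, BB.algebraMap_apply, BB.algebraMap_apply]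
    simp only [eq_comm]

instance : Module (BB k d t) (XX k d t) where
  smul a x := a.1.mulVec x
  one_smul x := Matrix.one_mulVec x
  mul_smul a b x := (Matrix.mulVec_mulVec x a.1 b.1).symm
  smul_zero a := Matrix.mulVec_zero a.1
  smul_add a x y := Matrix.mulVec_add a.1 x y
  add_smul a b x := Matrix.add_mulVec a.1 b.1 x
  zero_smul x := Matrix.zero_mulVec x

lemma XX.smul_apply (a : BB k d t) (x : XX k d t) (i) : (a • x) i = ∑ j, a.e i j * x j := rfl
lemma XX.add_apply (x y : XX k d t) (i) : (x + y) i = x i + y i := rfl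
lemma XX.sub_apply (x y : XX k d t) (i) : (x - y) i = x i - y i := rfl
lemma XX.neg_apply (x : XX k d t) (i) : (-x) i = - x i := rfl
lemma XX.zero_apply (i) : (0 : XX k d t) i = 0 := rfl
lemma XX.sum_apply {ι : Type*} (s : Finset ι) (f : ι → XX k d t) (i) :
    (∑ c ∈ s, f c) i = ∑ c ∈ s, f c i := Finset.sum_apply (M := fun _ => k) i s f
lemma XX.scal_apply (c : k) (x : XX k d t) (i) : (algebraMap k (BB k d t) c • x) i = c * x i := by
  rw [XX.smul_apply]
  simp only [BB.algebraMap_apply, ite_mul, zero_mul]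
  rw [sum_ite_eq, if_pos (mem_univ _)]

/-- place permutation -/
def pp (σ : Equiv.Perm (Fin d)) : XX k d t →ₗ[BB k d t] XX k d t where
  toFun x i := x (i ∘ σ)
  map_add' _ _ := rfl
  map_smul' a x := by
    funext i
    rw [RingHom.id_apply, XX.smul_apply, XX.smul_apply, ← sum_perm σ]
    simp only [BB.inv]

lemma pp_apply (σ : Equiv.Perm (Fin d)) (x : XX k d t) (i) : pp σ x i = x (i ∘ σ) := rfl

/-- the standard form -/
def frm (x y : XX k d t) : k := ∑ i, x i * y i

lemma frm_smul (a : BB k d t) (x y : XX k d t) : frm (a • x) y = frm x (star a • y) := by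
  unfold frm
  simp only [XX.smul_apply, sum_mul, mul_sum]
  rw [sum_comm]
  refine sum_congr rfl fun i _ => sum_congr rfl fun j _ => ?_
  rw [BB.star_apply]; ring

lemma frm_comm (x y : XX k d t) : frm x y = frm y x := by
  unfold frm; simp only [mul_comm]

lemma frm_add_left (x x' y : XX k d t) : frm (x + x') y = frm x y + frm x' y := by
  unfold frm; simp only [XX.add_apply, add_mul, sum_add_distrib]
lemma frm_add_right (x y y' : XX k d t) : frm x (y + y') = frm x y + frm x y' := by
  unfold frm; simp only [XX.add_apply, mul_add, sum_add_distrib]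
lemma frm_scal_right (c : k) (x y : XX k d t) :
    frm x (algebraMap k (BB k d t) c • y) = c * frm x y := by
  unfold frm; rw [mul_sum]
  refine sum_congr rfl fun i _ => ?_
  rw [XX.scal_apply]; ring

/-- unit vector -/
def ee (i : Fin d → Fin t) : XX k d t := fun j => if j = i then 1 else 0

lemma frm_ee (i : Fin d → Fin t) (x : XX k d t) : frm (ee i) x = x i := by
  unfold frm ee; simp only [ite_mul, one_mul, zero_mul]; rw [sum_ite_eq', if_pos (mem_univ _)]

lemma sm_ee (a : BB k d t) (i j : Fin d → Fin t) : (a • (ee i : XX k d t)) j = a.e j i := by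
  rw [XX.smul_apply]; simp [ee]

lemma ee_sum (x : XX k d t) : x = ∑ i, algebraMap k (BB k d t) (x i) • ee i := by
  funext j
  rw [XX.sum_apply]
  simp only [XX.scal_apply, ee, mul_ite, mul_one, mul_zero]
  rw [sum_ite_eq, if_pos (mem_univ _)]

/-- r : X → Dl -/
def xdl : XX k d t →ₗ[BB k d t] Dl k (BB k d t) (XX k d t) where
  toFun x := ⟨⟨⟨fun y => frm x y, by simp [frm, XX.zero_apply]⟩, fun y y' => frm_add_right x y y'⟩,
    fun c y => frm_scal_right c x y⟩
  map_add' x x' := Dl.ext' fun y => frm_add_left x x' y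
  map_smul' a x := Dl.ext' fun y => frm_smul a x y

lemma xdl_apply (x y : XX k d t) : (xdl x).1 y = frm x y := rfl

lemma xdl_surj : Surjective (xdl (k := k) (d := d) (t := t)) := by
  intro q
  refine ⟨fun i => q.1 (ee i), Dl.ext' fun y => ?_⟩
  conv_rhs => rw [ee_sum y, map_sum]
  simp only [q.2]
  rw [xdl_apply, frm]
  exact sum_congr rfl fun i _ => mul_comm _ _

instance : Module.Finite (BB k d t) (XX k d t) := by
  classical
  refine ⟨⟨univ.image fun i => ee i, ?_⟩⟩
  rw [eq_top_iff]
  intro x _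
  rw [ee_sum x]
  refine Submodule.sum_mem _ fun i _ => smul_mem _ _ (subset_span ?_)
  simp

/-- tensor power element -/
def tp (A : Matrix (Fin t) (Fin t) k) : BB k d t :=
  BB.mk (fun i j => ∏ b, A (i b) (j b)) fun σ i j => by
    exact Equiv.prod_comp σ fun b => A (i b) (j b)

end SB

section SF
open Equiv

variable {k : Type u} [Field k] {d t : ℕ}

lemma exists_perm {A : Type*} [DecidableEq A] (f g : Fin d → A)
    (h : ∀ x, (univ.filter fun b => f b = x).card = (univ.filter fun b => g b = x).card) :
    ∃ σ : Perm (Fin d), f = g ∘ σ := by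
  have hh : ∀ x, Nonempty ({b // f b = x} ≃ {b // g b = x}) := fun x => by
    refine ⟨Fintype.equivOfCardEq ?_⟩
    rw [Fintype.card_subtype, Fintype.card_subtype, h]
  let e := fun x => (hh x).some
  refine ⟨(Equiv.sigmaFiberEquiv f).symm.trans ((Equiv.sigmaCongrRight e).trans
    (Equiv.sigmaFiberEquiv g)), ?_⟩
  funext b
  exact ((e (f b)) ⟨b, rfl⟩).2.symm

lemma stab_ind {A : Type*} (lb : Fin d → A) (P : Perm (Fin d) → Prop) (hh : P 1)
    (hs : ∀ a b τ, a ≠ b → lb a = lb b → P τ → P (swap a b * τ)) :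
    ∀ τ : Perm (Fin d), lb ∘ τ = lb → P τ := by
  suffices H : ∀ (m : ℕ) (τ : Perm (Fin d)), τ.support.card ≤ m → lb ∘ τ = lb → P τ from
    fun τ => H _ τ le_rfl
  intro m
  induction m with
  | zero =>
    intro τ hτ _
    have : τ = 1 := Perm.card_support_eq_zero.1 (by omega)
    rw [this]; exact hh
  | succ m ih =>
    intro τ hτ hℓ
    by_cases h : τ = 1
    · rw [h]; exact hh
    · obtain ⟨a, ha⟩ : ∃ a, τ a ≠ a := by
        by_contra hc; push Not at hc; exact h (Equiv.ext hc)
      have hla : lb (τ a) = lb a := congrFun hℓ a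
      have wh := Perm.card_support_swap_mul ha
      have wr : lb ∘ (swap a (τ a) * τ : Perm (Fin d)) = lb := by
        funext b
        show lb (swap a (τ a) (τ b)) = lb b
        rw [← congrFun hℓ b]
        show _ = lb (τ b)
        rcases Equiv.swap_apply_eq_iff (x := a) (y := τ a) (z := τ b) (w := τ b) with _
        by_cases hb1 : τ b = a
        · rw [hb1, swap_apply_left, hla]
        · by_cases hb2 : τ b = τ a
          · rw [hb2, swap_apply_right, hla]
          · rw [swap_apply_of_ne_of_ne hb1 hb2]
      have := hs a (τ a) _ (Ne.symm ha) hla.symm (ih _ (by omega) wr)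
      rwa [← mul_assoc, swap_mul_self, one_mul] at this

/-- sign in k -/
def sg (σ : Perm (Fin d)) : k := ((Perm.sign σ : ℤˣ) : ℤ)

lemma sg_one : (sg (1 : Perm (Fin d)) : k) = 1 := by simp [sg]
lemma sg_mul (σ τ : Perm (Fin d)) : (sg (σ * τ) : k) = sg σ * sg τ := by simp [sg]
lemma sg_swap {a b : Fin d} (h : a ≠ b) : (sg (swap a b) : k) = -1 := by simp [sg, Perm.sign_swap h]
lemma sg_inv (σ : Perm (Fin d)) : (sg σ⁻¹ : k) = sg σ := by simp [sg]
lemma sg_sq (σ : Perm (Fin d)) : (sg σ * sg σ : k) = 1 := by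
  nth_rewrite 1 [← sg_inv]
  rw [← sg_mul, inv_mul_cancel, sg_one]

structure IsF (lb : Fin d → ℕ) (x : XX k d t) : Prop where
  ev : ∀ a b, a ≠ b → lb a = lb b → Even (lb a) → ∀ i, x (i ∘ swap a b) = x i
  od : ∀ a b, a ≠ b → lb a = lb b → ¬ Even (lb a) → ∀ i, x (i ∘ swap a b) = - x i
  van : ∀ a b, a ≠ b → lb a = lb b → ¬ Even (lb a) → ∀ i, i a = i b → x i = 0

lemma swap_eq {A : Type*} {i : Fin d → A} {a b : Fin d} (h : i a = i b) : i ∘ swap a b = i := by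
  funext c
  show i (swap a b c) = i c
  by_cases hb1 : c = a
  · rw [hb1, swap_apply_left, h]
  · by_cases hb2 : c = b
    · rw [hb2, swap_apply_right, h]
    · rw [swap_apply_of_ne_of_ne hb1 hb2]

lemma swap_swap' {A : Type*} (i : Fin d → A) (a b : Fin d) : (i ∘ swap a b) ∘ swap a b = i := by
  funext c; simp

lemma eq_of_swap {A : Type*} {i : Fin d → A} {a b : Fin d} (h : i ∘ swap a b = i) : i a = i b := by
  have := congrFun h a
  rw [Function.comp_apply, swap_apply_left] at this
  exact this.symm

/-- alternating sums vanish -/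
lemma sum_van {A : Type*} [Fintype A] (a b : Fin d) (f : (Fin d → A) → k)
    (h : ∀ j, f (j ∘ swap a b) = - f j) (h' : ∀ j, j a = j b → f j = 0) : ∑ j, f j = 0 := by
  classical
  refine sum_involution (fun j _ => j ∘ swap a b) ?_ ?_ ?_ ?_
  · intro j _; rw [h]; ring
  · intro j _ hj hc
    exact hj (h' j (eq_of_swap hc))
  · intro j _; exact mem_univ _
  · intro j _; exact swap_swap' j a b

def FF (k : Type u) [Field k] (t : ℕ) (lb : Fin d → ℕ) : Submodule (BB k d t) (XX k d t) where
  carrier := {x | IsF lb x}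
  zero_mem' := ⟨by intros; rfl, by intros; simp, by intros; rfl⟩
  add_mem' := by
    intro x y hx hy
    refine ⟨?_, ?_, ?_⟩
    · intro a b hh wh wr i
      rw [XX.add_apply, XX.add_apply, hx.ev a b hh wh wr, hy.ev a b hh wh wr]
    · intro a b hh wh wr i
      rw [XX.add_apply, XX.add_apply, hx.od a b hh wh wr, hy.od a b hh wh wr]; ring
    · intro a b hh wh wr i hi
      rw [XX.add_apply, hx.van a b hh wh wr i hi, hy.van a b hh wh wr i hi, add_zero]
  smul_mem' := by
    intro r x hx
    refine ⟨?_, ?_, ?_⟩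
    · intro a b hh wh wr i
      show (pp (swap a b) (r • x)) i = _
      rw [map_smul]
      have : pp (swap a b) x = x := by funext j; exact hx.ev a b hh wh wr j
      rw [this]
    · intro a b hh wh wr i
      have : pp (swap a b) x = - x := by funext j; exact hx.od a b hh wh wr j
      show (pp (swap a b) (r • x)) i = _
      rw [map_smul, this, smul_neg]; rfl
    · intro a b hh wh wr i hi
      rw [XX.smul_apply]
      refine sum_van a b _ ?_ ?_
      · intro j
        rw [hx.od a b hh wh wr j, mul_neg]
        congr 2
        have := r.inv (swap a b) i j
        rwa [swap_eq hi] at this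
      · intro j hj
        rw [hx.van a b hh wh wr j hj, mul_zero]

lemma mem_FF {lb : Fin d → ℕ} {x : XX k d t} : x ∈ FF k t lb ↔ IsF lb x := Iff.rfl

/-- purely odd labels -/
def AllOdd (lb : Fin d → ℕ) : Prop := ∀ a, ¬ Even (lb a)

lemma IsF.stab {lb : Fin d → ℕ} (hℓ : AllOdd lb) {x : XX k d t} (hx : IsF lb x) :
    ∀ τ : Perm (Fin d), lb ∘ τ = lb → ∀ i, x (i ∘ τ) = sg τ * x i := by
  refine stab_ind lb _ ?_ ?_
  · intro i; rw [sg_one, one_mul]; rfl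
  · intro a b τ hh wh wr i
    have : i ∘ (swap a b * τ : Perm (Fin d)) = (i ∘ swap a b) ∘ τ := rfl
    rw [this, wr, hx.od a b hh wh (hℓ a), sg_mul, sg_swap hh]; ring

lemma IsF.stab_ev {lb : Fin d → ℕ} (hℓ : ∀ a, Even (lb a)) {x : XX k d t} (hx : IsF lb x) :
    ∀ τ : Perm (Fin d), lb ∘ τ = lb → ∀ i, x (i ∘ τ) = x i := by
  refine stab_ind lb _ ?_ ?_
  · intro i; rfl
  · intro a b τ hh wh wr i
    have : i ∘ (swap a b * τ : Perm (Fin d)) = (i ∘ swap a b) ∘ τ := rfl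
    rw [this, wr, hx.ev a b hh wh (hℓ a)]

def St (lb : Fin d → ℕ) : Finset (Perm (Fin d)) := univ.filter fun σ => lb ∘ σ = lb

lemma mem_St {lb : Fin d → ℕ} {σ : Perm (Fin d)} : σ ∈ St lb ↔ lb ∘ σ = lb := by simp [St]

lemma St_mul {lb : Fin d → ℕ} {σ τ : Perm (Fin d)} (h : σ ∈ St lb) (h' : τ ∈ St lb) : σ * τ ∈ St lb := by
  rw [mem_St] at *
  rw [Perm.coe_mul, ← comp_assoc, h, h']

lemma St_inv {lb : Fin d → ℕ} {σ : Perm (Fin d)} (h : σ ∈ St lb) : σ⁻¹ ∈ St lb := by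
  rw [mem_St] at *
  conv_lhs => rw [← h]
  funext b; simp

lemma St_one {lb : Fin d → ℕ} : (1 : Perm (Fin d)) ∈ St lb := mem_St.2 rfl

lemma St_swap {lb : Fin d → ℕ} {a b : Fin d} (h : lb a = lb b) : swap a b ∈ St lb :=
  mem_St.2 (swap_eq h)

/-- antisymmetrizer -/
def al (lb : Fin d → ℕ) : XX k d t →ₗ[BB k d t] XX k d t where
  toFun x i := ∑ σ ∈ St lb, sg σ * x (i ∘ σ)
  map_add' x y := by
    funext i
    simp only [XX.add_apply, mul_add, sum_add_distrib]
  map_smul' a x := by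
    funext i
    simp only [RingHom.id_apply, XX.smul_apply, mul_sum]
    conv_rhs => rw [sum_comm]
    refine sum_congr rfl fun σ _ => ?_
    rw [← sum_perm σ]
    refine sum_congr rfl fun j _ => ?_
    rw [a.inv]; ring

lemma al_apply (lb : Fin d → ℕ) (x : XX k d t) (i) : al lb x i = ∑ σ ∈ St lb, sg σ * x (i ∘ σ) := rfl

lemma al_mem {lb : Fin d → ℕ} (hℓ : AllOdd lb) (x : XX k d t) : al lb x ∈ FF k t lb := by
  refine ⟨fun a b _ _ h => absurd h (hℓ a), ?_, ?_⟩
  · intro a b hh wh _ i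
    rw [al_apply, al_apply, ← sum_neg_distrib]
    refine sum_bij (fun σ _ => swap a b * σ) ?_ ?_ ?_ ?_
    · intro σ hσ; exact St_mul (St_swap wh) hσ
    · intro σ _ τ _ h; exact mul_left_cancel h
    · intro σ hσ
      exact ⟨swap a b * σ, St_mul (St_swap wh) hσ, by rw [← mul_assoc, swap_mul_self, one_mul]⟩
    · intro σ _
      rw [sg_mul, sg_swap hh]
      have : i ∘ (swap a b * σ : Perm (Fin d)) = (i ∘ swap a b) ∘ σ := rfl
      rw [this]; ring
  · intro a b hh wh _ i hi
    rw [al_apply]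
    refine sum_involution (fun σ _ => swap a b * σ) ?_ ?_ ?_ ?_
    · intro σ _
      have : i ∘ (swap a b * σ : Perm (Fin d)) = (i ∘ swap a b) ∘ σ := rfl
      rw [sg_mul, sg_swap hh, this, swap_eq hi]; ring
    · intro σ _ _ h
      have : swap a b = 1 := by rwa [mul_eq_right] at h
      rw [swap_eq_one_iff] at this
      exact hh this
    · intro σ hσ; exact St_mul (St_swap wh) hσ
    · intro σ _
      show swap a b * (swap a b * σ) = σ
      rw [← mul_assoc, swap_mul_self, one_mul]

lemma frm_al (lb : Fin d → ℕ) (x y : XX k d t) : frm (al lb x) y = frm x (al lb y) := by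
  unfold frm
  simp only [al_apply, sum_mul, mul_sum]
  rw [sum_comm]
  conv_rhs => rw [sum_comm]
  refine sum_bij (fun σ _ => σ⁻¹) (fun σ h => St_inv h) (fun σ _ τ _ h => inv_injective h)
    (fun σ h => ⟨σ⁻¹, St_inv h, inv_inv σ⟩) ?_
  intro σ _
  rw [← sum_perm σ⁻¹]
  refine sum_congr rfl fun i _ => ?_
  have : (i ∘ ⇑(σ⁻¹ : Perm (Fin d))) ∘ σ = i := by funext b; simp
  rw [this, sg_inv]; ring

lemma inj_stab {lb : Fin d → ℕ} {A : Type*} {i : Fin d → A}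
    (h : ∀ a b, lb a = lb b → i a = i b → a = b) {σ : Perm (Fin d)} (hσ : σ ∈ St lb)
    (hi : i ∘ σ = i) : σ = 1 := by
  ext1 b
  exact h _ _ (congrFun (mem_St.1 hσ) b) (congrFun hi b)

lemma al_surj {lb : Fin d → ℕ} (hℓ : AllOdd lb) {f : XX k d t} (hf : f ∈ FF k t lb) :
    ∃ x, al lb x = f := by
  classical
  let s : Setoid (Fin d → Fin t) :=
    ⟨fun i j => ∃ σ ∈ St lb, j = i ∘ σ, fun i => ⟨1, St_one, rfl⟩,
      fun {i j} ⟨σ, h, e⟩ => ⟨σ⁻¹, St_inv h, by rw [e]; funext b; simp⟩,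
      fun {i j l} ⟨σ, h, e⟩ ⟨τ, h', e'⟩ => ⟨σ * τ, St_mul h h', by rw [e', e]; rfl⟩⟩
  let rep : (Fin d → Fin t) → (Fin d → Fin t) := fun i => Quotient.out (Quotient.mk s i)
  refine ⟨fun i => if i = rep i then f i else 0, ?_⟩
  funext i
  rw [al_apply]
  by_cases gr : f i = 0
  · rw [gr]
    refine sum_eq_zero fun σ hσ => ?_
    rw [IsF.stab hℓ hf σ (mem_St.1 hσ), gr]; simp
  · have hinj : ∀ a b, lb a = lb b → i a = i b → a = b := by
      intro a b hh wh
      by_contra hab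
      exact gr (hf.van a b hab hh (hℓ a) i wh)
    have hr : s.r i (rep i) := Quotient.exact (s := s) (Quotient.out_eq (Quotient.mk s i)).symm
    obtain ⟨τ, hτ, he⟩ := hr
    rw [sum_eq_single τ]
    · have hrr : rep (i ∘ τ) = rep i := by
        show Quotient.out _ = Quotient.out _
        congr 1
        exact Quotient.sound (s := s) (s.symm ⟨τ, hτ, rfl⟩)
      rw [hrr, ← he, if_pos rfl, he, IsF.stab hℓ hf τ (mem_St.1 hτ), ← mul_assoc, sg_sq, one_mul]
    · intro σ hσ hne
      rw [if_neg, mul_zero]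
      intro hc
      have hrr : rep (i ∘ σ) = rep i := by
        show Quotient.out _ = Quotient.out _
        congr 1
        exact Quotient.sound (s := s) (s.symm ⟨σ, hσ, rfl⟩)
      rw [hrr, he] at hc
      apply hne
      have wr : i ∘ (σ * τ⁻¹ : Perm (Fin d)) = i := by
        have : i ∘ (σ * τ⁻¹ : Perm (Fin d)) = (i ∘ σ) ∘ ⇑(τ⁻¹ : Perm (Fin d)) := rfl
        rw [this, hc]; funext b; simp
      have := inj_stab hinj (St_mul hσ (St_inv hτ)) wr
      exact mul_inv_eq_one.1 this
    · intro h; exact absurd hτ h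

lemma al_smul_ee (lb : Fin d → ℕ) (a : BB k d t) (i) :
    star a • al lb (ee i) = ∑ j, algebraMap k (BB k d t) (a.e i j) • al lb (ee j : XX k d t) := by
  rw [← map_smul]
  conv_lhs => rw [ee_sum (star a • ee i), map_sum]
  refine sum_congr rfl fun j _ => ?_
  rw [map_smul, sm_ee, BB.star_apply]

lemma al_ee_swap {lb : Fin d → ℕ} {a b : Fin d} (hh : a ≠ b) (wh : lb a = lb b) (i) :
    al lb (ee (i ∘ swap a b) : XX k d t) = - al lb (ee i) := by
  funext j
  rw [XX.neg_apply, al_apply, al_apply, ← sum_neg_distrib]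
  refine sum_bij (fun σ _ => σ * swap a b) ?_ ?_ ?_ ?_
  · intro σ hσ; exact St_mul hσ (St_swap wh)
  · intro σ _ τ _ h; exact mul_right_cancel h
  · intro σ hσ
    exact ⟨σ * swap a b, St_mul hσ (St_swap wh), by rw [mul_assoc, swap_mul_self, mul_one]⟩
  · intro σ _
    rw [sg_mul, sg_swap hh]
    have : j ∘ (σ * swap a b : Perm (Fin d)) = (j ∘ σ) ∘ swap a b := rfl
    rw [this]
    have : (ee (i ∘ swap a b) : XX k d t) (j ∘ σ) = (ee i : XX k d t) ((j ∘ σ) ∘ swap a b) := by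
      unfold ee
      congr 1
      apply propext
      constructor
      · intro h; rw [h, swap_swap']
      · intro h; rw [← h, swap_swap']
    rw [this]; ring

lemma al_ee_van {lb : Fin d → ℕ} {a b : Fin d} (hh : a ≠ b) (wh : lb a = lb b) (i : Fin d → Fin t)
    (hi : i a = i b) : al lb (ee i : XX k d t) = 0 := by
  funext j
  rw [al_apply]
  refine sum_involution (fun σ _ => σ * swap a b) ?_ ?_ ?_ ?_
  · intro σ _
    have : j ∘ (σ * swap a b : Perm (Fin d)) = (j ∘ σ) ∘ swap a b := rfl
    rw [sg_mul, sg_swap hh, this]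
    have : (ee i : XX k d t) ((j ∘ σ) ∘ swap a b) = (ee i : XX k d t) (j ∘ σ) := by
      unfold ee
      congr 1
      apply propext
      rw [← comp_perm_eq (swap a b), swap_swap', swap_eq hi]
    rw [this]; ring
  · intro σ _ _ h
    have : swap a b = 1 := by rwa [mul_eq_left] at h
    rw [swap_eq_one_iff] at this
    exact hh this
  · intro σ hσ; exact St_mul hσ (St_swap wh)
  · intro σ _
    show σ * swap a b * swap a b = σ
    rw [mul_assoc, swap_mul_self, mul_one]

/-- self-duality -/
def sdf {lb : Fin d → ℕ} (hℓ : AllOdd lb) : Dl k (BB k d t) (FF k t lb) →ₗ[BB k d t] FF k t lb where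
  toFun q := ⟨fun i => q.1 ⟨al lb (ee i), al_mem hℓ _⟩, by
    refine ⟨fun a b _ _ h => absurd h (hℓ a), ?_, ?_⟩
    · intro a b hh wh _ i
      rw [← map_neg]
      congr 1
      exact Subtype.ext (al_ee_swap hh wh i)
    · intro a b hh wh _ i hi
      rw [← map_zero q.1]
      congr 1
      exact Subtype.ext (al_ee_van hh wh i hi)⟩
  map_add' q q' := rfl
  map_smul' a q := by
    apply Subtype.ext
    funext i
    show q.1 (star a • ⟨al lb (ee i), al_mem hℓ _⟩) = ∑ j, a.e i j * q.1 ⟨al lb (ee j), al_mem hℓ _⟩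
    have : star a • (⟨al lb (ee i), al_mem hℓ _⟩ : FF k t lb) =
        ∑ j, algebraMap k (BB k d t) (a.e i j) • ⟨al lb (ee j), al_mem hℓ _⟩ := by
      apply Subtype.ext
      rw [coe_sum]
      exact al_smul_ee lb a i
    rw [this, map_sum]
    simp only [q.2]

lemma sdf_apply {lb : Fin d → ℕ} (hℓ : AllOdd lb) (q : Dl k (BB k d t) (FF k t lb)) (i) :
    (sdf hℓ q).1 i = q.1 ⟨al lb (ee i), al_mem hℓ _⟩ := rfl

lemma sdf_bij {lb : Fin d → ℕ} (hℓ : AllOdd lb) : Bijective (sdf (k := k) (t := t) hℓ) := by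
  constructor
  · rw [injective_iff_map_eq_zero]
    intro q hq
    apply Dl.ext'
    rintro ⟨f, hf⟩
    obtain ⟨x, rfl⟩ := al_surj hℓ hf
    have hh : ∀ i, q.1 ⟨al lb (ee i), al_mem hℓ _⟩ = 0 := fun i => by
      rw [← sdf_apply hℓ, hq]; rfl
    have : (⟨al lb x, hf⟩ : FF k t lb) =
        ∑ j, algebraMap k (BB k d t) (x j) • ⟨al lb (ee j), al_mem hℓ _⟩ := by
      apply Subtype.ext
      rw [coe_sum]
      have wh := congrArg (al lb) (ee_sum x)
      rw [map_sum] at wh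
      simp only [map_smul] at wh
      exact wh
    rw [this, map_sum]
    simp only [q.2, hh, mul_zero, sum_const_zero]
    rfl
  · rintro ⟨f, hf⟩
    obtain ⟨x, rfl⟩ := al_surj hℓ hf
    refine ⟨Dl.map k (FF k t lb).subtype (xdl x), Subtype.ext ?_⟩
    funext i
    rw [sdf_apply, Dl.map_apply]
    show frm x (al lb (ee i)) = al lb x i
    rw [← frm_al, frm_comm, frm_ee]

noncomputable def sdE {lb : Fin d → ℕ} (hℓ : AllOdd lb) :
    Dl k (BB k d t) (FF k t lb) ≃ₗ[BB k d t] FF k t lb := LinearEquiv.ofBijective _ (sdf_bij hℓ)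

lemma Dl_FF_fin (lb : Fin d → ℕ) : Module.Finite (BB k d t) (Dl k (BB k d t) (FF k t lb)) := by
  refine Module.Finite.of_surjective (Dl.map k (FF k t lb).subtype ∘ₗ xdl) ?_
  rw [LinearMap.coe_comp]
  exact ((SES.ofSub (FF k t lb)).dual (k := k)).surj.comp xdl_surj

end SF

section SW
open Equiv

variable {k : Type u} [Field k] {d t q : ℕ} {A : Type*}

def cnt [DecidableEq A] (i : Fin d → A) (r : A) : ℕ := (univ.filter fun b => i b = r).card

lemma cnt_comp [DecidableEq A] (i : Fin d → A) (σ : Perm (Fin d)) (r : A) : cnt (i ∘ σ) r = cnt i r := by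
  unfold cnt
  refine card_bij (fun b _ => σ b) ?_ ?_ ?_
  · intro b hb; simpa using hb
  · intro a _ b _ h; exact σ.injective h
  · intro b hb; exact ⟨σ⁻¹ b, by simpa using hb, by simp⟩

abbrev Wt (d t : ℕ) := Lex (Fin t → Fin (d + 1))

def wt (i : Fin d → Fin t) : Wt d t := toLex fun r => ⟨cnt i r, by
  have := Finset.card_filter_le (univ : Finset (Fin d)) (fun b => i b = r)
  rw [card_univ, Fintype.card_fin] at this
  unfold cnt; omega⟩

lemma wt_eq {i j : Fin d → Fin t} : wt i = wt j ↔ ∀ r, cnt i r = cnt j r := by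
  constructor
  · intro h r
    have := congrFun (congrArg ofLex h) r
    exact congrArg Fin.val this
  · intro h
    apply ofLex.injective
    funext r
    exact Fin.ext (h r)

lemma wt_lt {i j : Fin d → Fin t} : wt i < wt j ↔
    ∃ r, (∀ r' < r, cnt i r' = cnt j r') ∧ cnt i r < cnt j r := by
  constructor
  · rintro ⟨r, hh, wh⟩
    exact ⟨r, fun r' hr => congrArg Fin.val (hh r' hr), wh⟩
  · rintro ⟨r, hh, wh⟩
    exact ⟨r, fun r' hr => Fin.ext (hh r' hr), wh⟩

lemma wt_comp (i : Fin d → Fin t) (σ : Perm (Fin d)) : wt (i ∘ σ) = wt i :=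
  wt_eq.2 fun r => cnt_comp i σ r

lemma exists_perm_wt {i j : Fin d → Fin t} (h : wt i = wt j) : ∃ σ : Perm (Fin d), i = j ∘ σ :=
  exists_perm i j (wt_eq.1 h)

def xi (w : Wt d t) : BB k d t := BB.mk (fun i j => if i = j ∧ wt i = w then 1 else 0) fun σ i j => by
  simp only [comp_perm_eq, wt_comp]

lemma xi_apply (w : Wt d t) (i j) : (xi w : BB k d t).e i j = if i = j ∧ wt i = w then 1 else 0 := rfl

lemma xi_smul (w : Wt d t) (x : XX k d t) (i) : ((xi w : BB k d t) • x) i = if wt i = w then x i else 0 := by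
  rw [XX.smul_apply, sum_eq_single i]
  · rw [xi_apply]; simp
  · intro j _ h; rw [xi_apply, if_neg, zero_mul]; exact fun h' => h h'.1.symm
  · simp

lemma xi_mul (w : Wt d t) (a : BB k d t) (i j) : (xi w * a).e i j = if wt i = w then a.e i j else 0 := by
  rw [BB.mul_apply, sum_eq_single i]
  · rw [xi_apply]; simp
  · intro l _ h; rw [xi_apply, if_neg, zero_mul]; exact fun h' => h h'.1.symm
  · simp

lemma xi_idem (w : Wt d t) : (xi w * xi w : BB k d t) = xi w := by
  apply BB.ext'; intro i j
  rw [xi_mul, xi_apply]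
  by_cases h : wt i = w <;> simp [h]

lemma xi_star (w : Wt d t) : star (xi w : BB k d t) = xi w := by
  apply BB.ext'; intro i j
  rw [BB.star_apply, xi_apply, xi_apply]
  congr 1
  apply propext
  constructor
  · rintro ⟨rfl, h⟩; exact ⟨rfl, h⟩
  · rintro ⟨rfl, h⟩; exact ⟨rfl, h⟩

lemma BB.sum_apply {ι : Type*} (s : Finset ι) (f : ι → BB k d t) (i j) :
    (∑ c ∈ s, f c).e i j = ∑ c ∈ s, (f c).e i j := by
  classical
  induction s using induction_on with
  | empty => rfl
  | insert a s ha ih => rw [sum_insert ha, sum_insert ha, BB.add_apply, ih]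

lemma xi_sum : ∑ w, (xi w : BB k d t) = 1 := by
  apply BB.ext'; intro i j
  rw [BB.sum_apply, BB.one_apply]
  simp only [xi_apply]
  by_cases h : i = j
  · simp only [h, true_and, if_true]
    rw [sum_ite_eq, if_pos (mem_univ _)]
  · simp [h]

/-- character -/
def chi (ep : Bool) (σ : Perm (Fin d)) : k := if ep then sg σ else 1

lemma chi_one (ep : Bool) : (chi ep (1 : Perm (Fin d)) : k) = 1 := by unfold chi; split_ifs; exacts [sg_one, rfl]
lemma chi_mul (ep : Bool) (σ τ : Perm (Fin d)) : (chi ep (σ * τ) : k) = chi ep σ * chi ep τ := by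
  unfold chi; split_ifs; exacts [sg_mul σ τ, by simp]
lemma chi_inv (ep : Bool) (σ : Perm (Fin d)) : (chi ep σ⁻¹ : k) = chi ep σ := by
  unfold chi; split_ifs; exacts [sg_inv σ, rfl]
lemma chi_sq (ep : Bool) (σ : Perm (Fin d)) : (chi ep σ * chi ep σ : k) = 1 := by
  unfold chi; split_ifs; exacts [sg_sq σ, by simp]
lemma chi_ne (ep : Bool) (σ : Perm (Fin d)) : (chi ep σ : k) ≠ 0 := fun h => by
  have := chi_sq (k := k) ep σ
  rw [h, zero_mul] at this; exact zero_ne_one this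
lemma chi_not (ep : Bool) (σ : Perm (Fin d)) : (chi ep σ * chi (!ep) σ : k) = sg σ := by
  cases ep <;> simp [chi]

structure IsM (ep : Bool) (x : (Fin d → Fin q) → (Fin d → A) → k) : Prop where
  inv : ∀ (σ : Perm (Fin d)) S i, x (S ∘ σ) (i ∘ σ) = chi ep σ * x S i
  van : ep = true → ∀ a b, a ≠ b → ∀ S i, S a = S b → i a = i b → x S i = 0

/-- kernels -/
def tpk (G : Fin t → A → k) (i : Fin d → Fin t) (m : Fin d → A) : k := ∏ b, G (i b) (m b)

lemma tpk_comp (G : Fin t → A → k) (i : Fin d → Fin t) (m : Fin d → A) (σ : Perm (Fin d)) :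
    tpk G (i ∘ σ) (m ∘ σ) = tpk G i m := Equiv.prod_comp σ fun b => G (i b) (m b)

lemma IsM.kern [Fintype A] {ep : Bool} {x : (Fin d → Fin q) → (Fin d → A) → k} (hx : IsM ep x)
    (K : (Fin d → Fin t) → (Fin d → A) → k) (hK : ∀ (σ : Perm (Fin d)) i m, K (i ∘ σ) (m ∘ σ) = K i m) :
    IsM ep (fun S i => ∑ m, K i m * x S m) := by
  refine ⟨?_, ?_⟩
  · intro σ S i
    rw [← sum_perm σ, mul_sum]
    refine sum_congr rfl fun m _ => ?_
    rw [hK, hx.inv]; ring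
  · intro he a b hab S i hS hi
    refine sum_van a b _ ?_ ?_
    · intro m
      have hh := hx.inv (swap a b) S m
      rw [swap_eq hS] at hh
      have wh := hK (swap a b) i m
      rw [swap_eq hi] at wh
      rw [hh, wh, chi, if_pos he, sg_swap hab]; ring
    · intro m hm
      rw [hx.van he a b hab S m hS hm, mul_zero]

def MM (k : Type u) [Field k] (d t : ℕ) (ep : Bool) (q : ℕ) :
    Submodule (BB k d t) ((Fin d → Fin q) → XX k d t) where
  carrier := {x | IsM ep x}
  zero_mem' := ⟨by intros; simp, by intros; rfl⟩
  add_mem' := by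
    intro x y hx hy
    refine ⟨?_, ?_⟩
    · intro σ S i
      show x (S ∘ σ) (i ∘ σ) + y (S ∘ σ) (i ∘ σ) = chi ep σ * (x S i + y S i)
      rw [hx.inv, hy.inv]; ring
    · intro he a b hab S i hS hi
      show x S i + y S i = 0
      rw [hx.van he a b hab S i hS hi, hy.van he a b hab S i hS hi, add_zero]
  smul_mem' := by
    intro a x hx
    exact hx.kern a.e a.inv

lemma MM.smul_apply {ep : Bool} (a : BB k d t) (x : MM k d t ep q) (S i) :
    (a • x).1 S i = ∑ j, a.e i j * x.1 S j := rfl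

lemma MM.xi_smul {ep : Bool} (w : Wt d t) (x : MM k d t ep q) (S i) :
    ((xi w : BB k d t) • x).1 S i = if wt i = w then x.1 S i else 0 := _root_.xi_smul w (x.1 S) i

lemma MM.sub_apply {ep : Bool} (x y : MM k d t ep q) (S i) : (x - y).1 S i = x.1 S i - y.1 S i := rfl

lemma MM.scal_apply {ep : Bool} (c : k) (x : MM k d t ep q) (S i) :
    (algebraMap k (BB k d t) c • x).1 S i = c * x.1 S i := XX.scal_apply c (x.1 S) i

lemma MM.ext' {ep : Bool} {x y : MM k d t ep q} (h : ∀ S i, x.1 S i = y.1 S i) : x = y :=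
  Subtype.ext (funext fun S => funext fun i => h S i)

/-- orbit elements -/
noncomputable def Eo (ep : Bool) (m0 : Fin d → A) (S0 : Fin d → Fin q) :
    (Fin d → Fin q) → (Fin d → A) → k := by
  classical
  exact fun S m => if h : ∃ σ : Perm (Fin d), S = S0 ∘ σ ∧ m = m0 ∘ σ then chi ep h.choose else 0

section Eo
variable {ep : Bool} {m0 : Fin d → A} {S0 : Fin d → Fin q}

lemma Eo_val (hinj : ep = true → ∀ a b, S0 a = S0 b → m0 a = m0 b → a = b)
    (σ : Perm (Fin d)) : (Eo ep m0 S0 (S0 ∘ σ) (m0 ∘ σ) : k) = chi ep σ := by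
  have h : ∃ τ : Perm (Fin d), S0 ∘ σ = S0 ∘ τ ∧ m0 ∘ σ = m0 ∘ τ := ⟨σ, rfl, rfl⟩
  unfold Eo
  rw [dif_pos h]
  obtain ⟨hh, wh⟩ := h.choose_spec
  unfold chi
  split_ifs with he
  · congr 1
    ext1 b
    exact (hinj he _ _ (congrFun hh b) (congrFun wh b)).symm
  · rfl

lemma Eo_ex {S m} (h : (Eo ep m0 S0 S m : k) ≠ 0) : ∃ σ : Perm (Fin d), S = S0 ∘ σ ∧ m = m0 ∘ σ := by
  by_contra hc
  unfold Eo at h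
  rw [dif_neg hc] at h
  exact h rfl

lemma Eo_isM (hinj : ep = true → ∀ a b, S0 a = S0 b → m0 a = m0 b → a = b) : IsM ep (Eo ep m0 S0 : _ → _ → k) := by
  refine ⟨?_, ?_⟩
  · intro σ S m
    by_cases h : ∃ τ : Perm (Fin d), S = S0 ∘ τ ∧ m = m0 ∘ τ
    · obtain ⟨τ, rfl, rfl⟩ := h
      have := Eo_val (k := k) hinj (τ * σ)
      rw [Eo_val hinj, mul_comm, ← chi_mul, ← this]; rfl
    · have hh : (Eo ep m0 S0 S m : k) = 0 := by
        by_contra hc; exact h (Eo_ex hc)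
      have wh : (Eo ep m0 S0 (S ∘ σ) (m ∘ σ) : k) = 0 := by
        by_contra hc
        obtain ⟨τ, wr, h4⟩ := Eo_ex hc
        refine h ⟨τ * σ⁻¹, ?_, ?_⟩
        · rw [Perm.coe_mul, ← comp_assoc, ← wr]; funext b; simp
        · rw [Perm.coe_mul, ← comp_assoc, ← h4]; funext b; simp
      rw [hh, wh, mul_zero]
  · intro he a b hab S m hS hm
    by_contra hc
    obtain ⟨τ, rfl, rfl⟩ := Eo_ex hc
    exact hab (τ.injective (hinj he _ _ hS hm))

end Eo

/-- span of higher weights -/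
def TW (k : Type u) [Field k] {d t : ℕ} (M : Type u) [AddCommGroup M] [Module (BB k d t) M] (v : Wt d t) : Submodule (BB k d t) M :=
  Submodule.span (BB k d t) {m : M | ∃ w, v < w ∧ (xi w : BB k d t) • m = m}

lemma TW_of {M : Type u} [AddCommGroup M] [Module (BB k d t) M] (v : Wt d t) (m : M)
    (h : ∀ w, ¬ v < w → (xi w : BB k d t) • m = 0) : m ∈ TW k M v := by
  have : m = ∑ w, (xi w : BB k d t) • m := by rw [← sum_smul, xi_sum, one_smul]
  rw [this]
  refine Submodule.sum_mem _ fun w _ => ?_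
  by_cases hw : v < w
  · exact subset_span ⟨w, hw, by rw [← mul_smul, xi_idem]⟩
  · rw [h w hw]; exact Submodule.zero_mem _

lemma TW_map {M N : Type u} [AddCommGroup M] [Module (BB k d t) M] [AddCommGroup N]
    [Module (BB k d t) N] {v : Wt d t} (f : M →ₗ[BB k d t] N) {m : M} (hm : m ∈ TW k M v) :
    f m ∈ TW k N v := by
  have : TW k M v ≤ (TW k N v).comap f := by
    refine span_le.2 ?_
    rintro x ⟨w, hw, hx⟩
    exact subset_span ⟨w, hw, by rw [← map_smul, hx]⟩
  exact this hm

lemma TW_kill {M N : Type u} [AddCommGroup M] [Module (BB k d t) M] [AddCommGroup N]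
    [Module (BB k d t) N] {v : Wt d t} (hN : ∀ w, v < w → ∀ z : N, (xi w : BB k d t) • z = 0)
    (f : M →ₗ[BB k d t] N) {m : M} (hm : m ∈ TW k M v) : f m = 0 := by
  have : TW k M v ≤ LinearMap.ker f := by
    refine span_le.2 ?_
    rintro x ⟨w, hw, hx⟩
    show f x = 0
    rw [← hx, map_smul, hN w hw]
  exact this hm

end SW

section SX
open Equiv

variable {k : Type u} [Field k] {d t q : ℕ} {A : Type*}

def lee (ep : Bool) (s θ : ℕ) : Prop := s < θ ∨ (ep = false ∧ s = θ)
instance (ep : Bool) (s θ : ℕ) : Decidable (lee ep s θ) := inferInstanceAs (Decidable (_ ∨ _))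

def Ss (ep : Bool) (R : Fin d → Fin t) (S : Fin d → Fin q) : Prop := ∀ r r' : Fin t, r < r' → ∀ θ : ℕ,
  (univ.filter fun b => R b = r' ∧ lee ep (S b).val θ).card ≤
  (univ.filter fun b => R b = r ∧ (S b).val < θ).card

def fS (R : Fin d → Fin t) (S : Fin d → Fin q) : ℕ := ∑ b, (S b).val * (t - (R b).val)

def mu (ep : Bool) (r r' : Fin t) (θ : ℕ) (x : Fin t) (s : ℕ) : Option (Fin t) :=
  if x = r ∧ s < θ then none else if x = r ∨ (x = r' ∧ lee ep s θ) then some r else some x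

def okk (r r' : Fin t) (i : Fin t) (m : Option (Fin t)) : Prop :=
  (m = none ∧ i = r) ∨ (∃ s, m = some s ∧ (i = s ∨ (s = r ∧ i = r')))

lemma okk_none {r r' i : Fin t} : okk r r' i none ↔ i = r := by simp [okk]
lemma okk_some {r r' i s : Fin t} : okk r r' i (some s) ↔ (i = s ∨ (s = r ∧ i = r')) := by
  simp [okk]

lemma okk_mu (ep : Bool) {r r' : Fin t} (h : r < r') (θ : ℕ) {x y : Fin t} {s : ℕ} :
    okk r r' y (mu ep r r' θ x s) → (y = x) ∨ (x = r ∧ y = r' ∧ θ ≤ s) ∨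
      (x = r' ∧ y = r ∧ lee ep s θ) := by
  have hne : r ≠ r' := h.ne
  unfold mu
  split_ifs with hh wh
  · rw [okk_none]; rintro rfl; exact Or.inl hh.1.symm
  · rw [okk_some]
    rintro (rfl | ⟨-, rfl⟩)
    · rcases wh with rfl | ⟨rfl, wr⟩
      · exact Or.inl rfl
      · exact Or.inr (Or.inr ⟨rfl, rfl, wr⟩)
    · rcases wh with rfl | ⟨rfl, wr⟩
      · exact Or.inr (Or.inl ⟨rfl, rfl, by by_contra hc; exact hh ⟨rfl, by omega⟩⟩)
      · exact Or.inl rfl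
  · rw [okk_some]
    rintro (rfl | ⟨rfl, rfl⟩)
    · exact Or.inl rfl
    · exact absurd (Or.inl rfl) wh

lemma okk_self (ep : Bool) {r r' : Fin t} (θ : ℕ) (x : Fin t) (s : ℕ) : okk r r' x (mu ep r r' θ x s) := by
  unfold mu
  split_ifs with hh wh
  · exact okk_none.2 hh.1
  · rw [okk_some]
    rcases wh with rfl | ⟨rfl, wr⟩
    · exact Or.inl rfl
    · exact Or.inr ⟨rfl, rfl⟩
  · exact okk_some.2 (Or.inl rfl)

lemma cmp1 {ep : Bool} {r r' : Fin t} (hr : r < r') {θ : ℕ} {R R' : Fin d → Fin t} {s : Fin d → ℕ}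
    (σ : Perm (Fin d)) (hR : R' = R ∘ σ) (h : ∀ b, okk r r' (R' b) (mu ep r r' θ (R b) (s b))) :
    ∑ b, s b * (t - (R' b).val) ≤ ∑ b, s b * (t - (R b).val) ∧
    (∑ b, s b * (t - (R' b).val) = ∑ b, s b * (t - (R b).val) → ∀ b, R' b ≠ R b → s b = θ) := by
  have hT : ∀ b, (0 : ℤ) ≤ ((s b : ℤ) - θ) * ((R' b).val - (R b).val) := by
    intro b
    rcases okk_mu ep hr θ (h b) with hh | ⟨hh, wh, wr⟩ | ⟨hh, wh, wr⟩
    · rw [hh]; simp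
    · rw [hh, wh]
      have : r.val < r'.val := hr
      exact mul_nonneg (by omega) (by omega)
    · rw [hh, wh]
      have : r.val < r'.val := hr
      have h4 : s b ≤ θ := by rcases wr with wr | wr; exacts [wr.le, wr.2.le]
      exact mul_nonneg_of_nonpos_of_nonpos (by omega) (by omega)
  have hsum : ∑ b, ((R' b).val : ℤ) = ∑ b, ((R b).val : ℤ) := by
    rw [hR]; exact Equiv.sum_comp σ fun b => ((R b).val : ℤ)
  have key : ∑ b, ((s b : ℤ) - θ) * ((R' b).val - (R b).val) =
      ((∑ b, s b * (t - (R b).val) : ℕ) : ℤ) - ((∑ b, s b * (t - (R' b).val) : ℕ) : ℤ) := by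
    push_cast
    rw [← sum_sub_distrib]
    have e : ∀ b, ((s b : ℤ) - θ) * ((R' b).val - (R b).val) =
      ((s b : ℤ) * ((t - (R b).val : ℕ) : ℤ) - (s b : ℤ) * ((t - (R' b).val : ℕ) : ℤ))
        - θ * ((R' b).val - (R b).val) := by
      intro b
      have hh := (R b).isLt
      have wh := (R' b).isLt
      rw [Nat.cast_sub hh.le, Nat.cast_sub wh.le]; ring
    rw [sum_congr rfl fun b _ => e b, sum_sub_distrib, ← mul_sum,
      sum_sub_distrib (f := fun b => ((R' b).val : ℤ)), hsum]
    simp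
  constructor
  · have := Finset.sum_nonneg fun b (_ : b ∈ univ) => hT b
    rw [key] at this; omega
  · intro he b hb
    rw [he, sub_self, Finset.sum_eq_zero_iff_of_nonneg fun b _ => hT b] at key
    have := key b (mem_univ _)
    rcases mul_eq_zero.1 this with hh | hh
    · omega
    · exact absurd (Fin.ext (by omega)) hb

lemma cmp2 {R R' : Fin d → Fin t} {s : Fin d → ℕ} {θ : ℕ}
    (σ : Perm (Fin d)) (hR : R' = R ∘ σ) (h : ∀ b, R' b ≠ R b → s b = θ) (x : Fin t) :
    (univ.filter fun b => R' b = x ∧ s b = θ).card =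
    (univ.filter fun b => R b = x ∧ s b = θ).card := by
  have hh := cnt_comp R σ x
  rw [← hR] at hh
  unfold cnt at hh
  rw [← card_filter_add_card_filter_not (fun b => s b = θ),
    ← card_filter_add_card_filter_not (s := univ.filter fun b => R b = x) (fun b => s b = θ),
    filter_filter, filter_filter, filter_filter, filter_filter] at hh
  have wh : (univ.filter fun b => R' b = x ∧ ¬ s b = θ) =
      (univ.filter fun b => R b = x ∧ ¬ s b = θ) := by
    apply filter_congr
    intro b _
    constructor
    · rintro ⟨wr, h4⟩; by_cases h5 : R' b = R b
      · exact ⟨h5 ▸ wr, h4⟩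
      · exact absurd (h b h5) h4
    · rintro ⟨wr, h4⟩; by_cases h5 : R' b = R b
      · exact ⟨h5.trans wr, h4⟩
      · exact absurd (h b h5) h4
  rw [wh] at hh
  omega

lemma cmp3 {R R' : Fin d → Fin t} {S : Fin d → Fin q} {θ : ℕ}
    (σ : Perm (Fin d)) (hR : R' = R ∘ σ) (h : ∀ b, R' b ≠ R b → (S b).val = θ) :
    ∃ τ : Perm (Fin d), R' = R ∘ τ ∧ S = S ∘ τ := by
  obtain ⟨τ, hτ⟩ := exists_perm (fun b => (R' b, S b)) (fun b => (R b, S b)) (by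
    rintro ⟨x, s⟩
    simp only [Prod.mk.injEq]
    by_cases hs : s.val = θ
    · have := cmp2 (s := fun b => (S b).val) σ hR h x
      simpa only [← hs, ← Fin.ext_iff] using this
    · congr 1
      apply filter_congr
      intro b _
      constructor
      · rintro ⟨wr, rfl⟩; by_cases h5 : R' b = R b
        · exact ⟨h5 ▸ wr, rfl⟩
        · exact absurd (h b h5) hs
      · rintro ⟨wr, rfl⟩; by_cases h5 : R' b = R b
        · exact ⟨h5.trans wr, rfl⟩
        · exact absurd (h b h5) hs)
  refine ⟨τ, ?_, ?_⟩
  · funext b; exact congrArg Prod.fst (congrFun hτ b)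
  · funext b; exact congrArg Prod.snd (congrFun hτ b)

lemma cmp4 {ep : Bool} {r r' : Fin t} (hr : r < r') {θ : ℕ} {R R' : Fin d → Fin t} {s : Fin d → ℕ}
    (σ : Perm (Fin d)) (hR : R' = R ∘ σ) (h : ∀ b, okk r r' (R' b) (mu ep r r' θ (R b) (s b)))
    (h' : ∀ b, R' b ≠ R b → s b = θ) (b : Fin d) :
    mu ep r r' θ (R' b) (s b) = mu ep r r' θ (R b) (s b) := by
  by_cases hb : R' b = R b
  · rw [hb]
  have hs := h' b hb
  have hne : r ≠ r' := hr.ne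
  cases ep with
  | false =>
    have hm : ∀ x, x = r ∨ x = r' → mu false r r' θ x θ = some r := by
      rintro x (rfl | rfl) <;> simp [mu, lee]
    rcases okk_mu _ hr θ (h b) with hh | ⟨hh, wh, wr⟩ | ⟨hh, wh, wr⟩
    · exact absurd hh hb
    · rw [hs, hm _ (Or.inr wh), hm _ (Or.inl hh)]
    · rw [hs, hm _ (Or.inl wh), hm _ (Or.inr hh)]
  | true =>
    exfalso
    have hc := cmp2 σ hR h' r'
    have hsub : (univ.filter fun b => R b = r' ∧ s b = θ) ⊆
        (univ.filter fun b => R' b = r' ∧ s b = θ) := by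
      intro c hcc
      simp only [mem_filter, mem_univ, true_and] at hcc ⊢
      refine ⟨?_, hcc.2⟩
      rcases okk_mu _ hr θ (h c) with hh | ⟨hh, wh, wr⟩ | ⟨hh, wh, wr⟩
      · exact hh.trans hcc.1
      · exact wh
      · exfalso
        have := hcc.2
        simp only [lee] at wr
        rcases wr with wr | wr
        · omega
        · exact absurd wr.1 (by simp)
    have heq := eq_of_subset_of_card_le hsub hc.le
    rcases okk_mu _ hr θ (h b) with hh | ⟨hh, wh, wr⟩ | ⟨hh, wh, wr⟩
    · exact hb hh
    · have : b ∈ (univ.filter fun b => R' b = r' ∧ s b = θ) := by simp [wh, hs]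
      rw [← heq] at this
      simp only [mem_filter, mem_univ, true_and] at this
      exact hne (hh.symm.trans this.1)
    · simp only [lee] at wr
      rcases wr with wr | wr
      · omega
      · exact absurd wr.1 (by simp)

/-- one-variable kernels -/
def kb (r r' : Fin t) (l : Fin t) (m : Option (Fin t)) : k :=
  m.elim ((if l = r then 1 else 0) - (if l = r' then 1 else 0)) fun s => if l = s then 1 else 0

def kc (r r' : Fin t) (i l : Fin t) : k := (if i = l then 1 else 0) + (if l = r ∧ i = r' then 1 else 0)

open Classical in
noncomputable def kg (r r' : Fin t) (i : Fin t) (m : Option (Fin t)) : k := if okk r r' i m then 1 else 0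

lemma kcb {r r' : Fin t} (h : r < r') (i : Fin t) (m : Option (Fin t)) :
    ∑ l, kc r r' i l * kb r r' l m = (kg r r' i m : k) := by
  have hne : r ≠ r' := h.ne
  cases m with
  | none =>
    unfold kg
    rw [okk_none]
    simp only [kb, Option.elim, mul_sub, sum_sub_distrib, mul_ite, mul_one, mul_zero,
      sum_ite_eq', mem_univ, if_true, kc]
    by_cases hh : i = r
    · subst hh; simp [hne]
    · by_cases wh : i = r'
      · subst wh; simp [hne.symm]
      · simp [hh, wh]
  | some s =>
    unfold kg
    rw [okk_some]
    simp only [kb, Option.elim, mul_ite, mul_one, mul_zero, sum_ite_eq', mem_univ, if_true, kc]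
    by_cases hh : i = s
    · subst hh
      by_cases wh : i = r
      · subst wh; simp [hne]
      · simp [wh]
    · by_cases wh : s = r ∧ i = r' <;> simp [hh, wh, hne.symm]

lemma tpk_mul (G : Fin t → A → k) (C : Fin t → Fin t → k) (H : Fin t → A → k)
    (h : ∀ i m, ∑ l, C i l * H l m = G i m) (i : Fin d → Fin t) (m : Fin d → A) :
    ∑ l, tpk C i l * tpk H l m = tpk G i m := by
  unfold tpk
  simp only [← h, Finset.prod_univ_sum, Fintype.piFinset_univ, Finset.prod_mul_distrib]

lemma tpk_kg_ne {r r' : Fin t} {i : Fin d → Fin t} {m : Fin d → Option (Fin t)}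
    (h : (tpk (kg r r') i m : k) ≠ 0) (b) : okk r r' (i b) (m b) := by
  by_contra hc
  refine h (Finset.prod_eq_zero (mem_univ b) ?_)
  unfold kg; rw [if_neg hc]

lemma tpk_kg_one {r r' : Fin t} {i : Fin d → Fin t} {m : Fin d → Option (Fin t)}
    (h : ∀ b, okk r r' (i b) (m b)) : (tpk (kg r r') i m : k) = 1 := by
  refine Finset.prod_eq_one fun b _ => ?_
  unfold kg; rw [if_pos (h b)]

end SX

section SY
open Equiv

variable {k : Type u} [Field k] {d t q : ℕ}

lemma mu_inj {r r' : Fin t} (h : r < r') {θ : ℕ} {x y : Fin t} {s : ℕ}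
    (he : mu true r r' θ x s = mu true r r' θ y s) : x = y := by
  have hne : r ≠ r' := h.ne
  unfold mu lee at he
  by_cases hs : s < θ
  · simp only [hs, and_true, true_or] at he
    split_ifs at he <;> simp_all
  · simp only [hs, and_false, if_false, Bool.true_eq_false, false_and, or_false] at he
    split_ifs at he <;> simp_all

lemma supp_wt {ep : Bool} {r r' : Fin t} (hr : r < r') {θ : ℕ} {R l : Fin d → Fin t} {s : Fin d → ℕ}
    (hs : (univ.filter fun b => R b = r ∧ s b < θ).card <
      (univ.filter fun b => R b = r' ∧ lee ep (s b) θ).card)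
    (h : ∀ b, (kb r r' (l b) (mu ep r r' θ (R b) (s b)) : k) ≠ 0) : wt R < wt l := by
  have hne : r ≠ r' := hr.ne
  have hl : ∀ b, (R b = r ∧ s b < θ ∧ (l b = r ∨ l b = r')) ∨
      (R b = r ∧ ¬ s b < θ ∧ l b = r) ∨ (R b = r' ∧ lee ep (s b) θ ∧ l b = r) ∨
      (R b ≠ r ∧ ¬ (R b = r' ∧ lee ep (s b) θ) ∧ l b = R b) := by
    intro b
    have hb := h b
    unfold mu kb at hb
    by_cases hh : R b = r
    · by_cases wh : s b < θ
      · refine Or.inl ⟨hh, wh, ?_⟩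
        by_contra hc
        push Not at hc
        simp [hh, wh, hc] at hb
      · refine Or.inr (Or.inl ⟨hh, wh, ?_⟩)
        by_contra hc
        simp [hh, wh, hc] at hb
    · by_cases wh : R b = r' ∧ lee ep (s b) θ
      · refine Or.inr (Or.inr (Or.inl ⟨wh.1, wh.2, ?_⟩))
        by_contra hc
        simp [wh.1, wh.2, hc, hne.symm] at hb
      · refine Or.inr (Or.inr (Or.inr ⟨hh, wh, ?_⟩))
        by_contra hc
        rw [if_neg (by tauto), if_neg (by tauto)] at hb
        simp [hc] at hb
  rw [wt_lt]
  refine ⟨r, ?_, ?_⟩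
  · intro x hx
    have hx1 : r ≠ x := hx.ne'
    have hx2 : r' ≠ x := (hx.trans hr).ne'
    unfold cnt
    congr 1
    apply filter_congr
    intro b _
    rcases hl b with ⟨hh, _, wh | wh⟩ | ⟨hh, _, wh⟩ | ⟨hh, _, wh⟩ | ⟨hh, _, wh⟩ <;> simp [hh, wh, hx1, hx2]
  · unfold cnt
    rw [← card_filter_add_card_filter_not (s := univ.filter fun b => R b = r) (fun b => s b < θ),
      filter_filter, filter_filter]
    have hd : Disjoint (univ.filter fun b => R b = r' ∧ lee ep (s b) θ)
        (univ.filter fun b => R b = r ∧ ¬ s b < θ) := by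
      rw [disjoint_left]
      intro b hh wh
      simp only [mem_filter, mem_univ, true_and] at hh wh
      exact hne (wh.1.symm.trans hh.1)
    have hsub : (univ.filter fun b => R b = r' ∧ lee ep (s b) θ) ∪
        (univ.filter fun b => R b = r ∧ ¬ s b < θ) ⊆ univ.filter fun b => l b = r := by
      intro b hb
      simp only [mem_union, mem_filter, mem_univ, true_and] at hb ⊢
      rcases hl b with ⟨hh, wr, wh | wh⟩ | ⟨hh, _, wh⟩ | ⟨hh, _, wh⟩ | ⟨hh, wr, wh⟩
      · exact wh
      · rcases hb with hb | hb
        · exact absurd (hh.symm.trans hb.1) hne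
        · exact absurd wr hb.2
      · exact wh
      · exact wh
      · rcases hb with hb | hb
        · exact absurd hb wr
        · exact absurd hb.1 hh
    have := card_le_card hsub
    rw [card_union_of_disjoint hd] at this
    omega

lemma fS_comp (R : Fin d → Fin t) (S : Fin d → Fin q) (σ : Perm (Fin d)) :
    fS R (S ∘ σ) = ∑ b, (S b).val * (t - ((R ∘ ⇑(σ⁻¹ : Perm (Fin d))) b).val) := by
  unfold fS
  rw [← Equiv.sum_comp σ fun b => (S b).val * (t - ((R ∘ ⇑(σ⁻¹ : Perm (Fin d))) b).val)]
  refine sum_congr rfl fun b _ => ?_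
  simp

lemma str1 {ep : Bool} {R : Fin d → Fin t} {S : Fin d → Fin q} (hS : ¬ Ss ep R S)
    (hinj : ep = true → ∀ a b, S a = S b → R a = R b → a = b) :
    ∃ y : MM k d t ep q, y ∈ TW k (MM k d t ep q) (wt R) ∧ (xi (wt R) : BB k d t) • y = y ∧ y.1 S R = 1 ∧
      ∀ S', y.1 S' R ≠ 0 → fS R S' ≤ fS R S ∧ (fS R S' = fS R S → ∃ ρ : Perm (Fin d), S' = S ∘ ρ ∧ R = R ∘ ρ) := by
  unfold Ss at hS
  push Not at hS
  obtain ⟨r, r', hr, θ, hs⟩ := hS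
  set m0 : Fin d → Option (Fin t) := fun b => mu ep r r' θ (R b) (S b).val with hm0
  have hi : ep = true → ∀ a b, S a = S b → m0 a = m0 b → a = b := by
    intro he a b hab hm
    refine hinj he a b hab ?_
    subst he
    simp only [hm0, hab] at hm
    exact mu_inj hr hm
  set uu : (Fin d → Fin q) → (Fin d → Option (Fin t)) → k := Eo ep m0 S with huu
  have hu : IsM ep uu := Eo_isM hi
  let w : MM k d t ep q := ⟨fun S' l => ∑ m, tpk (kb r r') l m * uu S' m,
    hu.kern _ fun σ i m => tpk_comp _ i m σ⟩
  have hw : w ∈ TW k (MM k d t ep q) (wt R) := by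
    refine TW_of _ _ fun w' hw' => MM.ext' fun S' l => ?_
    rw [MM.xi_smul]
    split_ifs with hl
    swap; · rfl
    show ∑ m, tpk (kb r r') l m * uu S' m = 0
    refine sum_eq_zero fun m _ => ?_
    by_contra hne
    obtain ⟨hh, wh⟩ := mul_ne_zero_iff.1 hne
    obtain ⟨σ, rfl, rfl⟩ := Eo_ex wh
    apply hw'
    rw [← hl, ← wt_comp l σ⁻¹]
    refine supp_wt (k := k) hr hs fun b => ?_
    have := Finset.prod_ne_zero_iff.1 hh (σ⁻¹ b) (mem_univ _)
    simpa using this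
  have hval : ∀ S', ((tp (Matrix.of (kc r r')) : BB k d t) • w).1 S' R = ∑ m, tpk (kg r r') R m * uu S' m := by
    intro S'
    rw [MM.smul_apply]
    show ∑ j, tpk (kc r r') R j * ∑ m, tpk (kb r r') j m * uu S' m = _
    simp only [← tpk_mul _ _ _ (kcb (k := k) hr), mul_sum, sum_mul]
    rw [sum_comm]
    refine sum_congr rfl fun m _ => sum_congr rfl fun l _ => ?_
    ring
  refine ⟨(xi (wt R) : BB k d t) • (tp (Matrix.of (kc r r')) : BB k d t) • w,
    smul_mem _ _ (smul_mem _ _ hw), by rw [← mul_smul, xi_idem], ?_, ?_⟩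
  · rw [MM.xi_smul, if_pos rfl, hval, sum_eq_single m0]
    · rw [tpk_kg_one fun b => okk_self ep θ (R b) (S b).val]
      have := Eo_val (k := k) hi 1
      rw [chi_one] at this
      rw [one_mul]; exact this
    · intro m _ hm
      by_contra hne
      obtain ⟨hh, wh⟩ := mul_ne_zero_iff.1 hne
      obtain ⟨σ, wr, rfl⟩ := Eo_ex wh
      have hok : ∀ b, okk r r' ((R ∘ ⇑(σ⁻¹ : Perm (Fin d))) b) (mu ep r r' θ (R b) (S b).val) := by
        intro b
        have := tpk_kg_ne hh (σ⁻¹ b)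
        simpa using this
      have hc := (cmp1 hr σ⁻¹ rfl hok).2 (by rw [← fS_comp, ← wr]; rfl)
      have h4 := cmp4 hr σ⁻¹ rfl hok hc
      apply hm
      funext b
      have := h4 (σ b)
      have e6 : (R ∘ ⇑(σ⁻¹ : Perm (Fin d))) (σ b) = R b := by simp
      rw [e6] at this
      show m0 (σ b) = m0 b
      rw [hm0]
      show mu ep r r' θ (R (σ b)) (S (σ b)).val = mu ep r r' θ (R b) (S b).val
      rw [← this]
      have h5 := congrFun wr b
      rw [Function.comp_apply] at h5
      rw [← h5]
    · simp
  · intro S' hS'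
    rw [MM.xi_smul, if_pos rfl, hval] at hS'
    obtain ⟨m, _, hne⟩ := Finset.exists_ne_zero_of_sum_ne_zero hS'
    obtain ⟨hh, wh⟩ := mul_ne_zero_iff.1 hne
    obtain ⟨σ, rfl, rfl⟩ := Eo_ex wh
    have hok : ∀ b, okk r r' ((R ∘ ⇑(σ⁻¹ : Perm (Fin d))) b) (mu ep r r' θ (R b) (S b).val) := by
      intro b
      have := tpk_kg_ne hh (σ⁻¹ b)
      simpa using this
    have hc := cmp1 hr σ⁻¹ rfl hok
    rw [← fS_comp] at hc
    refine ⟨hc.1, fun he => ?_⟩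
    obtain ⟨τ, wr, h4⟩ := cmp3 σ⁻¹ rfl (hc.2 he)
    refine ⟨τ * σ, ?_, ?_⟩
    · rw [Perm.coe_mul, ← comp_assoc, ← h4]
    · rw [Perm.coe_mul, ← comp_assoc, ← wr]; funext b; simp

lemma MM_zero {ep : Bool} {R : Fin d → Fin t} {z : MM k d t ep q} (hz : (xi (wt R) : BB k d t) • z = z)
    (h : ∀ S, z.1 S R = 0) : z = 0 := by
  refine MM.ext' fun S i => ?_
  rw [← hz, MM.xi_smul]
  split_ifs with hi
  swap; · rfl
  obtain ⟨σ, rfl⟩ := exists_perm_wt hi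
  have := z.2.inv σ (S ∘ ⇑(σ⁻¹ : Perm (Fin d))) R
  rw [h, mul_zero] at this
  have e : (S ∘ ⇑(σ⁻¹ : Perm (Fin d))) ∘ σ = S := by funext b; simp
  rw [e] at this
  exact this

/-- straightening -/
lemma straighten {ep : Bool} {R : Fin d → Fin t} (P : MM k d t ep q → Prop)
    (hP : ∀ z y, P z → y ∈ TW k (MM k d t ep q) (wt R) → P (z - y))
    (hdet : ∀ z S, P z → Ss ep R S → z.1 S R ≠ 0 → (∀ S', z.1 S' R ≠ 0 → fS R S' ≤ fS R S) → False)
    (z : MM k d t ep q) (hz : (xi (wt R) : BB k d t) • z = z) (hPz : P z) :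
    z ∈ TW k (MM k d t ep q) (wt R) := by
  classical
  suffices H : ∀ (F : ℕ) (z : MM k d t ep q), (xi (wt R) : BB k d t) • z = z → P z →
      (∀ S, z.1 S R ≠ 0 → fS R S < F) → z ∈ TW k (MM k d t ep q) (wt R) by
    refine H ((univ.sup fun S : Fin d → Fin q => fS R S) + 1) z hz hPz fun S _ => ?_
    exact Nat.lt_succ_of_le (le_sup (f := fun S : Fin d → Fin q => fS R S) (mem_univ S))
  intro F
  induction F with
  | zero =>
    intro z hz _ h
    rw [MM_zero hz fun S => by_contra fun hc => absurd (h S hc) (by omega)]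
    exact Submodule.zero_mem _
  | succ F ih =>
    suffices H : ∀ (n : ℕ) (z : MM k d t ep q), (xi (wt R) : BB k d t) • z = z → P z →
        (∀ S, z.1 S R ≠ 0 → fS R S < F + 1) →
        (univ.filter fun S => z.1 S R ≠ 0 ∧ fS R S = F).card ≤ n →
        z ∈ TW k (MM k d t ep q) (wt R) from fun z hh wh wr => H _ z hh wh wr le_rfl
    intro n
    induction n with
    | zero =>
      intro z hh wh wr h4
      refine ih z hh wh fun S hS => ?_
      have h5 := wr S hS
      by_contra hc
      have : S ∈ (univ.filter fun S => z.1 S R ≠ 0 ∧ fS R S = F) := by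
        simp only [mem_filter, mem_univ, true_and]; exact ⟨hS, by omega⟩
      have := card_pos.2 ⟨S, this⟩
      omega
    | succ n ihn =>
      intro z hh wh wr h4
      by_cases hne : ∃ S, z.1 S R ≠ 0 ∧ fS R S = F
      swap
      · refine ihn z hh wh wr ?_
        rw [Finset.filter_false_of_mem]
        · simp
        · intro S _ hS; exact hne ⟨S, hS⟩
      obtain ⟨S, hS, hF⟩ := hne
      have hss : ¬ Ss ep R S := fun hc => hdet z S wh hc hS fun S' hS' => by
        have := wr S' hS'; omega
      have hinj : ep = true → ∀ a b, S a = S b → R a = R b → a = b := by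
        intro he a b h5 h6
        by_contra hab
        exact hS (z.2.van he a b hab S R h5 h6)
      obtain ⟨y, hy1, hy2, hy3, hy4⟩ := str1 (k := k) hss hinj
      have hcy := smul_mem _ (algebraMap k (BB k d t) (z.1 S R)) hy1
      have hv : ∀ S', (z - algebraMap k (BB k d t) (z.1 S R) • y).1 S' R = z.1 S' R - z.1 S R * y.1 S' R := by
        intro S'; rw [MM.sub_apply, MM.scal_apply]
      have key : z - algebraMap k (BB k d t) (z.1 S R) • y ∈ TW k (MM k d t ep q) (wt R) := by
        have hzS' : ∀ S', fS R S' = F → y.1 S' R ≠ 0 → z.1 S' R ≠ 0 := by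
          intro S' h5 h6
          obtain ⟨ρ, h7, h8⟩ := (hy4 S' h6).2 (h5.trans hF.symm)
          have := z.2.inv ρ S R
          rw [← h8, ← h7] at this
          rw [this]
          exact mul_ne_zero (chi_ne _ _) hS
        refine ihn _ ?_ (hP z _ wh hcy) ?_ ?_
        · rw [smul_sub, hh, ← mul_smul, ← Algebra.commutes, mul_smul, hy2]
        · intro S' hS'
          rw [hv] at hS'
          by_cases h5 : y.1 S' R = 0
          · rw [h5, mul_zero, sub_zero] at hS'; exact wr S' hS'
          · have := (hy4 S' h5).1; omega
        · refine Nat.le_of_lt_succ (lt_of_lt_of_le (card_lt_card ?_) h4)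
          rw [ssubset_iff_of_subset]
          · refine ⟨S, by simp [hS, hF], ?_⟩
            simp only [mem_filter, mem_univ, true_and, not_and]
            intro h5
            rw [hv, hy3, mul_one, sub_self] at h5
            exact absurd rfl h5
          · intro S' hS'
            simp only [mem_filter, mem_univ, true_and] at hS' ⊢
            refine ⟨?_, hS'.2⟩
            by_cases h5 : y.1 S' R = 0
            · have h6 := hS'.1
              rw [hv, h5, mul_zero, sub_zero] at h6; exact h6
            · exact hzS' S' hS'.2 h5
      have := Submodule.add_mem _ key hcy
      rwa [sub_add_cancel] at this

end SY

section SZ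
open Equiv

variable {k : Type u} [Field k] {d t q : ℕ}

lemma card_comp (p : Fin d → Prop) [DecidablePred p] (σ : Perm (Fin d)) :
    (univ.filter fun b => p (σ b)).card = (univ.filter p).card := by
  refine card_bij (fun b _ => σ b) ?_ ?_ ?_
  · intro b hb; simpa using hb
  · intro a _ b _ h; exact σ.injective h
  · intro b hb; exact ⟨σ⁻¹ b, by simpa using hb, by simp⟩

def col (R : Fin d → Fin t) (b : Fin d) : ℕ := (univ.filter fun a => R a = R b ∧ a < b).card

lemma col_lt {R : Fin d → Fin t} {a b : Fin d} (h : R a = R b) (hab : a < b) : col R a < col R b := by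
  refine card_lt_card ?_
  rw [ssubset_iff_of_subset]
  · exact ⟨a, by simp [h, hab], by simp⟩
  · intro c hc
    simp only [mem_filter, mem_univ, true_and] at hc ⊢
    exact ⟨hc.1.trans h, hc.2.trans hab⟩

lemma col_inj {R : Fin d → Fin t} {a b : Fin d} (h : R a = R b) (h' : col R a = col R b) : a = b := by
  rcases lt_trichotomy a b with hh | hh | hh
  · exact absurd h' (col_lt h hh).ne
  · exact hh
  · exact absurd h'.symm (col_lt h.symm hh).ne

lemma col_lt_cnt (R : Fin d → Fin t) (b : Fin d) : col R b < cnt R (R b) := by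
  refine card_lt_card ?_
  rw [ssubset_iff_of_subset]
  · exact ⟨b, by simp, by simp⟩
  · intro c hc
    simp only [mem_filter, mem_univ, true_and] at hc ⊢
    exact hc.1

lemma col_ex {R : Fin d → Fin t} {r : Fin t} {c : ℕ} (h : c < cnt R r) : ∃ b, R b = r ∧ col R b = c := by
  have hh : (univ.filter fun b => R b = r).image (col R) = Finset.range (cnt R r) := by
    apply eq_of_subset_of_card_le
    · intro x hx
      rw [mem_image] at hx
      obtain ⟨b, hb, rfl⟩ := hx
      simp only [mem_filter, mem_univ, true_and] at hb
      rw [mem_range, ← hb]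
      exact col_lt_cnt R b
    · rw [Finset.card_image_of_injOn, card_range]
      · rfl
      · intro a ha b hb hab
        simp only [coe_filter, mem_univ, true_and, Set.mem_ofPred_eq] at ha hb
        exact col_inj (ha.trans hb.symm) hab
  have wh := mem_range.2 h
  rw [← hh, mem_image] at wh
  obtain ⟨b, hb, hc⟩ := wh
  exact ⟨b, by simpa using hb, hc⟩

lemma row_le (R : Fin d → Fin t) (r : Fin t) (c : ℕ) :
    (univ.filter fun b => R b = r ∧ col R b < c).card ≤ c := by
  conv_rhs => rw [← card_range c]
  refine Finset.card_le_card_of_injOn (col R) ?_ ?_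
  · intro b hb
    simp only [coe_filter, mem_univ, true_and, Set.mem_ofPred_eq] at hb
    simpa using hb.2
  · intro a ha b hb hab
    simp only [coe_filter, mem_univ, true_and, Set.mem_ofPred_eq] at ha hb
    exact col_inj (ha.1.trans hb.1.symm) hab

lemma row_ge (R : Fin d → Fin t) (b : Fin d) :
    col R b + 1 ≤ (univ.filter fun a => R a = R b ∧ col R a ≤ col R b).card := by
  conv_lhs => rw [← card_range (col R b + 1)]
  refine le_trans (card_le_card ?_) (Finset.card_image_le (f := col R))
  intro c hc
  rw [mem_range] at hc
  obtain ⟨a, hh, wh⟩ := col_ex (R := R) (r := R b) (c := c) (by have := col_lt_cnt R b; omega)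
  rw [mem_image]
  exact ⟨a, by simp [hh]; omega, wh⟩

lemma sortk (K P S : Fin d → ℕ) : ∃ τ : Perm (Fin d), K ∘ τ = K ∧
    ∀ a b, K a = K b → P a < P b → S (τ a) ≤ S (τ b) := by
  let f : Fin d → ℕ ×ₗ ℕ := fun b => toLex (K b, S b)
  let g : Fin d → ℕ ×ₗ ℕ := fun b => toLex (K b, P b)
  have hf := Tuple.monotone_sort f
  have hg := Tuple.monotone_sort g
  have hfst : Monotone (fun x : ℕ ×ₗ ℕ => (ofLex x).1) := Prod.Lex.monotone_fst
  have hh : K ∘ Tuple.sort f = K ∘ Tuple.sort g :=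
    Tuple.unique_monotone (hfst.comp hf) (hfst.comp hg)
  refine ⟨Tuple.sort f * (Tuple.sort g)⁻¹, ?_, ?_⟩
  · rw [Perm.coe_mul, ← comp_assoc, hh]; funext b; simp
  · intro a b hab hP
    have wh : (Tuple.sort g)⁻¹ a ≤ (Tuple.sort g)⁻¹ b := by
      by_contra hc
      push Not at hc
      have := hg hc.le
      have e : ∀ c, Tuple.sort g ((Tuple.sort g)⁻¹ c) = c := fun c => by simp
      simp only [Function.comp_apply, e] at this
      simp only [g, Prod.Lex.toLex_le_toLex] at this
      rcases this with this | this <;> omega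
    have wr := hf wh
    have h4 : ∀ c, K (Tuple.sort f ((Tuple.sort g)⁻¹ c)) = K c := fun c => by
      have := congrFun hh ((Tuple.sort g)⁻¹ c)
      simpa using this
    simp only [Function.comp_apply, f, Prod.Lex.toLex_le_toLex, h4] at wr
    rcases wr with wr | wr
    · omega
    · exact wr.2

lemma wt_ptw {R j : Fin d → Fin t} (h : ∀ b, R b ≤ j b) : wt j < wt R ∨ j = R := by
  by_contra hc
  push Not at hc
  obtain ⟨hh, wh⟩ := hc
  have key : ∀ n : ℕ, ∀ r : Fin t, r.val = n → ∀ b, j b = r ↔ R b = r := by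
    intro n
    induction n using Nat.strong_induction_on with
    | _ n ih =>
      intro r hr
      have hsub : (univ.filter fun b => j b = r) ⊆ (univ.filter fun b => R b = r) := by
        intro b hb
        simp only [mem_filter, mem_univ, true_and] at hb ⊢
        by_contra hne
        have hlt : R b < r := lt_of_le_of_ne (hb ▸ h b) hne
        have := (ih (R b).val (by rw [← hr]; exact hlt) (R b) rfl b).2 rfl
        exact hne (this.symm.trans hb)
      have heq := eq_of_subset_of_card_le hsub (by
        by_contra hlt
        push Not at hlt
        refine hh (wt_lt.2 ⟨r, fun r' hr' => ?_, hlt⟩)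
        unfold cnt
        congr 1
        apply filter_congr
        intro b _
        exact ih r'.val (by rw [← hr]; exact hr') r' rfl b)
      intro b
      have := Finset.ext_iff.1 heq b
      simpa using this
  apply wh
  funext b
  exact ((key _ (R b) rfl b).2 rfl)

def Dom (R : Fin d → Fin t) : Prop := ∀ r r' : Fin t, r < r' → cnt R r' ≤ cnt R r

lemma low_wt {R i : Fin d → Fin t} (hR : Dom R)
    (hi : ∀ a b, col R a = col R b → i a = i b → a = b) :
    wt i < wt R ∨ ∃ σ : Perm (Fin d), col R ∘ σ = col R ∧ i = R ∘ σ := by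
  obtain ⟨τ, hh, wh⟩ := sortk (col R) (fun b => (R b).val) (fun b => (i b).val)
  have wr : ∀ a b, col R a = col R b → R a < R b → i (τ a) < i (τ b) := by
    intro a b hab hlt
    refine lt_of_le_of_ne (wh a b hab hlt) fun he => ?_
    have := hi (τ a) (τ b) ((congrFun hh a).trans (hab.trans (congrFun hh b).symm)) he
    rw [τ.injective this] at hlt
    exact lt_irrefl _ hlt
  have h4 : ∀ n : ℕ, ∀ b, (R b).val = n → n ≤ (i (τ b)).val := by
    intro n
    induction n with
    | zero => intros; exact Nat.zero_le _
    | succ n ih =>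
      intro b hb
      have hn : n < t := by have := (R b).isLt; omega
      have hlt : (⟨n, hn⟩ : Fin t) < R b := by rw [Fin.lt_def]; simp; omega
      obtain ⟨a, ha1, ha2⟩ := col_ex (R := R) (r := ⟨n, hn⟩) (c := col R b)
        (lt_of_lt_of_le (col_lt_cnt R b) (hR _ _ hlt))
      have h5 := ih a (by rw [ha1])
      have h6 : i (τ a) < i (τ b) := wr a b ha2 (by rw [ha1]; exact hlt)
      have : (i (τ a)).val < (i (τ b)).val := h6
      omega
  rcases wt_ptw (R := R) (j := i ∘ τ) (fun b => h4 _ b rfl) with h5 | h5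
  · left; rwa [wt_comp] at h5
  · right
    refine ⟨τ⁻¹, ?_, ?_⟩
    · conv_lhs => rw [← hh]
      funext b; simp
    · rw [← h5]; funext b; simp

lemma ss_comp {ep : Bool} {R : Fin d → Fin t} {S : Fin d → Fin q} (h : Ss ep R S) {τ : Perm (Fin d)}
    (hτ : R ∘ τ = R) : Ss ep R (S ∘ τ) := by
  intro r r' hr θ
  have := h r r' hr θ
  rw [← card_comp _ τ] at this
  conv_rhs at this => rw [← card_comp _ τ]
  have e : ∀ b, R (τ b) = R b := fun b => congrFun hτ b
  simpa only [e, Function.comp_apply] using this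

lemma ss_col {ep : Bool} {R : Fin d → Fin t} {S : Fin d → Fin q} (h : Ss ep R S)
    (hs : ∀ a b, R a = R b → col R a < col R b → (S a).val ≤ (S b).val) {a b : Fin d}
    (hab : col R a = col R b) (hlt : R a < R b) {θ : ℕ} (hh : lee ep (S b).val θ) (wh : θ ≤ (S a).val) :
    False := by
  have wr := h (R a) (R b) hlt θ
  have h4 : (univ.filter fun c => R c = R b ∧ col R c ≤ col R b) ⊆
      univ.filter fun c => R c = R b ∧ lee ep (S c).val θ := by
    intro c hc
    simp only [mem_filter, mem_univ, true_and] at hc ⊢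
    refine ⟨hc.1, ?_⟩
    rcases hc.2.lt_or_eq with h5 | h5
    · have h6 := hs c b hc.1 h5
      unfold lee at hh ⊢
      rcases hh with hh | hh
      · left; omega
      · rcases h6.lt_or_eq with h7 | h7
        · left; omega
        · right; exact ⟨hh.1, by omega⟩
    · rw [col_inj hc.1 h5]; exact hh
  have h5 : (univ.filter fun c => R c = R a ∧ (S c).val < θ) ⊆
      univ.filter fun c => R c = R a ∧ col R c < col R a := by
    intro c hc
    simp only [mem_filter, mem_univ, true_and] at hc ⊢
    refine ⟨hc.1, ?_⟩
    by_contra hcc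
    push Not at hcc
    rcases hcc.lt_or_eq with h6 | h6
    · have := hs a c hc.1.symm h6; omega
    · have h7 := hc.2
      rw [← col_inj hc.1.symm h6] at h7; omega
  have h6 := card_le_card h4
  have h7 := card_le_card h5
  have h8 := row_ge R b
  have h9 := row_le R (R a) (col R a)
  omega

lemma fS_min {R : Fin d → Fin t} {S : Fin d → Fin q}
    (hc : ∀ a b, col R a = col R b → R a < R b → (S a).val ≤ (S b).val) {σ : Perm (Fin d)}
    (hσ : col R ∘ σ = col R) : fS R S ≤ fS R (S ∘ σ) ∧ (fS R (S ∘ σ) ≤ fS R S → S ∘ σ = S) := by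
  let F : Fin d → ℤ := fun b => (S b).val + q * col R b
  let G : Fin d → ℤ := fun b => (R b).val + t * col R b
  have hG : ∀ a b, G a ≤ G b → (col R a < col R b) ∨ (col R a = col R b ∧ R a ≤ R b) := by
    intro a b hab
    simp only [G] at hab
    have hh := (R a).isLt
    have wh := (R b).isLt
    rcases lt_trichotomy (col R a) (col R b) with h | h | h
    · exact Or.inl h
    · refine Or.inr ⟨h, ?_⟩
      rw [h] at hab
      rw [Fin.le_def]
      omega
    · exfalso
      have wr : ((col R b : ℤ) + 1) ≤ col R a := by exact_mod_cast h
      have : (t : ℤ) * (col R b + 1) ≤ t * col R a := mul_le_mul_of_nonneg_left wr (by omega)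
      have h4 : ((R b).val : ℤ) < t := by exact_mod_cast wh
      nlinarith
  have hFG : ∀ a b, G a ≤ G b → F a ≤ F b := by
    intro a b hab
    simp only [F]
    rcases hG a b hab with h | ⟨h, h'⟩
    · have wr : ((col R a : ℤ) + 1) ≤ col R b := by exact_mod_cast h
      have : (q : ℤ) * (col R a + 1) ≤ q * col R b := mul_le_mul_of_nonneg_left wr (by omega)
      have h4 : ((S a).val : ℤ) < q := by exact_mod_cast (S a).isLt
      nlinarith
    · rw [h]
      rcases h'.lt_or_eq with h5 | h5
      · have := hc a b h h5; omega
      · rw [col_inj h5 h]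
  have hmv : Monovary F G := fun a b hab => hFG a b hab.le
  have hcs : ∀ b, col R (σ b) = col R b := fun b => congrFun hσ b
  have key : ∑ b, F (σ b) * G b - ∑ b, F b * G b = (fS R S : ℤ) - fS R (S ∘ σ) := by
    unfold fS
    push_cast
    have es : ∀ b, F (σ b) * G b = ((S (σ b)).val : ℤ) * t + q * col R b * G b
        + t * (((S (σ b)).val : ℤ) * col R (σ b)) - ((S (σ b)).val : ℤ) * ((t - (R b).val : ℕ) : ℤ) := by
      intro b
      rw [Nat.cast_sub (R b).isLt.le]
      simp only [F, G, hcs]; ring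
    have e2 : ∀ b, F b * G b = ((S b).val : ℤ) * t + q * col R b * G b
        + t * (((S b).val : ℤ) * col R b) - ((S b).val : ℤ) * ((t - (R b).val : ℕ) : ℤ) := by
      intro b
      rw [Nat.cast_sub (R b).isLt.le]
      simp only [F, G]; ring
    simp only [es, e2, sum_add_distrib, sum_sub_distrib, ← mul_sum,
      ← sum_mul]
    rw [Equiv.sum_comp σ fun b => ((S b).val : ℤ), Equiv.sum_comp σ fun b => ((S b).val : ℤ) * (col R b : ℤ)]
    simp only [Function.comp_apply]
    ring
  have hh := hmv.sum_comp_perm_mul_le_sum_mul (σ := σ)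
  refine ⟨by omega, fun hle => ?_⟩
  have wh : ∑ b, F (σ b) * G b = ∑ b, F b * G b := by omega
  have wr : Monovary (F ∘ σ) G := (hmv.sum_comp_perm_mul_eq_sum_mul_iff (σ := σ)).1 wh
  have hs := Tuple.monotone_sort G
  have hGi : ∀ a b, G a = G b → a = b := by
    intro a b hab
    rcases hG a b hab.le with h | ⟨h, h'⟩
    · rcases hG b a hab.ge with h5 | ⟨h5, _⟩ <;> omega
    · rcases hG b a hab.ge with h5 | ⟨h5, h6⟩
      · omega
      · exact col_inj (le_antisymm h' h6) h
  have m1 : Monotone (F ∘ Tuple.sort G) := fun a b hab => hFG _ _ (hs hab)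
  have m2 : Monotone (F ∘ (σ * Tuple.sort G : Perm (Fin d))) := by
    intro a b hab
    rcases (hs hab).lt_or_eq with h5 | h5
    · exact wr h5
    · have := (Tuple.sort G).injective (hGi _ _ h5)
      rw [this]
  have h4 := Tuple.unique_monotone m1 m2
  funext b
  have h5 := congrFun h4 ((Tuple.sort G)⁻¹ b)
  have e : ∀ c, Tuple.sort G ((Tuple.sort G)⁻¹ c) = c := fun c => by simp
  simp only [Function.comp_apply, Perm.coe_mul, e] at h5
  simp only [F, hcs] at h5
  exact Fin.ext (by simp only [Function.comp_apply]; omega)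

end SZ

section SP
open Equiv

variable {k : Type u} [Field k] {d t q : ℕ}

lemma swap_comp_IsM {ep : Bool} {A : Type*} {K : (Fin d → Fin q) → (Fin d → A) → k} (hK : IsM ep K)
    {c : Fin d → A} {a b : Fin d} (h : c a = c b) (S) : K (S ∘ swap a b) c = chi ep (swap a b) * K S c := by
  have := hK.inv (swap a b) S c
  rwa [swap_eq h] at this

/-- detection map -/
def phi {ep : Bool} (K : (Fin d → Fin q) → (Fin d → ℕ) → k) (hK : IsM (!ep) K) (c : Fin d → ℕ) :
    MM k d t ep q →ₗ[BB k d t] FF k t (fun b => 2 * c b + 1) where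
  toFun x := ⟨fun i => ∑ S, K S c * x.1 S i, by
    have hx : IsM ep x.1 := x.2
    have key : ∀ a b, a ≠ b → c a = c b → ∀ S i, K (S ∘ swap a b) c * x.1 (S ∘ swap a b) (i ∘ swap a b)
        = - (K S c * x.1 S i) := by
      intro a b hab h S i
      rw [swap_comp_IsM hK h, hx.inv]
      have := chi_not (k := k) ep (swap a b)
      rw [sg_swap hab] at this
      linear_combination (K S c * x.1 S i) * this
    refine ⟨fun a b _ _ h => absurd h (by simp), ?_, ?_⟩
    · intro a b hab h _ i
      show ∑ S, K S c * x.1 S (i ∘ swap a b) = - ∑ S, K S c * x.1 S i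
      rw [← sum_perm (swap a b), ← sum_neg_distrib]
      exact sum_congr rfl fun S _ => key a b hab (by omega) S i
    · intro a b hab h _ i hi
      show ∑ S, K S c * x.1 S i = 0
      refine sum_van a b _ ?_ ?_
      · intro S
        have := key a b hab (by omega) S i
        rwa [swap_eq hi] at this
      · intro S hS
        cases ep with
        | true => rw [hx.van rfl a b hab S i hS hi, mul_zero]
        | false => rw [hK.van rfl a b hab S c hS (by omega), zero_mul]⟩
  map_add' x y := by
    apply Subtype.ext
    funext i
    show ∑ S, K S c * (x.1 S i + y.1 S i) = ∑ S, K S c * x.1 S i + ∑ S, K S c * y.1 S i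
    simp only [mul_add, sum_add_distrib]
  map_smul' a x := by
    apply Subtype.ext
    funext i
    show ∑ S, K S c * ∑ j, a.e i j * x.1 S j = ∑ j, a.e i j * ∑ S, K S c * x.1 S j
    simp only [mul_sum]
    rw [sum_comm]
    refine sum_congr rfl fun j _ => sum_congr rfl fun S _ => by ring

def ll (R : Fin d → Fin t) : Fin d → ℕ := fun b => 2 * col R b + 1

lemma ll_odd (R : Fin d → Fin t) : AllOdd (ll R) := fun a => by simp [ll]

lemma mem_St_ll {R : Fin d → Fin t} {σ : Perm (Fin d)} : σ ∈ St (ll R) ↔ col R ∘ σ = col R := by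
  rw [mem_St]
  constructor
  · intro h; funext b; have := congrFun h b; simp only [ll, Function.comp_apply] at this ⊢; omega
  · intro h; funext b; have := congrFun h b; simp only [ll, Function.comp_apply] at this ⊢; omega

lemma detect {ep : Bool} {R : Fin d → Fin t} (z : MM k d t ep q) (S : Fin d → Fin q) (hS : Ss ep R S)
    (hz : z.1 S R ≠ 0) (hmax : ∀ S', z.1 S' R ≠ 0 → fS R S' ≤ fS R S) :
    ∃ φ : MM k d t ep q →ₗ[BB k d t] FF k t (ll R), φ z ≠ 0 := by
  obtain ⟨τ, hh, wh⟩ := sortk (fun b => (R b).val) (col R) (fun b => (S b).val)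
  have hτ : R ∘ τ = R := by funext b; exact Fin.ext (congrFun hh b)
  have hτ' : R ∘ ⇑(τ⁻¹ : Perm (Fin d)) = R := by
    conv_lhs => rw [← hτ]
    funext b; simp
  have hf : fS R (S ∘ τ) = fS R S := by rw [fS_comp, hτ']; rfl
  have hz1 : z.1 (S ∘ τ) R ≠ 0 := by
    have hx : IsM ep z.1 := z.2
    have := hx.inv τ S R
    rw [hτ] at this
    rw [this]
    exact mul_ne_zero (chi_ne _ _) hz
  have hS1 := ss_comp hS hτ
  have hrow : ∀ a b, R a = R b → col R a < col R b → ((S ∘ τ) a).val ≤ ((S ∘ τ) b).val :=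
    fun a b h h' => wh a b (by rw [h]) h'
  generalize S ∘ τ = S1 at *
  rw [← hf] at hmax
  have hc : ∀ a b, col R a = col R b → R a < R b → (S1 a).val ≤ (S1 b).val := by
    intro a b h h'
    by_contra hlt
    push Not at hlt
    exact ss_col hS1 hrow h h' (θ := (S1 a).val) (Or.inl hlt) le_rfl
  have hinj : (!ep) = true → ∀ a b, S1 a = S1 b → col R a = col R b → a = b := by
    intro he
    have hlt : ∀ a b, col R a = col R b → R a < R b → S1 a = S1 b → False := by
      intro a b h h' h''
      refine ss_col hS1 hrow h h' (θ := (S1 a).val) (Or.inr ⟨by simpa using he, by rw [h'']⟩) le_rfl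
    intro a b h h'
    rcases lt_trichotomy (R a) (R b) with wr | wr | wr
    · exact (hlt a b h' wr h).elim
    · exact col_inj wr h'
    · exact (hlt b a h'.symm wr h.symm).elim
  refine ⟨phi (Eo (!ep) (col R) S1) (Eo_isM hinj) (col R), fun gr => hz1 ?_⟩
  have wr := congrFun (congrArg Subtype.val gr) R
  change ∑ S, Eo (!ep) (col R) S1 S (col R) * z.1 S R = 0 at wr
  rw [sum_eq_single S1] at wr
  · have := Eo_val (k := k) hinj 1
    rw [chi_one] at this
    change Eo (!ep) (col R) S1 S1 (col R) = 1 at this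
    rw [this, one_mul] at wr
    exact wr
  · intro S' _ hne
    by_contra hc0
    obtain ⟨σ, rfl, h5⟩ := Eo_ex (left_ne_zero_of_mul hc0)
    exact hne ((fS_min hc h5.symm).2 (hmax _ (right_ne_zero_of_mul hc0)))
  · simp

lemma FF_low {R : Fin d → Fin t} (hR : Dom R) (z : FF k t (ll R)) (i) (hi : ¬ wt i < wt R) :
    z.1 i = 0 ∨ ∃ σ ∈ St (ll R), i = R ∘ σ := by
  by_cases h : ∀ a b, col R a = col R b → i a = i b → a = b
  · rcases low_wt hR h with hh | ⟨σ, hh, wh⟩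
    · exact absurd hh hi
    · exact Or.inr ⟨σ, mem_St_ll.2 hh, wh⟩
  · push Not at h
    obtain ⟨a, b, hh, wh, wr⟩ := h
    have hz : IsF (ll R) z.1 := z.2
    exact Or.inl (hz.van a b wr (by simp [ll, hh]) (ll_odd R a) i wh)

def yy (k : Type u) [Field k] (R : Fin d → Fin t) : FF k t (ll R) := ⟨al (ll R) (ee R), al_mem (ll_odd R) _⟩

lemma yy_R (R : Fin d → Fin t) : (yy k R).1 R = 1 := by
  show al (ll R) (ee R) R = 1
  rw [al_apply, sum_eq_single 1]
  · rw [sg_one, one_mul]; show (if R = R then (1:k) else 0) = 1; rw [if_pos rfl]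
  · intro σ hσ hne
    have : ¬ R ∘ σ = R := fun h => hne (by
      ext1 b
      exact col_inj (congrFun h b) (congrFun (mem_St_ll.1 hσ) b))
    show sg σ * (if R ∘ σ = R then (1:k) else 0) = 0
    rw [if_neg this, mul_zero]
  · intro h; exact absurd St_one h

lemma yy_w (R : Fin d → Fin t) : (xi (wt R) : BB k d t) • yy k R = yy k R := by
  apply Subtype.ext
  show (xi (wt R) : BB k d t) • al (ll R) (ee R : XX k d t) = al (ll R) (ee R)
  rw [← map_smul]
  congr 1
  funext i
  rw [xi_smul]
  unfold ee
  by_cases h : i = R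
  · simp [h]
  · simp [h]

lemma FF_one {R : Fin d → Fin t} (hR : Dom R) (z : FF k t (ll R)) :
    (xi (wt R) : BB k d t) • z = algebraMap k (BB k d t) (z.1 R) • yy k R := by
  apply Subtype.ext
  funext i
  show ((xi (wt R) : BB k d t) • z.1) i = (algebraMap k (BB k d t) (z.1 R) • (yy k R).1) i
  rw [xi_smul, XX.scal_apply]
  split_ifs with h
  · rcases FF_low hR z i (by rw [h]; exact lt_irrefl _) with hh | ⟨σ, hσ, rfl⟩
    · rcases FF_low hR (yy k R) i (by rw [h]; exact lt_irrefl _) with wh | ⟨σ, hσ, rfl⟩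
      · rw [hh, wh, mul_zero]
      · have := IsF.stab (ll_odd R) z.2 σ (mem_St.1 hσ) R
        rw [hh] at this
        have wr : (z.1 R : k) = 0 := by
          by_contra hc
          have h4 : (sg σ : k) ≠ 0 := chi_ne true σ
          exact mul_ne_zero h4 hc this.symm
        rw [hh, wr, zero_mul]
    · rw [IsF.stab (ll_odd R) z.2 σ (mem_St.1 hσ), IsF.stab (ll_odd R) (yy k R).2 σ (mem_St.1 hσ), yy_R]
      ring
  · have := congrFun (congrArg Subtype.val (yy_w (k := k) R)) i
    change ((xi (wt R) : BB k d t) • (yy k R).1) i = (yy k R).1 i at this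
    rw [xi_smul, if_neg h] at this
    rw [← this, mul_zero]

lemma FF_top {R : Fin d → Fin t} (hR : Dom R) (w) (hw : wt R < w) (z : FF k t (ll R)) :
    (xi w : BB k d t) • z = 0 := by
  apply Subtype.ext
  funext i
  show ((xi w : BB k d t) • z.1) i = 0
  rw [xi_smul]
  split_ifs with h
  · rcases FF_low hR z i (by rw [h]; exact lt_asymm hw) with hh | ⟨σ, hσ, rfl⟩
    · exact hh
    · rw [wt_comp] at h; exact absurd hw (by rw [h]; exact lt_irrefl _)
  · rfl

/-- B as MM -/
def BM : BB k d t →ₗ[BB k d t] MM k d t false t where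
  toFun a := ⟨fun S i => a.e i S, ⟨fun σ S i => by rw [a.inv, chi, if_neg (by simp), one_mul], fun h => by simp at h⟩⟩
  map_add' a b := rfl
  map_smul' a b := rfl

def MB : MM k d t false t →ₗ[BB k d t] BB k d t where
  toFun x := BB.mk (fun i S => x.1 S i) fun σ i j => by
    have hx : IsM false x.1 := x.2
    rw [hx.inv, chi, if_neg (by simp), one_mul]
  map_add' a b := rfl
  map_smul' a b := rfl

lemma MB_BM (a : BB k d t) : MB (BM a) = a := rfl

lemma TW_star {v : Wt d t} {m : BB k d t} (h : m ∈ TW k (BB k d t) v) : star m ∈ TW k (BB k d t) v := by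
  induction h using span_induction with
  | mem x hx =>
    obtain ⟨w, hw, hx⟩ := hx
    have : star x = star x • (xi w : BB k d t) := by
      conv_lhs => rw [← hx, smul_eq_mul, star_mul, xi_star]
      rfl
    rw [this]
    exact smul_mem _ _ (subset_span ⟨w, hw, xi_idem w⟩)
  | zero => rw [star_zero]; exact Submodule.zero_mem _
  | add x y _ _ hx hy => rw [star_add]; exact Submodule.add_mem _ hx hy
  | smul a x _ hx =>
    rw [smul_eq_mul, star_mul]
    exact TW_map (toSpanSingleton (BB k d t) (BB k d t) (star a)) hx

lemma Ker_of {R : Fin d → Fin t} (hR : Dom R)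
    (hg : ∀ m : MM k d t false t, (xi (wt R) : BB k d t) • m = m →
      (∀ φ : MM k d t false t →ₗ[BB k d t] FF k t (ll R), φ m = 0) → m ∈ TW k (MM k d t false t) (wt R))
    (a : BB k d t) (ha : a • yy k R = 0) : a * xi (wt R) ∈ TW k (BB k d t) (wt R) := by
  have hh := hg (BM (xi (wt R) * star a)) (by rw [← map_smul, smul_eq_mul, ← mul_assoc, xi_idem]) ?_
  · have wh := TW_star (TW_map MB hh)
    rw [MB_BM, star_mul, star_star, xi_star] at wh
    exact wh
  · intro φ
    have : xi (wt R) * star a = (xi (wt R) * star a) • (1 : BB k d t) := (mul_one _).symm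
    rw [this, map_smul, map_smul, mul_smul, FF_one hR]
    obtain ⟨x0, hx0⟩ := al_surj (ll_odd R) (φ (BM 1)).2
    have wr : (star a • φ (BM 1)).1 R = 0 := by
      rw [← frm_ee R (star a • φ (BM 1)).1]
      show frm (ee R) (star a • (φ (BM 1)).1) = 0
      rw [← frm_smul, ← hx0, ← frm_al, map_smul]
      have : a • al (ll R) (ee R : XX k d t) = 0 := congrArg Subtype.val ha
      rw [this]
      simp [frm, XX.zero_apply]
    rw [wr, map_zero, zero_smul]

structure Pck (k : Type u) [Field k] {d t : ℕ} (v : Wt d t) where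
  Y : ModuleCat.{u} (BB k d t)
  y : Y
  yw : (xi v : BB k d t) • y = y
  one : ∀ z : Y, ∃ c : k, (xi v : BB k d t) • z = algebraMap k (BB k d t) c • y
  top : ∀ w, v < w → ∀ z : Y, (xi w : BB k d t) • z = 0
  ker : ∀ a : BB k d t, a • y = 0 → a * xi v ∈ TW k (BB k d t) v
  good : ∀ ep q (m : MM k d t ep q), (xi v : BB k d t) • m = m → (∀ φ : MM k d t ep q →ₗ[BB k d t] Y, φ m = 0) →
    m ∈ TW k (MM k d t ep q) v

lemma pck_trivial {v : Wt d t} (hg : ∀ ep q (m : MM k d t ep q), (xi v : BB k d t) • m = m → m ∈ TW k (MM k d t ep q) v) :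
    Nonempty (Pck k v) := by
  refine ⟨⟨ModuleCat.of _ PUnit, PUnit.unit, rfl, fun z => ⟨0, rfl⟩, fun _ _ _ => rfl, ?_, fun ep q m h _ => hg ep q m h⟩⟩
  intro a _
  have hh := hg false t (BM (xi v * star a)) (by rw [← map_smul, smul_eq_mul, ← mul_assoc, xi_idem])
  have wh := TW_star (TW_map MB hh)
  rwa [MB_BM, star_mul, star_star, xi_star] at wh

lemma pck (v : Wt d t) : Nonempty (Pck k v) := by
  by_cases hv : ∃ R : Fin d → Fin t, wt R = v
  · obtain ⟨R, rfl⟩ := hv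
    by_cases hR : Dom R
    · have hg : ∀ ep q (m : MM k d t ep q), (xi (wt R) : BB k d t) • m = m →
          (∀ φ : MM k d t ep q →ₗ[BB k d t] FF k t (ll R), φ m = 0) → m ∈ TW k (MM k d t ep q) (wt R) := by
        intro ep q m hm hφ
        refine straighten (fun z => ∀ φ : MM k d t ep q →ₗ[BB k d t] FF k t (ll R), φ z = 0) ?_ ?_ m hm hφ
        · intro z y hz hy φ
          rw [map_sub, hz, TW_kill (fun w hw z => FF_top hR w hw z) φ hy, sub_zero]
        · intro z S hz hS hh wh
          obtain ⟨φ, wr⟩ := detect z S hS hh wh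
          exact wr (hz φ)
      exact ⟨⟨ModuleCat.of _ (FF k t (ll R)), yy k R, yy_w R, fun z => ⟨_, FF_one hR z⟩, FF_top hR,
        Ker_of hR (hg false t), hg⟩⟩
    · refine pck_trivial ?_
      intro ep q m hm
      refine straighten (fun _ => True) (fun _ _ _ _ => trivial) ?_ m hm trivial
      intro z S _ hS _ _
      apply hR
      intro r r' hr
      have := hS r r' hr q
      unfold cnt
      convert this using 2
      · apply filter_congr; intro b _; simp [lee, (S b).isLt]
      · apply filter_congr; intro b _; simp [(S b).isLt]
  · refine pck_trivial ?_
    intro ep q m hm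
    have : m = 0 := by
      rw [← hm]
      apply MM.ext'
      intro S i
      rw [MM.xi_smul, if_neg (fun h => hv ⟨i, h⟩)]; rfl
    rw [this]; exact Submodule.zero_mem _

noncomputable def pk (v : Wt d t) : Pck k v := (pck v).some

noncomputable def oi (d t : ℕ) : Fin (Fintype.card (Wt d t)) ≃o Wt d t := Fintype.orderIsoFinOfCardEq _ rfl

lemma TW_Tn (v : Fin (Fintype.card (Wt d t))) (M : Type u) [AddCommGroup M] [Module (BB k d t) M] :
    TW k M (oi d t v) ≤ Submodule.span (BB k d t) {m : M | ∃ j : Fin (Fintype.card (Wt d t)),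
      v.val + 1 ≤ j.val ∧ (xi (oi d t j) : BB k d t) • m = m} := by
  refine span_mono ?_
  rintro m ⟨w, hw, hm⟩
  refine ⟨(oi d t).symm w, ?_, by rw [OrderIso.apply_symm_apply]; exact hm⟩
  have : v < (oi d t).symm w := by rwa [OrderIso.lt_symm_apply]
  exact this

noncomputable def QB (k : Type u) [Field k] (d t : ℕ) : QH k (BB k d t) (Fintype.card (Wt d t)) where
  ξ j := xi (oi d t j)
  idem j := xi_idem _
  sum := by rw [← xi_sum]; exact Equiv.sum_comp (oi d t).toEquiv fun w => (xi w : BB k d t)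
  star j := xi_star _
  Y j := (pk (oi d t j)).Y
  y j := (pk (oi d t j)).y
  yw j := (pk (oi d t j)).yw
  one j := (pk (oi d t j)).one
  top i j h := (pk (oi d t i)).top _ ((oi d t).lt_iff_lt.2 h)
  ker i a h := TW_Tn i _ ((pk (oi d t i)).ker a h)

lemma QB_good (ep q) : (QB k d t).Good (MM k d t ep q) := fun i m hm hφ =>
  TW_Tn i _ ((pk (oi d t i)).good ep q m hm hφ)

lemma QB_goodB : (QB k d t).Good (BB k d t) :=
  QH.Good.retr BM MB (LinearMap.ext MB_BM) (QB_good false t)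

end SP

section SI
open Equiv CategoryTheory CategoryTheory.Abelian

lemma EV.sum_right {R : Type u} [Ring R] {Z M : Type u} [AddCommGroup Z] [Module R Z] [AddCommGroup M]
    [Module R M] {ι : Type*} (s : Finset ι) (N : ι → Type u) [∀ j, AddCommGroup (N j)] [∀ j, Module R (N j)]
    (a : ∀ j, M →ₗ[R] N j) (b : ∀ j, N j →ₗ[R] M) (hab : ∑ j ∈ s, b j ∘ₗ a j = LinearMap.id) (i : ℕ)
    (h : ∀ j, EV R Z (N j) i) : EV R Z M i := fun e => by
  have hh := Ext.comp_mk₀_id e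
  have : 𝟙 (ModuleCat.of R M) = ∑ j ∈ s, ofHom (a j) ≫ ofHom (b j) := by
    apply hom_ext
    simp only [← ofHom_comp, hom_sum, hom_ofHom, hab]
    rfl
  rw [this] at hh
  rw [← hh]
  clear hh this hab
  classical
  induction s using induction_on with
  | empty => rw [sum_empty, Ext.mk₀_zero, Ext.comp_zero]
  | insert j s hj ih =>
    rw [sum_insert hj, Ext.mk₀_add, Ext.comp_add, ih, add_zero]
    rw [← Ext.mk₀_comp_mk₀, ← Ext.comp_assoc (a₁₂ := i) (a₂₃ := 0) _ _ _ (by simp) (by simp) (by simp),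
      h j (e.comp (Ext.mk₀ (ofHom (a j))) (add_zero i)), Ext.zero_comp]

variable {k : Type u} [Field k] {d t q : ℕ}

structure Lab (ep : Bool) (lb : Fin d → ℕ) (S0 : Fin d → Fin q) : Prop where
  par : ∀ a, Even (lb a) ↔ ep = false
  eqv : ∀ a b, lb a = lb b ↔ S0 a = S0 b

variable {ep : Bool} {lb : Fin d → ℕ} {S0 : Fin d → Fin q}

lemma Lab.stab (h : Lab ep lb S0) {x : XX k d t} (hx : IsF lb x) (τ : Perm (Fin d)) (hτ : S0 ∘ τ = S0) (i) :
    x (i ∘ τ) = chi ep τ * x i := by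
  have hh : lb ∘ τ = lb := by
    funext b; exact (h.eqv _ _).2 (congrFun hτ b)
  cases ep with
  | true => exact hx.stab (fun a => by simp [h.par a]) τ hh i
  | false => rw [hx.stab_ev (fun a => by simp [h.par a]) τ hh i]; simp [chi]

noncomputable def indV (ep : Bool) (S0 : Fin d → Fin q) (x : XX k d t) (S : Fin d → Fin q) (i : Fin d → Fin t) : k := by
  classical
  exact if h : ∃ σ : Perm (Fin d), S = S0 ∘ σ then chi ep h.choose * x (i ∘ ⇑(h.choose⁻¹ : Perm (Fin d))) else 0

lemma Lab.indV_val (h : Lab ep lb S0) {x : XX k d t} (hx : IsF lb x) (σ : Perm (Fin d)) (i) :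
    indV ep S0 x (S0 ∘ σ) i = chi ep σ * x (i ∘ ⇑(σ⁻¹ : Perm (Fin d))) := by
  have he : ∃ τ : Perm (Fin d), S0 ∘ σ = S0 ∘ τ := ⟨σ, rfl⟩
  unfold indV
  rw [dif_pos he]
  have hh := he.choose_spec
  generalize he.choose = τ at hh
  have wh : S0 ∘ ⇑(σ * τ⁻¹ : Perm (Fin d)) = S0 := by
    rw [Perm.coe_mul, ← comp_assoc, hh]; funext b; simp
  have wr : i ∘ ⇑(τ⁻¹ : Perm (Fin d)) = (i ∘ ⇑(σ⁻¹ : Perm (Fin d))) ∘ ⇑(σ * τ⁻¹ : Perm (Fin d)) := by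
    funext b; simp
  rw [wr, h.stab hx _ wh, chi_mul, chi_inv]
  linear_combination (chi ep σ * x (i ∘ ⇑(σ⁻¹ : Perm (Fin d)))) * chi_sq (k := k) ep τ

lemma indV_zero {x : XX k d t} {S : Fin d → Fin q} (h : ¬ ∃ σ : Perm (Fin d), S = S0 ∘ σ) (i) :
    indV ep S0 x S i = 0 := by unfold indV; rw [dif_neg h]

noncomputable def indF (h : Lab ep lb S0) : FF k t lb →ₗ[BB k d t] MM k d t ep q where
  toFun x := ⟨indV ep S0 x.1, by
    refine ⟨?_, ?_⟩
    · intro σ S i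
      by_cases hS : ∃ τ : Perm (Fin d), S = S0 ∘ τ
      · obtain ⟨τ, rfl⟩ := hS
        have hh : (S0 ∘ τ) ∘ σ = S0 ∘ ⇑(τ * σ : Perm (Fin d)) := rfl
        rw [hh, h.indV_val x.2, h.indV_val x.2, chi_mul]
        have : (i ∘ σ) ∘ ⇑((τ * σ)⁻¹ : Perm (Fin d)) = i ∘ ⇑(τ⁻¹ : Perm (Fin d)) := by
          funext b; simp [mul_inv_rev]
        rw [this]; ring
      · rw [indV_zero hS, indV_zero, mul_zero]
        rintro ⟨τ, hh⟩
        refine hS ⟨τ * σ⁻¹, ?_⟩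
        rw [Perm.coe_mul, ← comp_assoc, ← hh]; funext b; simp
    · intro he a b hab S i hS hi
      by_cases hS' : ∃ τ : Perm (Fin d), S = S0 ∘ τ
      · obtain ⟨τ, rfl⟩ := hS'
        rw [h.indV_val x.2]
        have hx : IsF lb x.1 := x.2
        rw [hx.van (τ a) (τ b) (fun hc => hab (τ.injective hc)) ((h.eqv _ _).2 hS)
          (by rw [h.par, he]; simp) _ (by simpa using hi), mul_zero]
      · exact indV_zero hS' i⟩
  map_add' x y := by
    apply MM.ext'
    intro S i
    show indV ep S0 (x.1 + y.1) S i = indV ep S0 x.1 S i + indV ep S0 y.1 S i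
    unfold indV
    split_ifs
    · rw [XX.add_apply]; ring
    · rw [add_zero]
  map_smul' a x := by
    apply MM.ext'
    intro S i
    rw [RingHom.id_apply, MM.smul_apply]
    show indV ep S0 (a • x.1) S i = ∑ j, a.e i j * indV ep S0 x.1 S j
    unfold indV
    split_ifs with hs
    · generalize hs.choose = σ
      rw [XX.smul_apply, ← sum_perm σ⁻¹, mul_sum]
      refine sum_congr rfl fun j _ => ?_
      rw [a.inv]; ring
    · simp

def evF (h : Lab ep lb S0) : MM k d t ep q →ₗ[BB k d t] FF k t lb where
  toFun z := ⟨z.1 S0, by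
    have hz : IsM ep z.1 := z.2
    have key : ∀ a b, lb a = lb b → ∀ i, z.1 S0 (i ∘ swap a b) = chi ep (swap a b) * z.1 S0 i := by
      intro a b hab i
      have := hz.inv (swap a b) S0 i
      rwa [swap_eq ((h.eqv a b).1 hab)] at this
    refine ⟨?_, ?_, ?_⟩
    · intro a b hab hl he i
      rw [key a b hl, chi, if_neg (by rw [(h.par a).1 he]; simp), one_mul]
    · intro a b hab hl he i
      rw [key a b hl, chi, if_pos (by rw [h.par] at he; simpa using he), sg_swap hab]; ring
    · intro a b hab hl he i hi
      exact hz.van (by rw [h.par] at he; simpa using he) a b hab S0 i ((h.eqv a b).1 hl) hi⟩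
  map_add' _ _ := rfl
  map_smul' _ _ := rfl

lemma evF_indF (h : Lab ep lb S0) (x : FF k t lb) : evF h (indF h x) = x := by
  apply Subtype.ext
  funext i
  show indV ep S0 x.1 S0 i = x.1 i
  have := h.indV_val x.2 1 i
  rw [chi_one, one_mul] at this
  exact this

lemma QB_goodFF (hℓ : AllOdd lb) : (QB k d t).Good (FF k t lb) := by
  have h : Lab true lb (fun b => (⟨lb b, by
      have := le_sup (f := lb) (mem_univ b); omega⟩ : Fin (univ.sup lb + 1))) :=
    ⟨fun a => by simpa using hℓ a, fun a b => by simp⟩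
  exact QH.Good.retr (indF h) (evF h) (LinearMap.ext (evF_indF h)) (QB_good true _)

lemma lab_ev (S : Fin d → Fin t) : Lab false (fun b => 2 * (S b).val) S :=
  ⟨fun a => by simp, fun a b => by simp [Fin.ext_iff]⟩

noncomputable def rep (w : Wt d t) (S : Fin d → Fin t) : Fin d → Fin t := by
  classical
  exact if h : ∃ R : Fin d → Fin t, wt R = w then h.choose else S

lemma rep_wt (S : Fin d → Fin t) : wt (rep (wt S) S) = wt S := by
  have h : ∃ R : Fin d → Fin t, wt R = wt S := ⟨S, rfl⟩
  unfold rep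
  rw [dif_pos h]
  exact h.choose_spec

lemma rep_eq {S S' : Fin d → Fin t} (h : wt S = wt S') : rep (wt S) S = rep (wt S') S' := by
  have hh : ∃ R : Fin d → Fin t, wt R = wt S := ⟨S, rfl⟩
  have wh : ∃ R : Fin d → Fin t, wt R = wt S' := ⟨S', rfl⟩
  unfold rep
  rw [dif_pos hh, dif_pos wh]
  simp only [h]

lemma EV_BB {Z : Type u} [AddCommGroup Z] [Module (BB k d t) Z] (i : ℕ)
    (h : ∀ S : Fin d → Fin t, EV (BB k d t) Z (FF k t fun b => 2 * (S b).val) i) :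
    EV (BB k d t) Z (BB k d t) i := by
  classical
  refine EV.retr_right (ML := MM k d t false t) i BM MB (LinearMap.ext MB_BM) ?_
  refine EV.sum_right (univ.filter fun S : Fin d → Fin t => rep (wt S) S = S)
    (fun S => FF k t fun b => 2 * (S b).val) (fun S => evF (lab_ev S)) (fun S => indF (lab_ev S)) ?_ i h
  apply LinearMap.ext
  intro z
  apply MM.ext'
  intro S' i
  rw [LinearMap.sum_apply]
  have e : ∀ s : Finset (Fin d → Fin t), (∑ S ∈ s, (indF (lab_ev S) ∘ₗ evF (lab_ev S)) z).1 S' i =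
      ∑ S ∈ s, ((indF (lab_ev S) (evF (lab_ev S) z)).1 S' i) := by
    intro s
    induction s using induction_on with
    | empty => rfl
    | insert a s ha ih => rw [sum_insert ha, sum_insert ha, ← ih]; rfl
  rw [e, sum_eq_single (rep (wt S') S')]
  · obtain ⟨σ, hσ⟩ := exists_perm_wt (rep_wt S').symm
    have hz : IsM false z.1 := z.2
    generalize rep (wt S') S' = S at *
    show indV false S (evF (lab_ev S) z).1 S' i = z.1 S' i
    rw [hσ, (lab_ev S).indV_val (evF (lab_ev S) z).2]
    show chi false σ * z.1 S _ = _
    rw [← hz.inv]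
    have : (i ∘ ⇑(σ⁻¹ : Perm (Fin d))) ∘ σ = i := by funext b; simp
    rw [this]
  · intro S hS hne
    rw [mem_filter] at hS
    refine indV_zero ?_ i
    rintro ⟨σ, hh⟩
    apply hne
    rw [← hS.2]
    apply rep_eq
    rw [hh, wt_comp]
  · intro hc
    exfalso
    apply hc
    rw [mem_filter]
    exact ⟨mem_univ _, rep_eq (rep_wt S')⟩

end SI

section SK
open Equiv

variable {k : Type u} [Field k] {d t : ℕ}

lemma cc {A : Type*} (i : Fin d → A) (a b c e : Fin d) :
    (i ∘ swap a b) ∘ swap c e = (i ∘ swap (swap a b c) (swap a b e)) ∘ swap a b := by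
  have := Equiv.mul_swap_eq_swap_mul (swap a b) c e
  have wh : (i ∘ swap a b) ∘ swap c e = i ∘ ⇑(swap a b * swap c e) := rfl
  rw [wh, this]; rfl

def eps (k : Type u) [Field k] (n : ℕ) : k := if Even n then 1 else -1

lemma eps_sq (n : ℕ) : eps k n * eps k n = 1 := by unfold eps; split_ifs <;> simp
lemma eps_ev {n : ℕ} (h : Even n) : eps k n = 1 := if_pos h
lemma eps_od {n : ℕ} (h : ¬ Even n) : eps k n = -1 := if_neg h

lemma IsF.sw {lb : Fin d → ℕ} {x : XX k d t} (hx : IsF lb x) {a b : Fin d} (hab : a ≠ b) (h : lb a = lb b) (i) :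
    x (i ∘ swap a b) = eps k (lb a) * x i := by
  unfold eps
  split_ifs with hh
  · rw [hx.ev a b hab h hh, one_mul]
  · rw [hx.od a b hab h hh]; ring

lemma IsF.of {lb : Fin d → ℕ} {x : XX k d t}
    (hh : ∀ a b, a ≠ b → lb a = lb b → ∀ i, x (i ∘ swap a b) = eps k (lb a) * x i)
    (wh : ∀ a b, a ≠ b → lb a = lb b → ¬ Even (lb a) → ∀ i, i a = i b → x i = 0) : IsF lb x :=
  ⟨fun a b hab h he i => by rw [hh a b hab h, eps_ev he, one_mul],
   fun a b hab h he i => by rw [hh a b hab h, eps_od he]; ring, wh⟩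

/-- fiber -/
def fib (lb : Fin d → ℕ) (n : ℕ) : Finset (Fin d) := univ.filter fun b => lb b = n
lemma mfb {lb : Fin d → ℕ} {n : ℕ} {b : Fin d} : b ∈ fib lb n ↔ lb b = n := by simp [fib]

def dlv (lb : Fin d → ℕ) (e : Fin d) (n : ℕ) (x : XX k d t) : XX k d t :=
  fun i => x i + eps k n * ∑ o ∈ fib lb n, x (i ∘ swap e o)

abbrev upd (lb : Fin d → ℕ) (e : Fin d) (n : ℕ) : Fin d → ℕ := Function.update lb e n

lemma upd_self (lb : Fin d → ℕ) (e : Fin d) (n : ℕ) : upd lb e n e = n := by simp [upd]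
lemma upd_ne (lb : Fin d → ℕ) {e b : Fin d} (n : ℕ) (h : b ≠ e) : upd lb e n b = lb b := by simp [upd, h]

lemma dlv_sw_e {lb : Fin d → ℕ} {e : Fin d} {n : ℕ} (he : lb e ≠ n) {x : XX k d t} (hx : IsF lb x)
    {b : Fin d} (hb : lb b = n) (i) : dlv lb e n x (i ∘ swap e b) = eps k n * dlv lb e n x i := by
  have hbe : e ≠ b := fun h => he (by rw [h, hb])
  unfold dlv
  have hbm : b ∈ fib lb n := mfb.2 hb
  rw [← add_sum_erase _ _ hbm, ← add_sum_erase _ (fun o => x (i ∘ swap e o)) hbm, swap_swap']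
  have : ∑ o ∈ (fib lb n).erase b, x ((i ∘ swap e b) ∘ swap e o) =
      eps k n * ∑ o ∈ (fib lb n).erase b, x (i ∘ swap e o) := by
    rw [mul_sum]
    refine sum_congr rfl fun o ho => ?_
    rw [mem_erase, mfb] at ho
    have hoe : o ≠ e := fun h => he (by rw [← h, ho.2])
    have hh := cc i e o o b
    rw [swap_apply_right, swap_apply_of_ne_of_ne hbe.symm ho.1.symm] at hh
    rw [← hh, hx.sw ho.1 (ho.2.trans hb.symm), ho.2]
  rw [this]
  linear_combination - x (i ∘ swap e b) * eps_sq (k := k) n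

lemma dlv_mem {lb : Fin d → ℕ} {e : Fin d} {n : ℕ} (he : lb e ≠ n) {x : XX k d t} (hx : IsF lb x) :
    IsF (upd lb e n) (dlv lb e n x) := by
  have comm : ∀ a b o : Fin d, a ≠ e → b ≠ e → ∀ i : Fin d → Fin t,
      (i ∘ swap a b) ∘ swap e o = (i ∘ swap e (swap a b o)) ∘ swap a b := by
    intro a b o ha hb i
    rw [cc, swap_apply_of_ne_of_ne ha.symm hb.symm]
  refine IsF.of ?_ ?_
  · intro a b hab h i
    by_cases ha : a = e
    · subst ha
      rw [upd_self, upd_ne _ _ hab.symm] at h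
      rw [upd_self]
      exact dlv_sw_e he hx h.symm i
    · by_cases hb : b = e
      · subst hb
        rw [upd_self, upd_ne _ _ hab] at h
        rw [upd_ne _ _ hab, h, swap_comm]
        exact dlv_sw_e he hx h i
      · rw [upd_ne _ _ ha, upd_ne _ _ hb] at h
        rw [upd_ne _ _ ha]
        unfold dlv
        have : ∑ o ∈ fib lb n, x ((i ∘ swap a b) ∘ swap e o) = eps k (lb a) * ∑ o ∈ fib lb n, x (i ∘ swap e o) := by
          rw [mul_sum]
          have hs : ∀ o, lb (swap a b o) = lb o := fun o => congrFun (swap_eq h) o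
          refine sum_bij (fun o _ => swap a b o) ?_ ?_ ?_ ?_
          · intro o ho; rw [mfb] at ho ⊢; rw [hs, ho]
          · intro o _ o' _ h'; exact (swap a b).injective h'
          · intro o ho; rw [mfb] at ho
            exact ⟨swap a b o, by rw [mfb, hs, ho], by simp⟩
          · intro o ho
            rw [comm a b o ha hb, hx.sw hab h]
        rw [this, hx.sw hab h]; ring
  · have van_e : ∀ b, lb b = n → ¬ Even n → ∀ i : Fin d → Fin t, i e = i b → dlv lb e n x i = 0 := by
      intro b hb hn i hi
      have hbe : e ≠ b := fun h => he (by rw [h, hb])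
      unfold dlv
      rw [← add_sum_erase _ _ (mfb.2 hb), swap_eq hi, sum_eq_zero, eps_od hn]
      · ring
      · intro o ho
        rw [mem_erase, mfb] at ho
        have hoe : o ≠ e := fun h => he (by rw [← h, ho.2])
        refine hx.van o b ho.1 (ho.2.trans hb.symm) (by rw [ho.2]; exact hn) _ ?_
        rw [Function.comp_apply, Function.comp_apply, swap_apply_right,
          swap_apply_of_ne_of_ne hbe.symm ho.1.symm, hi]
    intro a b hab h hn i hi
    by_cases ha : a = e
    · subst ha
      rw [upd_self, upd_ne _ _ hab.symm] at h
      rw [upd_self] at hn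
      exact van_e b h.symm hn i hi
    · by_cases hb : b = e
      · subst hb
        rw [upd_self, upd_ne _ _ hab] at h
        rw [upd_ne _ _ hab, h] at hn
        exact van_e a h hn i hi.symm
      · rw [upd_ne _ _ ha, upd_ne _ _ hb] at h
        rw [upd_ne _ _ ha] at hn
        unfold dlv
        rw [hx.van a b hab h hn i hi]
        have hov : ∀ o, o ≠ a → o ≠ b → x (i ∘ swap e o) = 0 := by
          intro o hh wh
          refine hx.van a b hab h hn _ ?_
          rw [Function.comp_apply, Function.comp_apply, swap_apply_of_ne_of_ne ha hh.symm,
            swap_apply_of_ne_of_ne hb wh.symm, hi]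
        have : ∑ o ∈ fib lb n, x (i ∘ swap e o) = 0 := by
          refine sum_involution (fun o _ => swap a b o) ?_ ?_ ?_ ?_
          · intro o ho
            have hh := comm a b o ha hb i
            rw [swap_eq hi] at hh
            rw [hh, hx.sw hab h, eps_od hn]; ring
          · intro o ho gr hc
            refine gr (hov o ?_ ?_)
            · rintro rfl; rw [swap_apply_left] at hc; exact hab hc.symm
            · rintro rfl; rw [swap_apply_right] at hc; exact hab hc
          · intro o ho
            rw [mfb] at ho ⊢
            exact (congrFun (swap_eq h) o).trans ho
          · intro o ho; simp
        rw [this, mul_zero, add_zero]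

def dl (lb : Fin d → ℕ) (e : Fin d) (n : ℕ) (he : lb e ≠ n) : FF k t lb →ₗ[BB k d t] FF k t (upd lb e n) where
  toFun x := ⟨dlv lb e n x.1, dlv_mem he x.2⟩
  map_add' x y := by
    apply Subtype.ext
    funext i
    show (x.1 + y.1) i + eps k n * ∑ o ∈ fib lb n, (x.1 + y.1) (i ∘ swap e o) = dlv lb e n x.1 i + dlv lb e n y.1 i
    unfold dlv
    simp only [XX.add_apply, sum_add_distrib]; ring
  map_smul' a x := by
    apply Subtype.ext
    show dlv lb e n (a • x.1) = a • dlv lb e n x.1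
    have key : ∀ z : XX k d t, dlv lb e n z = z + algebraMap k (BB k d t) (eps k n) • ∑ o ∈ fib lb n, pp (swap e o) z := by
      intro z
      funext i
      rw [XX.add_apply, XX.scal_apply, XX.sum_apply]; rfl
    rw [key, key, smul_add, ← mul_smul, ← Algebra.commutes, mul_smul]
    simp only [map_smul, smul_sum]

lemma dl_apply {lb : Fin d → ℕ} {e : Fin d} {n : ℕ} (he : lb e ≠ n) (x : FF k t lb) (i) :
    (dl lb e n he x).1 i = x.1 i + eps k n * ∑ o ∈ fib lb n, x.1 (i ∘ swap e o) := rfl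

end SK

section SKK
open Equiv

variable {k : Type u} [Field k] {d t : ℕ} {lb : Fin d → ℕ} {e : Fin d} {ze un : ℕ}

lemma fib_upd (he : lb e ≠ un) : fib (upd lb e un) un = insert e (fib lb un) := by
  ext b
  rw [mem_insert, mfb, mfb]
  by_cases h : b = e
  · subst h; simp
  · rw [upd_ne _ _ h]; simp [h]

lemma dlv_upd (he : lb e ≠ un) (es : Fin d) (y : XX k d t) (i) (hh : ¬ Even un) :
    dlv (upd lb e un) es un y i = y i - (y (i ∘ swap es e) + ∑ o ∈ fib lb un, y (i ∘ swap es o)) := by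
  unfold dlv
  rw [fib_upd he, sum_insert (by rw [mfb]; exact he), eps_od hh]; ring

lemma quad (i : Fin d → Fin t) {e es o o' : Fin d} (hh : e ≠ es) (wh : e ≠ o) (wr : e ≠ o') (h4 : es ≠ o) (h5 : es ≠ o')
    (h6 : o ≠ o') : (i ∘ swap es o') ∘ swap e o = (((i ∘ swap es o) ∘ swap e o') ∘ swap e es) ∘ swap o o' := by
  funext b
  simp only [Function.comp, swap_apply_def]
  congr 1
  grind

lemma koszul_sq (gr : Even ze) (hh : ¬ Even un) (he : lb e = ze) {x : XX k d t} (hx : IsF lb x)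
    {es : Fin d} (hne : es ≠ e) (he1 : lb es = ze) (i) :
    dlv (upd lb e un) es un (dlv lb e un x) i = 0 := by
  have hn : ze ≠ un := by rintro rfl; exact hh gr
  have hen : lb e ≠ un := he ▸ hn
  rw [dlv_upd hen es _ i hh]
  unfold dlv
  rw [eps_od hh]
  have E1 : ∑ o ∈ fib lb un, x ((i ∘ swap es e) ∘ swap e o) = ∑ o ∈ fib lb un, x (i ∘ swap es o) := by
    refine sum_congr rfl fun o ho => ?_
    rw [mfb] at ho
    have : o ≠ e := by rintro rfl; exact hen ho
    have : o ≠ es := by rintro rfl; exact hn (he1.symm.trans ho)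
    rw [cc, swap_apply_right, swap_apply_of_ne_of_ne ‹_› ‹_›, hx.sw hne (he1.trans he.symm), he1, eps_ev gr, one_mul]
  have E2 : x (i ∘ swap es e) = x i := by
    rw [hx.sw hne (he1.trans he.symm), he1, eps_ev gr, one_mul]
  have E3 : ∑ o ∈ fib lb un, ∑ o' ∈ fib lb un, x ((i ∘ swap es o) ∘ swap e o') = ∑ o ∈ fib lb un, x (i ∘ swap e o) := by
    have S0 : ∀ o ∈ fib lb un, x ((i ∘ swap es o) ∘ swap e o) = x (i ∘ swap e o) := by
      intro o ho
      rw [mfb] at ho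
      have g1 : o ≠ e := by rintro rfl; exact hen ho
      have g2 : o ≠ es := by rintro rfl; exact hn (he1.symm.trans ho)
      have := cc i e o e es
      rw [swap_apply_left, swap_apply_of_ne_of_ne hne g2.symm, swap_comm o es] at this
      rw [← this, hx.sw hne.symm (he.trans he1.symm), he, eps_ev gr, one_mul]
    have S1 : ∑ o ∈ fib lb un, ∑ o' ∈ fib lb un, x ((i ∘ swap es o) ∘ swap e o') =
        ∑ o ∈ fib lb un, ∑ o' ∈ fib lb un, (if o = o' then x (i ∘ swap e o) else 0) +
        ∑ o ∈ fib lb un, ∑ o' ∈ fib lb un, (if o = o' then 0 else x ((i ∘ swap es o) ∘ swap e o')) := by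
      rw [← sum_add_distrib]
      refine sum_congr rfl fun o ho => ?_
      rw [← sum_add_distrib]
      refine sum_congr rfl fun o' ho' => ?_
      by_cases h : o = o'
      · subst h; rw [S0 o ho]; simp
      · simp [h]
    have S2 : ∑ o ∈ fib lb un, ∑ o' ∈ fib lb un, (if o = o' then 0 else x ((i ∘ swap es o) ∘ swap e o')) = 0 := by
      rw [← Finset.sum_product']
      refine sum_involution (fun q _ => (q.2, q.1)) ?_ ?_ ?_ ?_
      · rintro ⟨o, o'⟩ hq
        rw [mem_product, mfb, mfb] at hq
        dsimp only at hq ⊢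
        by_cases h : o = o'
        · simp [h]
        · have g1 : e ≠ o := by rintro rfl; exact hen hq.1
          have g2 : es ≠ o := by rintro rfl; exact hn (he1.symm.trans hq.1)
          have g3 : e ≠ o' := by rintro rfl; exact hen hq.2
          have g4 : es ≠ o' := by rintro rfl; exact hn (he1.symm.trans hq.2)
          rw [if_neg h, if_neg (Ne.symm h), quad i hne.symm g1 g3 g2 g4 h, hx.sw h (hq.1.trans hq.2.symm),
            hx.sw hne.symm (he.trans he1.symm), he, hq.1, eps_ev gr, eps_od hh]
          ring
      · rintro ⟨o, o'⟩ hq gr h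
        refine gr (if_pos ?_)
        exact (Prod.mk.inj h).2
      · rintro ⟨o, o'⟩ hq
        rw [mem_product] at hq ⊢
        exact ⟨hq.2, hq.1⟩
      · rintro ⟨o, o'⟩ hq; rfl
    rw [S1, S2, add_zero]
    refine sum_congr rfl fun o ho => ?_
    rw [sum_ite_eq, if_pos ho]
  rw [E1, E2]
  simp only [sum_add_distrib, neg_mul, one_mul, sum_neg_distrib, E3]
  ring

def UU (lb : Fin d → ℕ) (ze un : ℕ) (b : Fin d) : Prop := lb b = ze ∨ lb b = un

def TopB (lb : Fin d → ℕ) (ze un : ℕ) (i : Fin d → Fin t) (b : Fin d) : Prop :=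
  UU lb ze un b ∧ ∀ c, UU lb ze un c → i b ≤ i c

lemma TopB.eq {i : Fin d → Fin t} {b c} (h : TopB lb ze un i b) (h' : TopB lb ze un i c) : i b = i c :=
  le_antisymm (h.2 c h'.1) (h'.2 b h.1)

lemma UU_swap {a b : Fin d} (ha : UU lb ze un a ↔ UU lb ze un b) (c) : UU lb ze un (swap a b c) ↔ UU lb ze un c := by
  by_cases hh : c = a
  · rw [hh, swap_apply_left, ha]
  · by_cases wh : c = b
    · rw [wh, swap_apply_right, ha]
    · rw [swap_apply_of_ne_of_ne hh wh]

lemma TopB.sw {i : Fin d → Fin t} {a b c : Fin d} (ha : UU lb ze un a ↔ UU lb ze un b) (h : TopB lb ze un i c) :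
    TopB lb ze un (i ∘ swap a b) (swap a b c) := by
  refine ⟨(UU_swap ha c).2 h.1, fun c' hc' => ?_⟩
  rw [Function.comp_apply, Function.comp_apply, swap_apply_self]
  exact h.2 _ ((UU_swap ha c').2 hc')

noncomputable def hy (lb : Fin d → ℕ) (e : Fin d) (ze un : ℕ) (y : XX k d t) : XX k d t := fun i => by
  classical
  exact if h : ∃ es, lb es = ze ∧ TopB lb ze un i es then y (i ∘ swap e h.choose) else 0

lemma hy_none (y : XX k d t) (i) (h : ¬ ∃ es, lb es = ze ∧ TopB lb ze un i es) : hy lb e ze un y i = 0 := by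
  unfold hy; rw [dif_neg h]


lemma yE (gr : Even ze) (hh : ¬ Even un) (he : lb e = ze) {y : XX k d t} (hyF : IsF (upd lb e un) y)
   {a b : Fin d} (hab : a ≠ b) (ha : a ≠ e) (hb : b ≠ e) (h : lb a = lb b) (i) :
    y (i ∘ swap a b) = eps k (lb a) * y i := by
  rw [hyF.sw hab (by rw [upd_ne _ _ ha, upd_ne _ _ hb, h]), upd_ne _ _ ha]

lemma hy_some (gr : Even ze) (hh : ¬ Even un) (he : lb e = ze) {y : XX k d t} (hyF : IsF (upd lb e un) y)
    {i es} (h : lb es = ze) (ht : TopB lb ze un i es) : hy lb e ze un y i = y (i ∘ swap e es) := by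
  have hex : ∃ es, lb es = ze ∧ TopB lb ze un i es := ⟨es, h, ht⟩
  unfold hy; rw [dif_pos hex]
  have hs := hex.choose_spec
  generalize hex.choose = e2 at hs
  have hE := ht.eq hs.2
  by_cases h12 : es = e2
  · rw [h12]
  by_cases g1 : es = e
  · subst g1; rw [swap_eq hE, swap_self]; rfl
  by_cases g2 : e2 = e
  · subst g2; rw [swap_eq hE.symm, swap_self]; rfl
  have := cc i es e2 e es
  rw [swap_apply_left, swap_apply_of_ne_of_ne (Ne.symm g1) (Ne.symm g2), swap_eq hE] at this
  rw [this, yE gr hh he hyF h12 g1 g2 (h.trans hs.1.symm), h, eps_ev gr, one_mul]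

lemma hy_o (gr : Even ze) (hh : ¬ Even un) (he : lb e = ze) {y : XX k d t} (hyF : IsF (upd lb e un) y)
    {i o} (h : lb o = un) (ht : TopB lb ze un i o) : hy lb e ze un y i = 0 := by
  by_cases hex : ∃ es, lb es = ze ∧ TopB lb ze un i es
  · obtain ⟨es, g1, g2⟩ := hex
    rw [hy_some gr hh he hyF g1 g2]
    have hn : ze ≠ un := by rintro rfl; exact hh gr
    have q1 : o ≠ e := by rintro rfl; exact hn (he.symm.trans h)
    have q2 : o ≠ es := by rintro rfl; exact hn (g1.symm.trans h)
    refine hyF.van o e q1 ?_ ?_ _ ?_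
    · rw [upd_ne _ _ q1, upd_self, h]
    · rw [upd_ne _ _ q1, h]; exact hh
    · rw [Function.comp_apply, Function.comp_apply, swap_apply_left, swap_apply_of_ne_of_ne q1 q2]
      exact ht.eq g2
  · exact hy_none _ _ hex

lemma hy_mem (gr : Even ze) (hh : ¬ Even un) (he : lb e = ze) {y : XX k d t} (hyF : IsF (upd lb e un) y) :
    IsF lb (hy lb e ze un y) := by
  have hn : ze ≠ un := by rintro rfl; exact hh gr
  have key : ∀ b, b ≠ e → lb b = ze → ∀ i, hy lb e ze un y (i ∘ swap e b) = hy lb e ze un y i := by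
    intro b hbe hb i
    have hU : UU lb ze un e ↔ UU lb ze un b := by unfold UU; rw [he, hb]
    by_cases hex : ∃ es, lb es = ze ∧ TopB lb ze un i es
    · obtain ⟨es, g1, g2⟩ := hex
      have g3 := g2.sw hU
      rw [hy_some gr hh he hyF g1 g2,
        hy_some gr hh he hyF ((congrFun (swap_eq (he.trans hb.symm)) es).trans g1) g3]
      by_cases q1 : es = e
      · subst q1; rw [swap_apply_left, swap_swap', swap_self]; rfl
      by_cases q2 : es = b
      · subst q2; rw [swap_apply_right, swap_self]; rfl
      rw [swap_apply_of_ne_of_ne q1 q2]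
      have := cc i e es b es
      rw [swap_apply_right, swap_apply_of_ne_of_ne hbe (Ne.symm q2), swap_comm b e] at this
      rw [← this, yE gr hh he hyF (Ne.symm q2) hbe q1 (hb.trans g1.symm), hb, eps_ev gr, one_mul]
    · rw [hy_none _ _ hex, hy_none]
      rintro ⟨es, g1, g2⟩
      refine hex ⟨swap e b es, (congrFun (swap_eq (he.trans hb.symm)) es).trans g1, ?_⟩
      have := g2.sw hU
      rwa [swap_swap'] at this
  refine IsF.of ?_ ?_
  · intro a b hab h i
    by_cases ha : a = e
    · subst ha
      rw [key b hab.symm (h.symm.trans he), he, eps_ev gr, one_mul]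
    by_cases hb : b = e
    · subst hb
      rw [swap_comm, key a hab (h.trans he), h, he, eps_ev gr, one_mul]
    have hU : UU lb ze un a ↔ UU lb ze un b := by unfold UU; rw [h]
    by_cases hex : ∃ es, lb es = ze ∧ TopB lb ze un i es
    · obtain ⟨es, g1, g2⟩ := hex
      have g3 := g2.sw hU
      rw [hy_some gr hh he hyF g1 g2,
        hy_some gr hh he hyF ((congrFun (swap_eq h) es).trans g1) g3, cc, swap_apply_self,
        swap_apply_of_ne_of_ne (Ne.symm ha) (Ne.symm hb), yE gr hh he hyF hab ha hb h]
    · rw [hy_none _ _ hex, hy_none, mul_zero]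
      rintro ⟨es, g1, g2⟩
      refine hex ⟨swap a b es, (congrFun (swap_eq h) es).trans g1, ?_⟩
      have := g2.sw hU
      rwa [swap_swap'] at this
  · intro a b hab h hodd i hi
    by_cases hex : ∃ es, lb es = ze ∧ TopB lb ze un i es
    · obtain ⟨es, g1, g2⟩ := hex
      rw [hy_some gr hh he hyF g1 g2]
      have q1 : a ≠ e := by rintro rfl; exact hodd (he ▸ gr)
      have q2 : a ≠ es := by rintro rfl; exact hodd (g1 ▸ gr)
      have q3 : b ≠ e := by rintro rfl; rw [h] at hodd; exact hodd (he ▸ gr)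
      have q4 : b ≠ es := by rintro rfl; rw [h] at hodd; exact hodd (g1 ▸ gr)
      refine hyF.van a b hab (by rw [upd_ne _ _ q1, upd_ne _ _ q3, h]) (by rw [upd_ne _ _ q1]; exact hodd) _ ?_
      rw [Function.comp_apply, Function.comp_apply, swap_apply_of_ne_of_ne q1 q2, swap_apply_of_ne_of_ne q3 q4, hi]
    · exact hy_none _ _ hex

lemma exists_top (he : lb e = ze) (i : Fin d → Fin t) : ∃ b, TopB lb ze un i b := by
  classical
  obtain ⟨b, hb, hm⟩ := Finset.exists_min_image (univ.filter fun b => UU lb ze un b) i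
    ⟨e, by rw [mem_filter]; exact ⟨mem_univ _, Or.inl he⟩⟩
  rw [mem_filter] at hb
  exact ⟨b, hb.2, fun c hc => hm c (by rw [mem_filter]; exact ⟨mem_univ _, hc⟩)⟩

lemma hy_dl (gr : Even ze) (hh : ¬ Even un) (he : lb e = ze) {y : XX k d t} (hyF : IsF (upd lb e un) y)
    (H : ∀ es, es ≠ e → lb es = ze → ∀ i, dlv (upd lb e un) es un y i = 0) :
    dlv lb e un (hy lb e ze un y) = y := by
  have hn : ze ≠ un := by rintro rfl; exact hh gr
  have hen : lb e ≠ un := he ▸ hn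
  funext i
  unfold dlv
  rw [eps_od hh]
  have hUo : ∀ o, lb o = un → (UU lb ze un e ↔ UU lb ze un o) := fun o ho => by
    unfold UU; rw [he, ho]; simp
  have yo : ∀ o, lb o = un → ∀ j, y (j ∘ swap e o) = - y j := fun o ho j => by
    have q1 : e ≠ o := by rintro rfl; exact hen ho
    rw [hyF.sw q1 (by rw [upd_self, upd_ne _ _ q1.symm, ho]), upd_self, eps_od hh]; ring
  have yv : ∀ o, lb o = un → ∀ j : Fin d → Fin t, j e = j o → y j = 0 := fun o ho j hj => by
    have q1 : e ≠ o := by rintro rfl; exact hen ho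
    exact hyF.van e o q1 (by rw [upd_self, upd_ne _ _ q1.symm, ho]) (by rw [upd_self]; exact hh) j hj
  obtain ⟨b, hb⟩ := exists_top (un := un) he i
  by_cases hbe : b = e
  · subst hbe
    rw [hy_some gr hh he hyF he hb, sum_eq_zero, swap_self]
    · show y i + _ = _; ring
    · intro o ho
      rw [mfb] at ho
      by_cases hex : ∃ es, lb es = ze ∧ TopB lb ze un (i ∘ swap b o) es
      · obtain ⟨es, g1, g2⟩ := hex
        rw [hy_some gr hh he hyF g1 g2]
        refine yv o ho _ ?_
        have q1 : o ≠ b := by rintro rfl; exact hen ho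
        have q2 : o ≠ es := by rintro rfl; exact hn (g1.symm.trans ho)
        have g3 := hb.sw (hUo o ho)
        have g4 := g2.eq g3
        rw [swap_apply_left] at g4
        rw [Function.comp_apply, swap_apply_left, Function.comp_apply (f := i ∘ swap b o), swap_apply_of_ne_of_ne q1 q2, g4]
      · exact hy_none _ _ hex
  rcases hb.1 with hb0 | hb1
  · rw [hy_some gr hh he hyF hb0 hb]
    have wh := H b hbe hb0 i
    rw [dlv_upd hen b _ i hh] at wh
    have wr : ∑ o ∈ fib lb un, hy lb e ze un y (i ∘ swap e o) = - ∑ o ∈ fib lb un, y (i ∘ swap b o) := by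
      rw [← sum_neg_distrib]
      refine sum_congr rfl fun o ho => ?_
      rw [mfb] at ho
      have q2 : b ≠ o := by rintro rfl; exact hn (hb0.symm.trans ho)
      have g3 := hb.sw (hUo o ho)
      rw [swap_apply_of_ne_of_ne hbe q2] at g3
      rw [hy_some gr hh he hyF hb0 g3, cc, swap_apply_left, swap_apply_of_ne_of_ne hbe q2, yo o ho, swap_comm o b]
    rw [wr, swap_comm e b]
    linear_combination -wh
  · rw [hy_o gr hh he hyF hb1 hb, ← add_sum_erase _ _ (mfb.2 hb1), sum_eq_zero]
    · have g3 := hb.sw (hUo b hb1)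
      rw [swap_apply_right] at g3
      rw [hy_some gr hh he hyF he g3, swap_self]
      show 0 + -1 * (y (i ∘ swap e b) + 0) = _
      rw [yo b hb1]; ring
    · intro o ho
      rw [mem_erase, mfb] at ho
      have g3 := hb.sw (hUo o ho.2)
      rw [swap_apply_of_ne_of_ne hbe ho.1.symm] at g3
      exact hy_o gr hh he hyF hb1 g3

lemma dl_inj (hf : ∀ b, lb b ≠ un) : Function.Injective (dl (k := k) (t := t) lb e un (hf e)) := by
  intro x y h
  apply Subtype.ext
  funext i
  have wh := congrFun (congrArg Subtype.val h) i
  rw [dl_apply, dl_apply, show fib lb un = ∅ from eq_empty_of_forall_notMem fun b hb => hf b (mfb.1 hb)] at wh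
  simpa using wh

lemma dl_surj (gr : Even ze) (hh : ¬ Even un) (he : lb e = ze) (hen : lb e ≠ un) (hs : ∀ b, lb b = ze → b = e) :
    Surjective (dl (k := k) (t := t) lb e un hen) := fun y =>
  ⟨⟨hy lb e ze un y.1, hy_mem gr hh he y.2⟩, Subtype.ext (hy_dl gr hh he y.2 fun es q1 q2 => absurd (hs es q2) q1)⟩

lemma ker_all (gr : Even ze) (hh : ¬ Even un) (he : lb e = ze) {e' : Fin d} (hne : e' ≠ e) (he' : lb e' = ze)
    {y : XX k d t} (hyF : IsF (upd lb e un) y) (H0 : ∀ i, dlv (upd lb e un) e' un y i = 0) :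
    ∀ es, es ≠ e → lb es = ze → ∀ i, dlv (upd lb e un) es un y i = 0 := by
  intro es q1 q2 i
  by_cases q3 : es = e'
  · rw [q3]; exact H0 i
  have wh := H0 (i ∘ swap e' es)
  have hn : ze ≠ un := by rintro rfl; exact hh gr
  have hen : lb e ≠ un := he ▸ hn
  have sw : ∀ j, y (j ∘ swap e' es) = y j := fun j => by
    rw [yE gr hh he hyF (Ne.symm q3) hne q1 (he'.trans q2.symm), he', eps_ev gr, one_mul]
  rw [dlv_upd hen _ _ _ hh] at wh ⊢
  have tr : ∀ o, o ≠ e' → o ≠ es → y ((i ∘ swap e' es) ∘ swap e' o) = y (i ∘ swap es o) := fun o g1 g2 => by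
    rw [cc, swap_apply_left, swap_apply_of_ne_of_ne g1 g2, sw]
  rw [sw, tr e hne.symm (Ne.symm q1)] at wh
  rw [← wh]
  congr 2
  refine sum_congr rfl fun o ho => ?_
  rw [mfb] at ho
  rw [tr o (by rintro rfl; exact hn (he'.symm.trans ho)) (by rintro rfl; exact hn (q2.symm.trans ho))]

lemma dl_exact (gr : Even ze) (hh : ¬ Even un) (he : lb e = ze) (hen : lb e ≠ un) {e' : Fin d} (hne : e' ≠ e) (he' : lb e' = ze)
    (hen' : upd lb e un e' ≠ un) :
    Exact (dl (k := k) (t := t) lb e un hen) (dl (upd lb e un) e' un hen') := by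
  intro y
  constructor
  · intro hy0
    exact ⟨⟨hy lb e ze un y.1, hy_mem gr hh he y.2⟩, Subtype.ext (hy_dl gr hh he y.2
      (ker_all gr hh he hne he' y.2 fun i => congrFun (congrArg Subtype.val hy0) i))⟩
  · rintro ⟨x, rfl⟩
    apply Subtype.ext
    funext i
    exact koszul_sq gr hh he x.2 hne he' i

end SKK

section SV
open Equiv

variable {k : Type u} [Field k] {d t : ℕ}

/-- abstract vanishing theory -/
structure Eth (R : Type u) [Ring R] (E : ∀ (M : Type u) [AddCommGroup M] [Module R M], ℕ → Prop) : Prop where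
  c1 : ∀ {MA ML MC : Type u} [AddCommGroup MA] [Module R MA] [AddCommGroup ML] [Module R ML] [AddCommGroup MC] [Module R MC]
    {f : MA →ₗ[R] ML} {g : ML →ₗ[R] MC}, SES f g → ∀ i, E ML (i + 1) → E MC i → E MA (i + 1)
  c2 : ∀ {MA ML MC : Type u} [AddCommGroup MA] [Module R MA] [AddCommGroup ML] [Module R ML] [AddCommGroup MC] [Module R MC]
    {f : MA →ₗ[R] ML} {g : ML →ₗ[R] MC}, SES f g → ∀ i, E MA i → E MC i → E ML i
  c3 : ∀ {MA ML MC : Type u} [AddCommGroup MA] [Module R MA] [AddCommGroup ML] [Module R ML] [AddCommGroup MC] [Module R MC]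
    {f : MA →ₗ[R] ML} {g : ML →ₗ[R] MC}, SES f g → ∀ i, E MA (i + 1) → E ML i → E MC i
  retr : ∀ {MA ML : Type u} [AddCommGroup MA] [Module R MA] [AddCommGroup ML] [Module R ML] (i : ℕ)
    (a : MA →ₗ[R] ML) (b : ML →ₗ[R] MA), b ∘ₗ a = LinearMap.id → E ML i → E MA i
  sub : ∀ {M : Type u} [AddCommGroup M] [Module R M] [Subsingleton M] (i : ℕ), E M i

lemma Eth.equiv {R : Type u} [Ring R] {E : ∀ (M : Type u) [AddCommGroup M] [Module R M], ℕ → Prop} (hE : Eth R E)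
    {MA ML : Type u} [AddCommGroup MA] [Module R MA] [AddCommGroup ML] [Module R ML] (i : ℕ) (a : MA ≃ₗ[R] ML)
    (h : E ML i) : E MA i := hE.retr i a.toLinearMap a.symm.toLinearMap (LinearMap.ext fun x => by simp) h

abbrev EVE (R : Type u) [Ring R] (Z : Type u) [AddCommGroup Z] [Module R Z] :
    ∀ (M : Type u) [AddCommGroup M] [Module R M], ℕ → Prop := fun M _ _ i => EV R Z M i

abbrev EDE (k R : Type u) [Field k] [Ring R] [Algebra k R] [StarRing R] [SA k R] (Y : Type u) [AddCommGroup Y] [Module R Y] :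
    ∀ (M : Type u) [AddCommGroup M] [Module R M], ℕ → Prop := fun M _ _ i => EV R (Dl k R M) Y i

lemma Eth.ev (R : Type u) [Ring R] (Z : Type u) [AddCommGroup Z] [Module R Z] : Eth R (EVE R Z) where
  c1 h i wh wr := h.cov1 wh wr
  c2 h i wh wr := h.cov2 wh wr
  c3 h i wh wr := h.cov3 wh wr
  retr i a b hab h := EV.retr_right i a b hab h
  sub i := EV.sub_right i

lemma Eth.dl (k R : Type u) [Field k] [Ring R] [Algebra k R] [StarRing R] [SA k R] (Y : Type u) [AddCommGroup Y] [Module R Y] :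
    Eth R (EDE k R Y) where
  c1 h i wh wr := (h.dual (k := k)).con3 wr wh
  c2 h i wh wr := (h.dual (k := k)).con2 wr wh
  c3 h i wh wr := (h.dual (k := k)).con1 wr wh
  retr i a b hab h := EV.retr_left i (Dl.map k b) (Dl.map k a) (LinearMap.ext fun q => Dl.ext' fun m => by
    rw [LinearMap.comp_apply, Dl.map_apply, Dl.map_apply]
    exact congrArg q.1 (LinearMap.congr_fun hab m)) h
  sub {M} _ _ _ i := by
    have : Subsingleton (Dl k R M) := ⟨fun f g => Dl.ext' fun m => by
      rw [Subsingleton.elim m 0, map_zero, map_zero]⟩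
    exact EV.sub_left i

def VV {k : Type u} [Field k] {d t : ℕ} (E : ∀ (M : Type u) [AddCommGroup M] [Module (BB k d t) M], ℕ → Prop)
    (M : Type u) [AddCommGroup M]
    [Module (BB k d t) M] (C : ℕ) : Prop := ∀ i, C ≤ i → E M i

variable {E : ∀ (M : Type u) [AddCommGroup M] [Module (BB k d t) M], ℕ → Prop}

lemma VV.mono {M : Type u} [AddCommGroup M] [Module (BB k d t) M] {C C' : ℕ} (h : VV E M C) (hC : C ≤ C') :
    VV E M C' := fun i hi => h i (hC.trans hi)

lemma cfu {lb : Fin d → ℕ} {e : Fin d} {un : ℕ} (he : lb e ≠ un) :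
    (fib (upd lb e un) (lb e)).card + 1 = (fib lb (lb e)).card := by
  have : fib (upd lb e un) (lb e) = (fib lb (lb e)).erase e := by
    ext b
    rw [mem_erase, mfb, mfb]
    by_cases h : b = e
    · subst h; rw [upd_self]; simp [he.symm]
    · rw [upd_ne _ _ h]; simp [h]
  rw [this, card_erase_add_one (mfb.2 rfl)]

lemma cfl {lb : Fin d → ℕ} {e : Fin d} {n un : ℕ} (hn : n ≠ un) :
    (fib (upd lb e un) n).card ≤ (fib lb n).card := by
  refine card_le_card fun b hb => ?_
  rw [mfb] at hb ⊢
  by_cases h : b = e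
  · subst h; rw [upd_self] at hb; exact absurd hb.symm hn
  · rwa [upd_ne _ _ h] at hb

lemma SES.ofExact {R : Type u} [Ring R] {MA ML MC : Type u} [AddCommGroup MA] [Module R MA] [AddCommGroup ML] [Module R ML]
    [AddCommGroup MC] [Module R MC] {f : MA →ₗ[R] ML} {g : ML →ₗ[R] MC} (ex : Exact f g) :
    SES (LinearMap.range f).subtype g.rangeRestrict := by
  refine ⟨Submodule.injective_subtype _, ?_, surjective_rangeRestrict _⟩
  intro y
  rw [← mem_ker, ker_rangeRestrict, mem_ker, ex y, Submodule.coe_subtype, Subtype.range_coe]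
  rfl

lemma koszul_V (hE : Eth (BB k d t) E) {ze un : ℕ} (gr : Even ze) (hh : ¬ Even un) (f : ℕ → ℕ) (hf : ∀ j, 1 ≤ j → f j + 1 ≤ f (j + 1))
    (G : (Fin d → ℕ) → Prop) (hG : ∀ lb e, G lb → lb e = ze → G (upd lb e un))
    (H : ∀ lb e, G lb → lb e = ze → VV E (FF k t (upd lb e un)) (f (fib lb ze).card)) :
    ∀ (m : ℕ) (lb : Fin d → ℕ) (e : Fin d) (hen : lb e ≠ un), G lb → lb e = ze → (fib lb ze).card = m + 1 →
      VV E (LinearMap.range (dl (k := k) (t := t) lb e un hen)) (f (m + 1)) := by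
  intro m
  have hn : ze ≠ un := by rintro rfl; exact hh gr
  induction m with
  | zero =>
    intro lb e hen hGl he hc
    have hs : ∀ b, lb b = ze → b = e := fun b hb => by
      obtain ⟨a, ha⟩ := Finset.card_eq_one.1 hc
      have wh : b ∈ fib lb ze := mfb.2 hb
      have wr : e ∈ fib lb ze := mfb.2 he
      rw [ha, mem_singleton] at wh wr
      rw [wh, wr]
    have hr := LinearMap.range_eq_top.2 (dl_surj (k := k) (t := t) gr hh he hen hs)
    intro i hi
    have := H lb e hGl he i (by rw [hc]; exact hi)
    exact hE.equiv i ((LinearEquiv.ofEq _ _ hr).trans topEquiv) this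
  | succ m ih =>
    intro lb e hen hGl he hc
    have wh := cfu hen
    rw [he, hc] at wh
    obtain ⟨e', he'⟩ : (fib (upd lb e un) ze).Nonempty := card_pos.1 (by omega)
    rw [mfb] at he'
    have hne : e' ≠ e := by rintro rfl; rw [upd_self] at he'; exact hn he'.symm
    have hle : lb e' = ze := by rwa [upd_ne _ _ hne] at he'
    have hen' : upd lb e un e' ≠ un := by rw [he']; exact hn
    have ex := dl_exact (k := k) (t := t) gr hh he hen hne hle hen'
    have V1 := ih (upd lb e un) e' hen' (hG _ _ hGl he) he' (by omega)
    have V2 := H lb e hGl he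
    rw [hc] at V2
    have S := SES.ofExact ex
    have wr := hf (m + 1) (by omega)
    intro i hi
    obtain ⟨i, rfl⟩ : ∃ j, i = j + 1 := ⟨i - 1, by omega⟩
    exact hE.c1 S i (V2 _ hi) (V1 _ (by omega))

lemma koszul_V' (hE : Eth (BB k d t) E) {ze un : ℕ} (gr : Even ze) (hh : ¬ Even un) (f : ℕ → ℕ) (hf : ∀ j, 1 ≤ j → f j + 1 ≤ f (j + 1))
    (G : (Fin d → ℕ) → Prop) (hG : ∀ lb e, G lb → lb e = ze → G (upd lb e un))
    (H : ∀ lb e, G lb → lb e = ze → VV E (FF k t (upd lb e un)) (f (fib lb ze).card))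
    (lb : Fin d → ℕ) (hGl : G lb) (hfr : ∀ b, lb b ≠ un) (hp : 0 < (fib lb ze).card) :
    VV E (FF k t lb) (f (fib lb ze).card) := by
  obtain ⟨e, he⟩ := card_pos.1 hp
  rw [mfb] at he
  obtain ⟨m, hm⟩ : ∃ m, (fib lb ze).card = m + 1 := ⟨(fib lb ze).card - 1, by omega⟩
  have := koszul_V hE gr hh f hf G hG H m lb e (hfr e) hGl he hm
  intro i hi
  rw [hm] at hi
  exact hE.equiv i (LinearEquiv.ofInjective _ (dl_inj hfr)) (this i hi)

def sc {lb : Fin d → ℕ} (c : k) : FF k t lb →ₗ[BB k d t] FF k t lb where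
  toFun x := algebraMap k (BB k d t) c • x
  map_add' x y := smul_add _ _ _
  map_smul' a x := by
    show algebraMap k (BB k d t) c • a • x = a • algebraMap k (BB k d t) c • x
    rw [← mul_smul, Algebra.commutes, mul_smul]

lemma sc_apply {lb : Fin d → ℕ} (c : k) (x : FF k t lb) (i) : (sc c x).1 i = c * x.1 i :=
  XX.scal_apply c x.1 i

lemma peel (hE : Eth (BB k d t) E) {lb : Fin d → ℕ} {e : Fin d} {un : ℕ} (gr : Even (lb e)) (hfr : ∀ b, lb b ≠ un)
    (hr : ((fib lb (lb e)).card : k) ≠ 0) {C : ℕ} (h : VV E (FF k t (upd lb e un)) C) :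
    VV E (FF k t lb) C := by
  intro i hi
  have hq : upd (upd lb e un) e (lb e) = lb := by simp [upd]
  have hz : upd lb e un e ≠ lb e := by rw [upd_self]; exact (hfr e).symm
  refine hE.retr i (dl lb e un (hfr e))
    (sc ((fib lb (lb e)).card : k)⁻¹ ∘ₗ Submodule.inclusion (by rw [hq]) ∘ₗ dl (upd lb e un) e (lb e) hz) ?_ (h i hi)
  refine LinearMap.ext fun x => Subtype.ext (funext fun j => ?_)
  rw [LinearMap.comp_apply, LinearMap.comp_apply, sc_apply]
  have a1 : ∀ j, (dl lb e un (hfr e) x).1 j = x.1 j := fun j => by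
    rw [dl_apply, show fib lb un = ∅ from eq_empty_of_forall_notMem fun b hb => hfr b (mfb.1 hb)]
    simp
  show _ * (dl (upd lb e un) e (lb e) hz (dl lb e un (hfr e) x)).1 j = x.1 j
  rw [dl_apply, a1]
  have a2 : ∑ o ∈ fib (upd lb e un) (lb e), (dl lb e un (hfr e) x).1 (j ∘ swap e o) =
      ∑ o ∈ fib (upd lb e un) (lb e), x.1 j := by
    refine sum_congr rfl fun o ho => ?_
    rw [mfb] at ho
    have q : o ≠ e := by rintro rfl; rw [upd_self] at ho; exact hfr o ho.symm
    rw [upd_ne _ _ q] at ho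
    rw [a1, x.2.sw q.symm ho.symm, eps_ev gr, one_mul]
  rw [a2, Finset.sum_const, eps_ev gr, ← cfu (hfr e), nsmul_eq_mul]
  rw [← cfu (hfr e)] at hr
  push_cast at hr ⊢
  field_simp
  ring

lemma exists_fresh (lb : Fin d → ℕ) : ∃ un, ¬ Even un ∧ ∀ b, lb b ≠ un := by
  refine ⟨2 * (∑ b, lb b) + 1, by simp, fun b hb => ?_⟩
  have := Finset.single_le_sum (f := lb) (fun c _ => Nat.zero_le _) (mem_univ b)
  omega

def nev (lb : Fin d → ℕ) : ℕ := (univ.filter fun b => Even (lb b)).card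

lemma nev_upd {lb : Fin d → ℕ} {e : Fin d} {un : ℕ} (gr : Even (lb e)) (hh : ¬ Even un) :
    nev (upd lb e un) < nev lb := by
  refine card_lt_card (ssubset_iff_of_subset ?_ |>.2 ⟨e, ?_, ?_⟩)
  · intro b hb
    rw [mem_filter] at hb ⊢
    refine ⟨mem_univ _, ?_⟩
    by_cases h : b = e
    · rwa [h]
    · rw [upd_ne _ _ h] at hb; exact hb.2
  · simpa using gr
  · rw [mem_filter, upd_self]; exact fun h => hh h.2

variable {p : ℕ} [CharP k p] {C : ℕ}

lemma cast_ne (r : ℕ) (h : 0 < r) (wh : r < 2 * p) (wr : r ≠ p) : (r : k) ≠ 0 := by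
  rw [Ne, CharP.cast_eq_zero_iff k p]
  rintro ⟨c, rfl⟩
  rcases c with _ | _ | c
  · simp at h
  · simp at wr
  · nlinarith

lemma ev_C0 (hE : Eth (BB k d t) E) (hodd : ∀ lb : Fin d → ℕ, AllOdd lb → VV E (FF k t lb) C) :
    ∀ (m : ℕ) (lb : Fin d → ℕ), nev lb = m → (∀ n, Even n → (fib lb n).card < p) → VV E (FF k t lb) C := by
  intro m
  induction m using Nat.strong_induction_on with
  | _ m ih =>
    intro lb hm hl
    by_cases ho : AllOdd lb
    · exact hodd lb ho
    unfold AllOdd at ho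
    push Not at ho
    obtain ⟨e, he⟩ := ho
    obtain ⟨un, hh, hfr⟩ := exists_fresh lb
    have hpos : 0 < (fib lb (lb e)).card := card_pos.2 ⟨e, mfb.2 rfl⟩
    have hlt := hl _ he
    refine peel hE he hfr (cast_ne (p := p) _ hpos (by omega) (by omega)) (ih _ (hm ▸ nev_upd he hh) _ rfl fun n hn => ?_)
    exact (cfl (by rintro rfl; exact hh hn)).trans_lt (hl n hn)

lemma ev_C1 (hE : Eth (BB k d t) E) (hp : 0 < p) (hodd : ∀ lb : Fin d → ℕ, AllOdd lb → VV E (FF k t lb) C) {ze : ℕ} (gr : Even ze) :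
    ∀ (m : ℕ) (lb : Fin d → ℕ), nev lb = m → (fib lb ze).card < 2 * p → (∀ n, Even n → n ≠ ze → (fib lb n).card < p) →
      VV E (FF k t lb) (C + (p - 1)) := by
  intro m
  induction m using Nat.strong_induction_on with
  | _ m ih =>
    intro lb hm h2p hl
    obtain ⟨un, hh, hfr⟩ := exists_fresh lb
    have hn : ze ≠ un := by rintro rfl; exact hh gr
    rcases lt_trichotomy (fib lb ze).card p with hc | hc | hc
    · refine (ev_C0 hE (p := p) hodd _ lb rfl fun n hn => ?_).mono (by omega)
      by_cases h : n = ze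
      · rwa [h]
      · exact hl n hn h
    · have := koszul_V' hE gr hh (fun j => C + (j - 1)) (fun j hj => by omega)
        (fun ℓ' => (fib ℓ' ze).card ≤ p ∧ (∀ n, Even n → n ≠ ze → (fib ℓ' n).card < p))
        (fun ℓ' e hG he => ⟨(cfl hn).trans hG.1, fun n hn' hne =>
          (cfl (by rintro rfl; exact hh hn')).trans_lt (hG.2 n hn' hne)⟩)
        (fun ℓ' e hG he => (ev_C0 hE (p := p) hodd _ _ rfl fun n hn' => by
          by_cases h : n = ze
          · have := cfu (lb := ℓ') (e := e) (un := un) (he ▸ hn)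
            have := hG.1
            rw [he] at *
            rw [h]; omega
          · exact (cfl (by rintro rfl; exact hh hn')).trans_lt (hG.2 n hn' h)).mono (by omega))
        lb ⟨hc.le, hl⟩ hfr (by omega)
      rwa [hc] at this
    · obtain ⟨e, he⟩ := card_pos.1 (show 0 < (fib lb ze).card by omega)
      rw [mfb] at he
      have hee : Even (lb e) := he ▸ gr
      refine peel hE hee hfr (cast_ne (p := p) _ (by rw [he]; omega) (by rw [he]; omega) (by rw [he]; omega))
        (ih _ (hm ▸ nev_upd hee hh) _ rfl ((cfl hn).trans_lt h2p) fun n hn' hne => ?_)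
      exact (cfl (by rintro rfl; exact hh hn')).trans_lt (hl n hn' hne)

lemma ev_C2 (hE : Eth (BB k d t) E) (hp : 0 < p) (hodd : ∀ lb : Fin d → ℕ, AllOdd lb → VV E (FF k t lb) C) {ze m0 : ℕ} (gr : Even ze) (hm0 : Even m0)
    (hne0 : m0 ≠ ze) (lb : Fin d → ℕ) (hc : (fib lb ze).card = p) (hc' : (fib lb m0).card < 2 * p)
    (hl : ∀ n, Even n → n ≠ ze → n ≠ m0 → (fib lb n).card < p) :
      VV E (FF k t lb) (C + (2 * p - 2)) := by
  obtain ⟨un, hh, hfr⟩ := exists_fresh lb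
  have hn : ze ≠ un := by rintro rfl; exact hh gr
  have hn2 : m0 ≠ un := by rintro rfl; exact hh hm0
  have := koszul_V' hE gr hh (fun j => C + (p - 1) + (j - 1)) (fun j hj => by omega)
        (fun ℓ' => (fib ℓ' ze).card ≤ p ∧ (fib ℓ' m0).card < 2 * p ∧ (∀ n, Even n → n ≠ ze → n ≠ m0 → (fib ℓ' n).card < p))
        (fun ℓ' e hG he => ⟨(cfl hn).trans hG.1, (cfl hn2).trans_lt hG.2.1, fun n hn' hne hne' =>
          (cfl (by rintro rfl; exact hh hn')).trans_lt (hG.2.2 n hn' hne hne')⟩)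
        (fun ℓ' e hG he => (ev_C1 hE (p := p) hp hodd hm0 _ _ rfl ((cfl hn2).trans_lt hG.2.1) fun n hn' hne' => by
          by_cases h : n = ze
          · have := cfu (lb := ℓ') (e := e) (un := un) (he ▸ hn)
            have := hG.1
            rw [he] at *
            rw [h]; omega
          · exact (cfl (by rintro rfl; exact hh hn')).trans_lt (hG.2.2 n hn' h hne')).mono (by omega))
        lb ⟨hc.le, hc', hl⟩ hfr (by omega)
  rw [hc] at this
  exact this.mono (by omega)

lemma FF_sub {lb : Fin d → ℕ} {un : ℕ} (hh : ¬ Even un) (hl : ∀ b, lb b = un) (htd : t < d) : Subsingleton (FF k t lb) := by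
  have : ∀ x : FF k t lb, x = 0 := fun x => Subtype.ext (funext fun i => by
    obtain ⟨a, b, hab, hi⟩ := Fintype.exists_ne_map_eq_of_card_lt i (by simpa using htd)
    exact x.2.van a b hab (by rw [hl, hl]) (by rw [hl]; exact hh) i hi)
  exact ⟨fun x y => by rw [this x, this y]⟩

lemma ev_C3 (hE : Eth (BB k d t) E) (hp : 0 < p) (hC : 1 ≤ C) (htd : t < d) (hd : d = 2 * p) (hodd : ∀ lb : Fin d → ℕ, AllOdd lb → VV E (FF k t lb) C)
    {ze : ℕ} (gr : Even ze) (lb : Fin d → ℕ) (hc : ∀ b, lb b = ze) :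
      VV E (FF k t lb) (C + (2 * p - 2)) := by
  obtain ⟨un, hh, hfr⟩ := exists_fresh lb
  have hn : ze ≠ un := by rintro rfl; exact hh gr
  have hcard : (fib lb ze).card = 2 * p := by
    rw [show fib lb ze = univ from Finset.eq_univ_of_forall fun b => mfb.2 (hc b)]; simp [hd]
  have := koszul_V' hE gr hh (fun j => C + j - 2) (fun j hj => by omega)
        (fun ℓ' => ∀ b, ℓ' b = ze ∨ ℓ' b = un)
        (fun ℓ' e hG he b => by
          by_cases h : b = e
          · right; rw [h, upd_self]
          · rw [upd_ne _ _ h]; exact hG b)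
        (fun ℓ' e hG he => by
          have c1 := cfu (lb := ℓ') (e := e) (un := un) (he ▸ hn)
          rw [he] at c1
          have c2 : (fib ℓ' ze).card ≤ 2 * p := (Finset.card_le_univ _).trans (by simp [hd])
          have ev : ∀ n, Even n → n ≠ ze → (fib (upd ℓ' e un) n).card < p := fun n hn' hne => by
            rw [show fib (upd ℓ' e un) n = ∅ from eq_empty_of_forall_notMem fun b hb => ?_]
            · simpa using hp
            rw [mfb] at hb
            by_cases h : b = e
            · rw [h, upd_self] at hb; exact hh (hb ▸ hn')
            · rw [upd_ne _ _ h] at hb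
              rcases hG b with g | g
              · exact hne (hb.symm.trans g)
              · exact hh (g ▸ hb ▸ hn')
          rcases Nat.eq_zero_or_pos (fib (upd ℓ' e un) ze).card with hz | hz
          · have : ∀ b, upd ℓ' e un b = un := fun b => by
              have q : upd ℓ' e un b ≠ ze := fun h => by
                rw [Finset.card_eq_zero] at hz
                have := mfb.2 h
                rw [hz] at this; simp at this
              by_cases h : b = e
              · rw [h, upd_self]
              · rw [upd_ne _ _ h] at q ⊢
                exact (hG b).resolve_left q
            have := FF_sub (k := k) hh this htd
            exact fun i _ => hE.sub i
          · by_cases hlt : (fib (upd ℓ' e un) ze).card < p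
            · refine (ev_C0 hE (p := p) hodd _ _ rfl fun n hn' => ?_).mono (show C ≤ C + (fib ℓ' ze).card - 2 by omega)
              by_cases h : n = ze
              · rwa [h]
              · exact ev n hn' h
            · exact (ev_C1 hE (p := p) hp hodd gr _ _ rfl (by omega) ev).mono (show _ ≤ C + (fib ℓ' ze).card - 2 by omega))
        lb (fun b => Or.inl (hc b)) hfr (by omega)
  rw [hcard] at this
  exact this.mono (by omega)

lemma fib_disj (lb : Fin d → ℕ) {n m : ℕ} (h : n ≠ m) : (fib lb n).card + (fib lb m).card ≤ d := by
  rw [← card_union_of_disjoint]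
  · exact (Finset.card_le_univ _).trans (by simp)
  · rw [disjoint_left]; intro b hh wh; rw [mfb] at hh wh; exact h (hh.symm.trans wh)

lemma ev_all (hE : Eth (BB k d t) E) (hp : 0 < p) (hC : 1 ≤ C) (htd : t < d) (hd : d = 2 * p) (hodd : ∀ lb : Fin d → ℕ, AllOdd lb → VV E (FF k t lb) C)
    (lb : Fin d → ℕ) : VV E (FF k t lb) (C + (2 * p - 2)) := by
  by_cases H : ∀ n, Even n → (fib lb n).card < p
  · exact (ev_C0 hE (p := p) hodd _ _ rfl H).mono (by omega)
  push Not at H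
  obtain ⟨ze, gr, hc0⟩ := H
  by_cases hall : ∀ b, lb b = ze
  · exact ev_C3 hE (p := p) hp hC htd hd hodd gr lb hall
  have hlt : (fib lb ze).card < 2 * p := by
    by_contra hcon
    have hh : (fib lb ze).card = Fintype.card (Fin d) := le_antisymm (Finset.card_le_univ _) (by simp; omega)
    rw [Finset.card_eq_iff_eq_univ] at hh
    exact hall fun b => mfb.1 (hh ▸ mem_univ b)
  by_cases H2 : ∀ n, Even n → n ≠ ze → (fib lb n).card < p
  · exact (ev_C1 hE (p := p) hp hodd gr _ _ rfl hlt H2).mono (by omega)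
  push Not at H2
  obtain ⟨m0, hm0, hne, hcm⟩ := H2
  have := fib_disj lb hne
  refine ev_C2 hE (p := p) hp hodd gr hm0 hne lb (by omega) (by omega) fun n hn hh wh => ?_
  by_contra hcon
  have hd3 : (fib lb n).card + (fib lb m0).card + (fib lb ze).card ≤ d := by
    rw [← card_union_of_disjoint, ← card_union_of_disjoint]
    · exact (Finset.card_le_univ _).trans (by simp)
    · rw [disjoint_left]; intro b hh wh; rw [mem_union, mfb, mfb] at hh; rw [mfb] at wh
      rcases hh with g | g
      · exact hh (g.symm.trans wh)
      · exact hne (g.symm.trans wh)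
    · rw [disjoint_left]; intro b g1 g2; rw [mfb] at g1 g2; exact wh (g1.symm.trans g2)
  omega

end SV

section SU
open Equiv

variable {k : Type u} [Field k] {d t p : ℕ}

lemma EV_desc {Z : Type u} [AddCommGroup Z] [Module (BB k d t) Z] [Module.Finite (BB k d t) Z] {c : ℕ}
    (h : VV (EVE (BB k d t) Z) (BB k d t) c) : ∀ (j : ℕ) (N : Type u) [AddCommGroup N] [Module (BB k d t) N],
    Module.Finite (BB k d t) N → ∀ i, c ≤ i →
    Fintype.card (Wt d t) + Fintype.card (Wt d t) < i + j → EV (BB k d t) Z N i := by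
  intro j
  induction j with
  | zero => intro N _ _ hN i hi hj; exact QH.EV_fin (Q := QB k d t) QB_goodB i hj
  | succ j ih =>
    intro N _ _ hN i hi hj
    obtain ⟨n, f, hf⟩ := exists_cover (BB k d t) N
    exact (SES.ofKer hf).cov3 (ih _ inferInstance (i + 1) (by omega) (by omega)) (EV.pi_right n i (h i hi))

lemma PD_of_VV {Z : Type u} [AddCommGroup Z] [Module (BB k d t) Z] [Module.Finite (BB k d t) Z] {c : ℕ}
    (h : VV (EVE (BB k d t) Z) (BB k d t) (c + 1)) : PDimLE (BB k d t) c Z :=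
  PDimLE.of_EV c inferInstance fun N _ _ hN =>
    EV_desc h (Fintype.card (Wt d t) + Fintype.card (Wt d t)) N hN (c + 1) le_rfl (by omega)

lemma PD_step (hp : 0 < p) [CharP k p] (htd : t < d) (hd : d = 2 * p) {C : ℕ} {Z : Type u} [AddCommGroup Z] [Module (BB k d t) Z]
    [Module.Finite (BB k d t) Z]
    (hodd : ∀ lb : Fin d → ℕ, AllOdd lb → VV (EVE (BB k d t) Z) (FF k t lb) (C + 1)) : PDimLE (BB k d t) (C + (2 * p - 2)) Z :=
  PD_of_VV fun i hi => EV_BB i fun S => ev_all (Eth.ev _ Z) (p := p) hp (by omega) htd hd hodd _ i (by omega)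

lemma FF_odd_odd {lb ℓ' : Fin d → ℕ} (h : AllOdd lb) (h' : AllOdd ℓ') : VV (EVE (BB k d t) (FF k t lb)) (FF k t ℓ') 1 := by
  intro i hi
  obtain ⟨i, rfl⟩ : ∃ j, i = j + 1 := ⟨i - 1, by omega⟩
  exact EV.equiv_right _ (sdE h').symm
    (QH.EV_good (Q := QB k d t) QB_goodB (QB_goodFF h) (QB_goodFF h') i)

lemma PD_odd (hp : 0 < p) [CharP k p] (htd : t < d) (hd : d = 2 * p) {lb : Fin d → ℕ} (h : AllOdd lb) :
    PDimLE (BB k d t) (2 * p - 2) (FF k t lb) := by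
  have := PD_step (k := k) (p := p) (C := 0) hp htd hd (Z := FF k t lb) fun ℓ' h' => FF_odd_odd h h'
  rwa [zero_add] at this

lemma EV_odd (hp : 0 < p) [CharP k p] (htd : t < d) (hd : d = 2 * p) {lb : Fin d → ℕ} (h : AllOdd lb)
    {Z : Type u} [AddCommGroup Z] [Module (BB k d t) Z] : VV (EVE (BB k d t) Z) (FF k t lb) (2 * p - 2 + 1) := fun i hi =>
  EV.equiv_right _ (sdE h).symm (PDimLE.ev_dual (k := k) (PD_odd hp htd hd h) Z i (by omega))

theorem PD_all (hp : 0 < p) [CharP k p] (htd : t < d) (hd : d = 2 * p) (Z : Type u) [AddCommGroup Z] [Module (BB k d t) Z]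
    [Module.Finite (BB k d t) Z] : PDimLE (BB k d t) (4 * (p - 1)) Z := by
  have := PD_step (k := k) (p := p) hp htd hd (Z := Z) (C := 2 * p - 2) fun lb h => EV_odd hp htd hd h
  rwa [show 2 * p - 2 + (2 * p - 2) = 4 * (p - 1) by omega] at this

end SU

lemma SES.ofSubm {R X : Type u} [Ring R] [AddCommGroup X] [Module R X] {A B C : Submodule R X} (φ : X →ₗ[R] X)
    (hA : ∀ x, x ∈ A ↔ x ∈ B ∧ φ x = 0) (hB : ∀ x ∈ B, φ x ∈ C) (hs : ∀ y ∈ C, ∃ x ∈ B, φ x = y) :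
    ∃ (f : A →ₗ[R] B) (g : B →ₗ[R] C), SES f g := by
  refine ⟨Submodule.inclusion fun x hx => ((hA x).1 hx).1, φ.restrict hB, inclusion_injective _, fun x => ?_, fun y => ?_⟩
  · constructor
    · intro h
      exact ⟨⟨x.1, (hA _).2 ⟨x.2, congrArg Subtype.val h⟩⟩, rfl⟩
    · rintro ⟨y, rfl⟩
      exact Subtype.ext ((hA _).1 y.2).2
  · obtain ⟨x, hx, h⟩ := hs y.1 y.2
    exact ⟨⟨x, hx⟩, Subtype.ext h⟩

section SL
open Equiv

variable {k : Type u} [Field k] {d t : ℕ} {lb : Fin d → ℕ} {e : Fin d} {ze un : ℕ}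

def Dm (e : Fin d) (A : Finset (Fin d)) : XX k d t →ₗ[BB k d t] XX k d t :=
  LinearMap.id - ∑ o ∈ A, pp (swap e o)

lemma Dm_apply (e : Fin d) (A : Finset (Fin d)) (x : XX k d t) (i) :
    Dm e A x i = x i - ∑ o ∈ A, x (i ∘ swap e o) := by
  unfold Dm
  rw [LinearMap.sub_apply, XX.sub_apply, LinearMap.sum_apply, XX.sum_apply]; rfl

lemma dlv_Dm (hh : ¬ Even un) (x : XX k d t) : dlv lb e un x = Dm e (fib lb un) x := by
  funext i; rw [Dm_apply]; unfold dlv; rw [eps_od hh]; ring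

lemma Dm_comm {e e' : Fin d} {A A' : Finset (Fin d)} (h : ∀ a ∈ insert e A, a ∉ insert e' A') (x : XX k d t) :
    Dm e A (Dm e' A' x) = Dm e' A' (Dm e A x) := by
  have key : ∀ o ∈ A, ∀ o' ∈ A', ∀ i : Fin d → Fin t, (i ∘ swap e o) ∘ swap e' o' = (i ∘ swap e' o') ∘ swap e o := by
    intro o ho o' ho' i
    have := h e (Finset.mem_insert_self _ _)
    have := h o (Finset.mem_insert_of_mem ho)
    rw [cc, swap_apply_of_ne_of_ne, swap_apply_of_ne_of_ne] <;> rintro rfl <;> simp_all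
  funext i
  simp only [Dm_apply, sum_sub_distrib]
  rw [sum_comm (s := A)]
  rw [sum_congr rfl fun o' ho' => sum_congr rfl fun o ho => congrArg x (key o ho o' ho' i)]
  ring

lemma hy_Dm (gr : Even ze) (hh : ¬ Even un) (he : lb e = ze) {y : XX k d t} (hyF : IsF (upd lb e un) y)
    {e' : Fin d} {A : Finset (Fin d)} (hA : ∀ a ∈ insert e' A, ¬ UU lb ze un a) (hD : Dm e' A y = 0) :
    Dm e' A (hy lb e ze un y) = 0 := by
  have ht : ∀ o ∈ A, ∀ i : Fin d → Fin t, ∀ b, TopB lb ze un i b ↔ TopB lb ze un (i ∘ swap e' o) b := by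
    intro o ho i b
    have : ∀ c, UU lb ze un c → (i ∘ swap e' o) c = i c := fun c hc => by
      rw [Function.comp_apply, swap_apply_of_ne_of_ne]
      · rintro rfl; exact hA _ (Finset.mem_insert_self _ _) hc
      · rintro rfl; exact hA _ (Finset.mem_insert_of_mem ho) hc
    constructor
    · intro h; exact ⟨h.1, fun c hc => by rw [this _ h.1, this _ hc]; exact h.2 c hc⟩
    · intro h; exact ⟨h.1, fun c hc => by have wr := h.2 c hc; rwa [this _ h.1, this _ hc] at wr⟩
  funext i
  rw [Dm_apply]
  by_cases hex : ∃ es, lb es = ze ∧ TopB lb ze un i es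
  · obtain ⟨es, g1, g2⟩ := hex
    have := congrFun hD (i ∘ swap e es)
    rw [Dm_apply] at this
    rw [hy_some gr hh he hyF g1 g2]
    refine Eq.trans ?_ this
    congr 1
    refine sum_congr rfl fun o ho => ?_
    rw [hy_some gr hh he hyF g1 ((ht o ho i es).1 g2), cc, swap_apply_of_ne_of_ne, swap_apply_of_ne_of_ne]
    all_goals
      rintro rfl
      first
        | exact hA _ (Finset.mem_insert_of_mem ho) (Or.inl ‹_›)
        | exact hA _ (Finset.mem_insert_self _ _) (Or.inl ‹_›)
  · rw [hy_none _ _ hex, sum_eq_zero, sub_zero]; · rfl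
    intro o ho
    refine hy_none _ _ ?_
    rintro ⟨es, g1, g2⟩
    exact hex ⟨es, g1, (ht o ho i es).2 g2⟩

abbrev DK (k : Type u) [Field k] (t : ℕ) (e : Fin d) (A : Finset (Fin d)) : Submodule (BB k d t) (XX k d t) :=
  LinearMap.ker (Dm e A)

abbrev JJ (k : Type u) [Field k] (t : ℕ) (lb : Fin d → ℕ) (e : Fin d) (un : ℕ) (N : Submodule (BB k d t) (XX k d t)) :
    Submodule (BB k d t) (XX k d t) := FF k t lb ⊓ DK k t e (fib lb un) ⊓ N

lemma JJ_SES (gr : Even ze) (hh : ¬ Even un) (he : lb e = ze) {es : Fin d} (hne : es ≠ e) (he1 : lb es = ze)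
    {e' : Fin d} {A : Finset (Fin d)} (hA : ∀ a ∈ insert e' A, ¬ UU lb ze un a) :
    ∃ (f : JJ k t lb e un (DK k t e' A) →ₗ[BB k d t] (FF k t lb ⊓ DK k t e' A : Submodule _ _))
      (g : (FF k t lb ⊓ DK k t e' A : Submodule _ _) →ₗ[BB k d t] JJ k t (upd lb e un) es un (DK k t e' A)), SES f g := by
  have hn : ze ≠ un := by rintro rfl; exact hh gr
  refine SES.ofSubm (Dm e (fib lb un)) ?_ ?_ ?_
  · intro x
    simp only [Submodule.mem_inf, mem_ker]; tauto
  · rintro x ⟨hx, hx'⟩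
    refine ⟨⟨?_, ?_⟩, ?_⟩
    · rw [← dlv_Dm hh]; exact dlv_mem (he ▸ hn) hx
    · refine mem_ker.2 ?_
      rw [← dlv_Dm hh, ← dlv_Dm hh]; funext i; exact koszul_sq gr hh he hx hne he1 i
    · refine mem_ker.2 ?_
      rw [Dm_comm, mem_ker.1 hx', map_zero]
      intro a ha ha'
      refine hA a ha ?_
      rw [mem_insert, mfb] at ha'
      rcases ha' with rfl | ha'
      · exact Or.inl he
      · exact Or.inr ha'
  · rintro y ⟨⟨hyF, hK⟩, hN⟩
    refine ⟨hy lb e ze un y, ⟨hy_mem gr hh he hyF, hy_Dm gr hh he hyF hA hN⟩, ?_⟩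
    rw [← dlv_Dm hh, hy_dl gr hh he hyF (ker_all gr hh he hne he1 hyF fun i => ?_)]
    rw [dlv_Dm hh]; exact congrFun hK i

variable {E : ∀ (M : Type u) [AddCommGroup M] [Module (BB k d t) M], ℕ → Prop}

def fin' (lb : Fin d → ℕ) (ze un : ℕ) (e : Fin d) : Fin d → ℕ := fun b => if lb b = ze ∧ b ≠ e then un else lb b

lemma rev_aux (hE : Eth (BB k d t) E) (gr : Even ze) (hh : ¬ Even un) {c : ℕ} (e : Fin d) {e' : Fin d} {A : Finset (Fin d)}
    (G : (Fin d → ℕ) → Prop) (hG : ∀ lb e, G lb → lb e = ze → G (upd lb e un)) (hA : ∀ lb, G lb → ∀ a ∈ insert e' A, ¬ UU lb ze un a)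
    (H : ∀ lb r, G lb → (fib lb ze).card = r + 2 → E (FF k t lb ⊓ DK k t e' A : Submodule _ _) (c + r)) :
    ∀ m lb, G lb → lb e = ze → (fib lb ze).card = m + 1 →
      (∀ es, lb es = ze → E (JJ k t lb es un (DK k t e' A)) (c + m)) → E (JJ k t (fin' lb ze un e) e un (DK k t e' A)) c := by
  have hn : ze ≠ un := by rintro rfl; exact hh gr
  intro m
  induction m with
  | zero =>
    intro lb hl he hc hJ
    have : fin' lb ze un e = lb := by
      funext b
      refine if_neg fun h => h.2 ?_
      exact Finset.card_le_one.1 (by rw [hc]) b (mfb.2 h.1) e (mfb.2 he)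
    rw [this]; exact hJ e he
  | succ m ih =>
    intro lb hl he hc hJ
    obtain ⟨a, ha, hae⟩ := Finset.exists_mem_ne (show 1 < (fib lb ze).card by omega) e
    rw [mfb] at ha
    have wh := cfu (lb := lb) (e := a) (un := un) (ha ▸ hn)
    rw [ha] at wh
    have := ih (upd lb a un) (hG _ _ hl ha) (by rw [upd_ne _ _ hae.symm, he]) (by omega) fun es wr => by
      have hne : es ≠ a := by rintro rfl; rw [upd_self] at wr; exact hn wr.symm
      rw [upd_ne _ _ hne] at wr
      obtain ⟨f, g, S⟩ := JJ_SES (k := k) (t := t) gr hh ha hne wr (hA _ hl)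
      exact hE.c3 S _ (hJ a ha) (H lb m hl (by omega))
    have h4 : fin' (upd lb a un) ze un e = fin' lb ze un e := by
      funext b
      unfold fin'
      by_cases hb : b = a
      · subst hb; rw [upd_self]; simp [ha, hae]
      · rw [upd_ne _ _ hb]
    rwa [h4] at this

lemma rev (hE : Eth (BB k d t) E) (gr : Even ze) (hh : ¬ Even un) {c : ℕ} (e : Fin d) {e' : Fin d} {A : Finset (Fin d)}
    (G : (Fin d → ℕ) → Prop) (hG : ∀ lb e, G lb → lb e = ze → G (upd lb e un)) (hA : ∀ lb, G lb → ∀ a ∈ insert e' A, ¬ UU lb ze un a)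
    (H : ∀ lb r, G lb → (fib lb ze).card = r + 2 → E (FF k t lb ⊓ DK k t e' A : Submodule _ _) (c + r))
    (lb : Fin d → ℕ) (hl : G lb) (he : lb e = ze) (hf : ∀ b, lb b ≠ un) :
    E (JJ k t (fin' lb ze un e) e un (DK k t e' A)) c := by
  have : 0 < (fib lb ze).card := card_pos.2 ⟨e, mfb.2 he⟩
  refine rev_aux hE gr hh e G hG hA H ((fib lb ze).card - 1) lb hl he (by omega) fun es _ => ?_
  have : Subsingleton (JJ k t lb es un (DK k t e' A)) := by
    have key : ∀ x ∈ JJ k t lb es un (DK k t e' A), x = 0 := by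
      rintro x ⟨⟨_, hx⟩, _⟩
      funext i
      have := congrFun (mem_ker.1 hx) i
      rw [Dm_apply, show fib lb un = ∅ from eq_empty_of_forall_notMem fun b hb => hf b (mfb.1 hb),
        sum_empty, sub_zero] at this
      exact this
    exact ⟨fun a b => Subtype.ext ((key _ a.2).trans (key _ b.2).symm)⟩
  exact hE.sub _

end SL

section SM
open Equiv

variable {k : Type u} [Field k] {d t p : ℕ} {ze un : ℕ}
variable {E : ∀ (M : Type u) [AddCommGroup M] [Module (BB k d t) M], ℕ → Prop}

def Gd (L : Fin d → ℕ) (ze un : ℕ) (lb : Fin d → ℕ) : Prop := ∀ b, lb b = L b ∨ (L b = ze ∧ lb b = un)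

lemma Gd.fib {L lb : Fin d → ℕ} (h : Gd L ze un lb) {n : ℕ} (hn : n ≠ un) : fib lb n ⊆ fib L n := fun b hb => by
  rw [mfb] at hb ⊢
  rcases h b with h | h
  · rw [← h, hb]
  · exact absurd (hb.symm.trans h.2) hn

lemma rev' (hE : Eth (BB k d t) E) (gr : Even ze) (hh : ¬ Even un) {c m : ℕ} {e e' : Fin d} {A : Finset (Fin d)}
    {L : Fin d → ℕ} (hf : ∀ b, L b ≠ un) (he : L e = ze) (hA : ∀ a ∈ insert e' A, L a ≠ ze) (hc : (fib L ze).card = m + 2)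
    (HL : E (FF k t L ⊓ DK k t e' A : Submodule _ _) (c + m))
    (H : ∀ lb, Gd L ze un lb → (fib lb ze).card < m + 2 → VV E (FF k t lb ⊓ DK k t e' A : Submodule _ _) c) :
    E (JJ k t (fin' L ze un e) e un (DK k t e' A)) c := by
  have hn : ze ≠ un := by rintro rfl; exact hh gr
  refine rev hE gr hh e (Gd L ze un) ?_ ?_ ?_ L (fun b => Or.inl rfl) he hf
  · intro lb a hl ha b
    by_cases hb : b = a
    · subst hb
      rw [upd_self]
      rcases hl b with h | h
      · exact Or.inr ⟨h.symm.trans ha, rfl⟩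
      · exact Or.inr ⟨h.1, rfl⟩
    · rw [upd_ne _ _ hb]; exact hl b
  · intro lb hl a ha hu
    have wh := hA a ha
    rcases hl a with h | h
    · rcases hu with hu | hu
      · exact wh (h.symm.trans hu)
      · exact hf a (h.symm.trans hu)
    · exact wh h.1
  · intro lb r hl hr
    by_cases h : r = m
    · have wr := eq_of_subset_of_card_le (hl.fib hn) (by omega)
      have : lb = L := by
        funext b
        rcases hl b with h4 | h4
        · exact h4
        · have : b ∈ fib lb ze := by rw [wr, mfb]; exact h4.1
          rw [mfb.1 this, h4.1]
      rw [this, h]; exact HL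
    · have := card_le_card (hl.fib hn)
      exact H lb hl (by omega) _ (by omega)

end SM

section SN
open Equiv

variable {k : Type u} [Field k] {t p : ℕ} {C : ℕ}
variable {E : ∀ (M : Type u) [AddCommGroup M] [Module (BB k (2 * p) t) M], ℕ → Prop}

def lab (p a' a b' b : ℕ) : Fin (2 * p) → ℕ := fun x =>
  if x.val < p then (if x.val = 0 then a' else a) else (if x.val = p then b' else b)

lemma card_lo (p : ℕ) : (univ.filter fun x : Fin (2 * p) => x.val < p).card = p := by
  rw [Fin.card_filter_val_lt]; omega

lemma card_hi (p : ℕ) : (univ.filter fun x : Fin (2 * p) => ¬ x.val < p).card = p := by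
  have := card_filter_add_card_filter_not (s := (univ : Finset (Fin (2 * p)))) (fun x => x.val < p)
  rw [card_lo, card_univ, Fintype.card_fin] at this; omega

abbrev pe (hp : 2 ≤ p) : Fin (2 * p) := ⟨0, by omega⟩
abbrev pf (hp : 2 ≤ p) : Fin (2 * p) := ⟨p, by omega⟩

variable (hp : 2 ≤ p)

lemma updL (a' a b' b n : ℕ) : upd (lab p a' a b' b) (pe hp) n = lab p n a b' b := by
  funext x
  by_cases h : x = pe hp
  · subst h; rw [upd_self]; unfold lab; rw [if_pos (by show 0 < p; omega), if_pos rfl]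
  · rw [upd_ne _ _ h]; unfold lab
    rw [if_neg (c := x.val = 0) fun wh => h (Fin.ext wh), if_neg (c := x.val = 0) fun wh => h (Fin.ext wh)]

lemma updR (a' a b' b n : ℕ) : upd (lab p a' a b' b) (pf hp) n = lab p a' a n b := by
  funext x
  by_cases h : x = pf hp
  · subst h; rw [upd_self]; unfold lab; rw [if_neg (by show ¬ p < p; omega), if_pos rfl]
  · rw [upd_ne _ _ h]; unfold lab
    rw [if_neg (c := x.val = p) fun wh => h (Fin.ext wh), if_neg (c := x.val = p) fun wh => h (Fin.ext wh)]

lemma finL : fin' (lab p 0 0 2 2) 0 1 (pe hp) = lab p 0 1 2 2 := by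
  funext x; unfold fin' lab
  by_cases h : x.val = 0
  · have : x = pe hp := Fin.ext h
    simp [this]
  · have : x ≠ pe hp := fun wh => h (congrArg Fin.val wh)
    by_cases wr : x.val < p <;> simp [this, h, wr]

lemma finR : fin' (lab p 0 1 2 2) 2 3 (pf hp) = lab p 0 1 2 3 := by
  funext x; unfold fin' lab
  by_cases h : x.val = p
  · have : x = pf hp := Fin.ext h
    simp [this]
  · have : x ≠ pf hp := fun wh => h (congrArg Fin.val wh)
    by_cases wr : x.val < p
    · simp [wr]; split_ifs <;> simp
    · simp [this, h, wr]

lemma lab_odd {a' a b' b : ℕ} (hh : ¬ Even a') (wh : ¬ Even a) (wr : ¬ Even b') (h4 : ¬ Even b) : AllOdd (lab p a' a b' b) := by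
  intro x; unfold lab; split_ifs <;> assumption

/-- step 1 -/
lemma LBa (hE : Eth (BB k (2 * p) t) E) (hodd : ∀ lb : Fin (2 * p) → ℕ, AllOdd lb → VV E (FF k t lb) C)
    [CharP k p] (H : E (FF k t (lab p 0 0 2 2)) (C + (2 * p - 3))) :
    E (FF k t (lab p 0 1 2 2) ⊓ DK k t (pe hp) (fib (lab p 0 1 2 2) 1) : Submodule _ _) (C + (p - 1)) := by
  have htop : ∀ M : Submodule (BB k (2 * p) t) (XX k (2 * p) t), M ⊓ DK k t (pf hp) {pf hp} = M := by
    intro M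
    refine inf_eq_left.2 fun x _ => mem_ker.2 ?_
    funext i
    rw [Dm_apply, Finset.sum_singleton, swap_self]
    exact sub_self _
  have := rev' (c := C + (p - 1)) (m := p - 2) (L := lab p 0 0 2 2) (ze := 0) (un := 1) (e := pe hp) (e' := pf hp) (A := {pf hp}) hE
    (by decide) (by decide)
    (by intro b; unfold lab; split_ifs <;> decide) (by unfold lab; simp; omega)
    (by intro a ha; simp only [mem_insert, mem_singleton, or_self] at ha; subst ha; unfold lab; simp)
    ?_ ?_ ?_
  · rw [finL] at this; unfold JJ at this; rwa [htop] at this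
  · refine Eq.trans ?_ ((card_lo p).trans (by omega))
    congr 1; ext x; rw [mfb]; unfold lab; simp
  · rw [htop, show C + (p - 1) + (p - 2) = C + (2 * p - 3) by omega]; exact H
  · intro lb hl hc
    rw [htop]
    refine ev_C1 hE (p := p) (by omega) hodd (ze := 2) (by decide) _ lb rfl ?_ ?_
    · refine (card_le_card (hl.fib (by decide))).trans_lt ?_
      refine (card_le_card (t := univ.filter fun x : Fin (2 * p) => ¬ x.val < p) fun x hx => ?_).trans_lt (by rw [card_hi]; omega)
      rw [mfb] at hx; unfold lab at hx; split_ifs at hx <;> simp_all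
    · intro n hn hn2
      by_cases h : n = 0
      · subst h; omega
      · refine (card_le_card (hl.fib (by rintro rfl; revert hn; decide))).trans_lt ?_
        rw [Finset.card_eq_zero.2]
        · omega
        · refine eq_empty_of_forall_notMem fun x hx => ?_
          rw [mfb] at hx; unfold lab at hx; split_ifs at hx <;> omega

/-- step 2 -/
lemma LBb (hE : Eth (BB k (2 * p) t) E) (hodd : ∀ lb : Fin (2 * p) → ℕ, AllOdd lb → VV E (FF k t lb) C)
    [CharP k p]
    (H : E (FF k t (lab p 0 1 2 2) ⊓ DK k t (pe hp) (fib (lab p 0 1 2 2) 1) : Submodule _ _) (C + (p - 1))) :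
    E (JJ k t (lab p 0 1 2 3) (pf hp) 3 (DK k t (pe hp) (fib (lab p 0 1 2 2) 1))) (C + 1) := by
  have hlo : ∀ a, lab p 0 1 2 2 a = 1 → a.val < p := by
    intro a h; by_contra wh; unfold lab at h; rw [if_neg wh] at h; simp at h
  have := rev' (c := C + 1) (m := p - 2) (L := lab p 0 1 2 2) (ze := 2) (un := 3) (e := pf hp) (e' := pe hp)
    (A := fib (lab p 0 1 2 2) 1) hE
    (by decide) (by decide)
    (by intro b; unfold lab; split_ifs <;> decide) (by unfold lab; simp)
    (by
      intro a ha
      rw [mem_insert, mfb] at ha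
      rcases ha with rfl | ha
      · unfold lab; simp; omega
      · omega)
    ?_ ?_ ?_
  · rwa [finR] at this
  · refine Eq.trans ?_ ((card_hi p).trans (by omega))
    congr 1; ext x; rw [mfb]; unfold lab; simp
    split_ifs <;> simp_all
  · rw [show C + 1 + (p - 2) = C + (p - 1) by omega]; exact H
  · intro lb hl hc
    have hfib : fib lb 1 = fib (lab p 0 1 2 2) 1 := by
      ext x; rw [mfb, mfb]
      rcases hl x with h | h
      · rw [h]
      · omega
    have hle : lb (pe hp) = 0 := by
      have wr : lab p 0 1 2 2 (pe hp) = 0 := by unfold lab; simp; omega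
      rcases hl (pe hp) with h | h
      · omega
      · omega
    have hs : ∀ b, lb b = 0 → b = pe hp := by
      intro b hb
      have hb2 : lab p 0 1 2 2 b = 0 := by
        rcases hl b with h | h <;> omega
      unfold lab at hb2; split_ifs at hb2
      exact Fin.ext ‹_›
    have hlt : ∀ n, Even n → (fib lb n).card < p := by
      intro n hn
      by_cases h : n = 2
      · subst h; omega
      by_cases h : n = 0
      · subst h
        refine lt_of_le_of_lt (Finset.card_le_one.2 fun a ha b hb => ?_) (show 1 < p by omega)
        rw [hs a (mfb.1 ha), hs b (mfb.1 hb)]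
      · refine (card_le_card (hl.fib (by rintro rfl; revert hn; decide))).trans_lt ?_
        rw [Finset.card_eq_zero.2]
        · omega
        · refine eq_empty_of_forall_notMem fun x hx => ?_
          rw [mfb] at hx; unfold lab at hx; split_ifs at hx <;> first | omega | (subst hx; revert hn; decide)
    obtain ⟨f, g, S⟩ : ∃ (f : (FF k t lb ⊓ DK k t (pe hp) (fib lb 1) : Submodule _ _) →ₗ[BB k (2 * p) t] FF k t lb)
        (g : FF k t lb →ₗ[BB k (2 * p) t] FF k t (upd lb (pe hp) 1)), SES f g := by
      refine SES.ofSubm (Dm (pe hp) (fib lb 1)) (fun x => Iff.rfl) (fun x hx => ?_) fun y hy => ?_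
      · rw [← dlv_Dm (by decide)]; exact dlv_mem (by omega) hx
      · obtain ⟨x, hx⟩ := dl_surj (k := k) (t := t) (ze := 0) (un := 1) (by decide) (by decide) hle (by omega) hs ⟨y, hy⟩
        exact ⟨x.1, x.2, by rw [← dlv_Dm (by decide)]; exact congrArg Subtype.val hx⟩
    rw [← hfib]
    intro i hi
    obtain ⟨i, rfl⟩ : ∃ j, i = j + 1 := ⟨i - 1, by omega⟩
    refine hE.c1 S i (ev_C0 hE (p := p) hodd _ lb rfl hlt _ (by omega)) (ev_C0 hE (p := p) hodd _ _ rfl (fun n hn => ?_) _ (by omega))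
    exact (cfl (by rintro rfl; revert hn; decide)).trans_lt (hlt n hn)

end SN

lemma SES.ofQ {R X : Type u} [Ring R] [AddCommGroup X] [Module R X] {W K1 K2 T N : Submodule R X} {D1 D2 : X →ₗ[R] X}
    (hh : ∀ x ∈ K1, D1 x ∈ T) (wh : ∀ x ∈ K2, D2 x ∈ T) (w1 : ∀ w ∈ W, D1 w ∈ K2) (w2 : ∀ w ∈ W, D2 w ∈ K1)
    (hc : ∀ x, D1 (D2 x) = D2 (D1 x)) (hN : ∀ x, x ∈ N ↔ x ∈ W ∧ D1 x = 0 ∧ D2 x = 0)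
    (s : ∀ x ∈ K1, ∀ y ∈ K2, D1 x + D2 y = 0 → ∃ w ∈ W, D2 w = x ∧ D1 w = -y) :
    ∃ (f : N →ₗ[R] W) (g : W →ₗ[R] LinearMap.ker ((D1.restrict hh).coprod (D2.restrict wh))), SES f g := by
  refine ⟨Submodule.inclusion fun x hx => ((hN x).1 hx).1,
    LinearMap.codRestrict _ (LinearMap.prod (D2.restrict w2) (-(D1.restrict w1))) fun w => ?_,
    inclusion_injective _, fun x => ?_, fun y => ?_⟩
  · rw [mem_ker]
    apply Subtype.ext
    show D1 (D2 w.1) + D2 (- D1 w.1) = 0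
    rw [map_neg, hc, add_neg_cancel]
  · constructor
    · intro h
      have wr := congrArg (fun q => ((Subtype.val q).1 : K1).1) h
      have h4 := congrArg (fun q => ((Subtype.val q).2 : K2).1) h
      change D2 x.1 = 0 at wr
      change - D1 x.1 = 0 at h4
      exact ⟨⟨x.1, (hN _).2 ⟨x.2, neg_eq_zero.1 h4, wr⟩⟩, rfl⟩
    · rintro ⟨y, rfl⟩
      have := (hN _).1 y.2
      apply Subtype.ext
      refine Prod.ext (Subtype.ext this.2.2) (Subtype.ext ?_)
      show - D1 y.1 = 0
      rw [this.2.1, neg_zero]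
  · obtain ⟨⟨x, z⟩, h⟩ := y
    obtain ⟨w, hw, es, e2⟩ := s x.1 x.2 z.1 z.2 (congrArg Subtype.val h)
    refine ⟨⟨w, hw⟩, Subtype.ext (Prod.ext (Subtype.ext es) (Subtype.ext ?_))⟩
    show - D1 w = z.1
    rw [e2, neg_neg]

section SO
open Equiv

variable {k : Type u} [Field k] {t p : ℕ} {C : ℕ}
variable {E : ∀ (M : Type u) [AddCommGroup M] [Module (BB k (2 * p) t) M], ℕ → Prop}

def A1 (p : ℕ) : Finset (Fin (2 * p)) := univ.filter fun x => x.val < p ∧ x.val ≠ 0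
def A2 (p : ℕ) : Finset (Fin (2 * p)) := univ.filter fun x => p < x.val

variable (hp : 2 ≤ p)

lemma fibA1 {b' b : ℕ} (hh : b' ≠ 1) (wh : b ≠ 1) : fib (lab p 0 1 b' b) 1 = A1 p := by
  ext x; rw [mfb]; unfold lab A1; rw [mem_filter]
  split_ifs <;> simp_all

lemma fibA2 {a' a : ℕ} (hh : a' ≠ 3) (wh : a ≠ 3) : fib (lab p a' a 2 3) 3 = A2 p := by
  ext x; rw [mfb]; unfold lab A2; rw [mem_filter]
  split_ifs <;> simp_all <;> omega

lemma labe (a' a b' b : ℕ) : lab p a' a b' b (pe hp) = a' := by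
  unfold lab; rw [if_pos (by show 0 < p; omega), if_pos rfl]
lemma labf (a' a b' b : ℕ) : lab p a' a b' b (pf hp) = b' := by
  unfold lab; rw [if_neg (by show ¬ p < p; omega), if_pos rfl]

lemma D1_mem {b' b : ℕ} (hh : b' ≠ 1) (wh : b ≠ 1) (x) (hx : x ∈ FF k t (lab p 0 1 b' b)) : Dm (pe hp) (A1 p) x ∈ FF k t (lab p 1 1 b' b) := by
  rw [← fibA1 hh wh, ← dlv_Dm (by decide), ← updL hp 0 1 b' b 1]
  exact dlv_mem (by rw [labe]; decide) hx

lemma D2_mem {a' a : ℕ} (hh : a' ≠ 3) (wh : a ≠ 3) (x) (hx : x ∈ FF k t (lab p a' a 2 3)) : Dm (pf hp) (A2 p) x ∈ FF k t (lab p a' a 3 3) := by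
  rw [← fibA2 hh wh, ← dlv_Dm (by decide), ← updR hp a' a 2 3 3]
  exact dlv_mem (by rw [labf]; decide) hx

lemma D1_surj {b' b : ℕ} (hh : b' ≠ 1) (wh : b ≠ 1) (h1' : b' ≠ 0) (h2' : b ≠ 0) (y) (hyF : y ∈ FF k t (lab p 1 1 b' b)) :
    ∃ x ∈ FF k t (lab p 0 1 b' b), Dm (pe hp) (A1 p) x = y ∧ (Dm (pf hp) (A2 p) y = 0 → Dm (pf hp) (A2 p) x = 0) := by
  rw [← updL hp 0 1 b' b 1] at hyF
  refine ⟨_, hy_mem (by decide) (by decide) (labe hp _ _ _ _) hyF, ?_, hy_Dm (by decide) (by decide) (labe hp _ _ _ _) hyF ?_⟩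
  · rw [← fibA1 hh wh, ← dlv_Dm (by decide)]
    refine hy_dl (by decide) (by decide) (labe hp _ _ _ _) hyF fun es q1 q2 => absurd ?_ q1
    unfold lab at q2
    split_ifs at q2 <;> first | omega | exact Fin.ext (by assumption)
  · intro a ha
    have : p ≤ a.val := by
      rw [mem_insert] at ha
      rcases ha with rfl | ha
      · exact le_rfl
      · rw [A2, mem_filter] at ha; exact ha.2.le
    unfold UU lab
    rw [if_neg (by omega)]
    split_ifs <;> tauto

lemma D2_surj {a' a : ℕ} (hh : a' ≠ 3) (wh : a ≠ 3) (h1' : a' ≠ 2) (h2' : a ≠ 2) (y) (hyF : y ∈ FF k t (lab p a' a 3 3)) :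
    ∃ x ∈ FF k t (lab p a' a 2 3), Dm (pf hp) (A2 p) x = y := by
  rw [← updR hp a' a 2 3 3] at hyF
  refine ⟨_, hy_mem (by decide) (by decide) (labf hp _ _ _ _) hyF, ?_⟩
  rw [← fibA2 hh wh, ← dlv_Dm (by decide)]
  refine hy_dl (by decide) (by decide) (labf hp _ _ _ _) hyF fun es q1 q2 => absurd ?_ q1
  unfold lab at q2
  split_ifs at q2 <;> first | omega | exact Fin.ext (by assumption)

lemma D_comm (x : XX k (2 * p) t) : Dm (pe hp) (A1 p) (Dm (pf hp) (A2 p) x) = Dm (pf hp) (A2 p) (Dm (pe hp) (A1 p) x) := by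
  refine Dm_comm (fun a ha hb => ?_) x
  rw [mem_insert, A1, mem_filter] at ha
  rw [mem_insert, A2, mem_filter] at hb
  have hh : a.val < p := by
    rcases ha with rfl | ha
    · show 0 < p; omega
    · exact ha.2.1
  rcases hb with rfl | hb
  · exact lt_irrefl _ hh
  · omega

abbrev KK1 (k : Type u) [Field k] (t p : ℕ) := FF k t (lab p 0 1 3 3)
abbrev KK2 (k : Type u) [Field k] (t p : ℕ) := FF k t (lab p 1 1 2 3)
abbrev Th (k : Type u) [Field k] (t p : ℕ) := FF k t (lab p 1 1 3 3)

def de (k : Type u) [Field k] (t : ℕ) : (KK1 k t p × KK2 k t p) →ₗ[BB k (2 * p) t] Th k t p :=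
  ((Dm (pe hp) (A1 p)).restrict (D1_mem hp (by decide) (by decide))).coprod
    ((Dm (pf hp) (A2 p)).restrict (D2_mem hp (by decide) (by decide)))

lemma de_surj : Surjective (de hp k t) := fun y => by
  obtain ⟨x, hx, h, -⟩ := D1_surj hp (by decide) (by decide) (by decide) (by decide) y.1 y.2
  refine ⟨(⟨x, hx⟩, 0), Subtype.ext ?_⟩
  show Dm (pe hp) (A1 p) x + Dm (pf hp) (A2 p) 0 = y.1
  rw [map_zero, add_zero, h]

abbrev QQ (k : Type u) [Field k] (t : ℕ) : Submodule (BB k (2 * p) t) (KK1 k t p × KK2 k t p) := LinearMap.ker (de hp k t)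

lemma lab_lt (hp' : 2 ≤ p) {a' b' : ℕ} (n : ℕ) (hn : Even n) (h : a' ≠ b' ∨ ¬ Even a') : (fib (lab p a' 1 b' 3) n).card < p := by
  refine lt_of_le_of_lt (Finset.card_le_one.2 fun a ha b hb => Fin.ext ?_) (show 1 < p by omega)
  rw [mfb] at ha hb
  have hh : n ≠ 1 := by rintro rfl; revert hn; decide
  have wr : n ≠ 3 := by rintro rfl; revert hn; decide
  have wh : n = a' → a' ≠ b' := by rintro rfl; tauto
  unfold lab at ha hb
  split_ifs at ha hb <;> omega

lemma LBc (hE : Eth (BB k (2 * p) t) E) (hodd : ∀ lb : Fin (2 * p) → ℕ, AllOdd lb → VV E (FF k t lb) C) [CharP k p]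
    (H : E (FF k t (lab p 0 0 2 2)) (C + (2 * p - 3))) : E (QQ hp k t) C := by
  have hh := LBb hp hE hodd (LBa hp hE hodd H)
  obtain ⟨f, g, S⟩ := SES.ofQ (W := FF k t (lab p 0 1 2 3)) (N := JJ k t (lab p 0 1 2 3) (pf hp) 3 (DK k t (pe hp) (fib (lab p 0 1 2 2) 1)))
      (D1_mem hp (b' := 3) (b := 3) (by decide) (by decide)) (D2_mem hp (a' := 1) (a := 1) (by decide) (by decide))
      (D1_mem hp (by decide) (by decide)) (D2_mem hp (by decide) (by decide)) (D_comm hp) (by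
      intro x
      unfold JJ
      rw [fibA1 (by decide) (by decide), fibA2 (by decide) (by decide)]
      simp only [Submodule.mem_inf, mem_ker]; tauto
    ) (by
      intro x hx y hy hxy
      obtain ⟨w0, hw0, e0⟩ := D2_surj hp (by decide) (by decide) (by decide) (by decide) x hx
      obtain ⟨w1, hw1, es, e1'⟩ := D1_surj hp (by decide) (by decide) (by decide) (by decide) (-y - Dm (pe hp) (A1 p) w0)
        (Submodule.sub_mem _ (Submodule.neg_mem _ hy) (D1_mem hp (by decide) (by decide) w0 hw0))
      refine ⟨w0 + w1, Submodule.add_mem _ hw0 hw1, ?_, ?_⟩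
      · rw [map_add, e0, e1', add_zero]
        rw [map_sub, map_neg, ← D_comm, e0, eq_neg_of_add_eq_zero_left hxy]; abel
      · rw [map_add, es]; abel)
  exact hE.c3 S C hh (ev_C0 hE (p := p) hodd _ _ rfl (fun n hn => lab_lt hp n hn (by left; decide)) C le_rfl)

end SO

section SN
open CategoryTheory CategoryTheory.Abelian

lemma SES.decomp {R : Type u} [Ring R] {MA ML MC N₁ N₂ N₃ : Type u} [AddCommGroup MA] [Module R MA] [AddCommGroup ML] [Module R ML]
    [AddCommGroup MC] [Module R MC] [AddCommGroup N₁] [Module R N₁] [AddCommGroup N₂] [Module R N₂]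
    [AddCommGroup N₃] [Module R N₃] {f : MA →ₗ[R] ML} {g : ML →ₗ[R] MC} {f' : N₁ →ₗ[R] N₂} {g' : N₂ →ₗ[R] N₃}
    (S : SES f g) (T : SES f' g') (hh : EV R MC N₁ 2) (wh : EV R ML N₂ 1) (β : MA →ₗ[R] N₃) :
    ∃ (z : MA →ₗ[R] N₂) (w : ML →ₗ[R] N₃), ∀ x, β x = g' (z x) + w (f x) := by
  obtain ⟨x, hx⟩ := Ext.covariant_sequence_exact₃ (ModuleCat.of R MC) T.se
    (S.se.extClass.comp (Ext.mk₀ (ofHom β)) (add_zero 1)) (n₁ := 2) rfl (hh _)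
  obtain ⟨y, hy⟩ := Ext.contravariant_sequence_exact₃ S.se (ModuleCat.of R N₂) x (wh _) (add_comm 1 0)
  obtain ⟨z, rfl⟩ := Ext.mk₀_bijective _ _ |>.2 y
  have wr : S.se.extClass.comp (Ext.mk₀ (ofHom (β - g' ∘ₗ z.hom))) (add_comm 1 0) = 0 := by
    have : ofHom (β - g' ∘ₗ z.hom) = ofHom β - z ≫ ofHom g' := rfl
    rw [this, sub_eq_add_neg, Ext.mk₀_add, Ext.mk₀_neg, Ext.comp_add, Ext.comp_neg, ← sub_eq_add_neg, sub_eq_zero, ← Ext.mk₀_comp_mk₀, ← Ext.comp_assoc_of_third_deg_zero, hy]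
    exact hx.symm
  obtain ⟨w, hw⟩ := Ext.contravariant_sequence_exact₁ S.se (ModuleCat.of R N₃) _ (add_comm 1 0) wr
  obtain ⟨w, rfl⟩ := Ext.mk₀_bijective _ _ |>.2 w
  rw [Ext.mk₀_comp_mk₀] at hw
  have := hom_ext_iff.1 ((Ext.mk₀_bijective _ _).1 hw)
  refine ⟨z.hom, w.hom, fun x => ?_⟩
  have h4 : w.hom (f x) = β x - g' (z.hom x) := LinearMap.congr_fun this x
  rw [h4]; abel

lemma SES.prod (R : Type u) [Ring R] (MA ML : Type u) [AddCommGroup MA] [Module R MA] [AddCommGroup ML] [Module R ML] :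
    SES (LinearMap.inl R MA ML) (LinearMap.snd R MA ML) :=
  ⟨LinearMap.inl_injective, fun x => ⟨fun h => ⟨x.1, Prod.ext rfl (Eq.symm h)⟩, by rintro ⟨y, rfl⟩; rfl⟩, LinearMap.snd_surjective⟩

variable {k : Type u} [Field k] {t p : ℕ} {C : ℕ}
variable {E : ∀ (M : Type u) [AddCommGroup M] [Module (BB k (2 * p) t) M], ℕ → Prop}

lemma VV_K (hp : 2 ≤ p) [CharP k p] (hE : Eth (BB k (2 * p) t) E) (hodd : ∀ lb : Fin (2 * p) → ℕ, AllOdd lb → VV E (FF k t lb) C) :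
    VV E (KK1 k t p × KK2 k t p) C := fun i hi =>
  hE.c2 (SES.prod _ _ _) i
    (ev_C0 hE (p := p) hodd _ _ rfl (fun n hn => lab_lt hp n hn (by left; decide)) i hi)
    (ev_C0 hE (p := p) hodd _ _ rfl (fun n hn => lab_lt hp n hn (by left; decide)) i hi)

lemma Th_odd : AllOdd (lab p 1 1 3 3) := lab_odd (by decide) (by decide) (by decide) (by decide)

lemma VV_ED {lb : Fin (2 * p) → ℕ} (h : AllOdd lb) (ℓ' : Fin (2 * p) → ℕ) (h' : AllOdd ℓ') :
    VV (EDE k (BB k (2 * p) t) (FF k t lb)) (FF k t ℓ') 1 := fun i hi =>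
  EV.equiv_left i (sdE h') (FF_odd_odd h' h i hi)

lemma EV_KK (hp : 2 ≤ p) [CharP k p] : EV (BB k (2 * p) t) (Dl k (BB k (2 * p) t) (KK1 k t p × KK2 k t p)) (KK1 k t p × KK2 k t p) 1 :=
  VV_K hp (Eth.ev _ _) (C := 1) (fun lb h i hi => VV_K hp (Eth.dl k _ (FF k t lb)) (VV_ED h) i hi) 1 le_rfl

lemma EV_QQ (hp : 2 ≤ p) [CharP k p] (htd : t < 2 * p)
    (H : EV (BB k (2 * p) t) (Dl k (BB k (2 * p) t) (FF k t (lab p 0 0 2 2))) (FF k t (lab p 0 0 2 2)) (4 * (p - 1))) :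
    EV (BB k (2 * p) t) (Dl k (BB k (2 * p) t) (QQ hp k t)) (QQ hp k t) 2 := by
  have hh : EV (BB k (2 * p) t) (Dl k (BB k (2 * p) t) (QQ hp k t)) (FF k t (lab p 0 0 2 2)) (2 * p - 1) :=
    LBc hp (Eth.dl k _ (FF k t (lab p 0 0 2 2))) (C := 2 * p - 1)
      (fun lb h i hi => EV.equiv_left i (sdE h) (PDimLE.ev (PD_odd (by omega) htd rfl h) _ i (by omega)))
      (by rw [show 2 * p - 1 + (2 * p - 3) = 4 * (p - 1) by omega]; exact H)
  refine LBc hp (Eth.ev _ (Dl k (BB k (2 * p) t) (QQ hp k t))) (C := 2) (fun lb h i hi => ?_)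
    (by rw [show 2 + (2 * p - 3) = 2 * p - 1 by omega]; exact hh)
  obtain ⟨j, rfl⟩ : ∃ j, i = j + 1 := ⟨i - 1, by omega⟩
  exact (Eth.dl k _ (FF k t lb)).c1 (SES.ofKer (de_surj hp)) j
    (VV_K hp (Eth.dl k _ (FF k t lb)) (VV_ED h) (j + 1) (by omega)) (VV_ED h _ Th_odd j (by omega))

lemma dec (hp : 2 ≤ p) [CharP k p] (htd : t < 2 * p)
    (H : EV (BB k (2 * p) t) (Dl k (BB k (2 * p) t) (FF k t (lab p 0 0 2 2))) (FF k t (lab p 0 0 2 2)) (4 * (p - 1)))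
    (β : Dl k (BB k (2 * p) t) (Th k t p) →ₗ[BB k (2 * p) t] Th k t p) :
    ∃ (z : Dl k (BB k (2 * p) t) (Th k t p) →ₗ[BB k (2 * p) t] (KK1 k t p × KK2 k t p))
      (w : Dl k (BB k (2 * p) t) (KK1 k t p × KK2 k t p) →ₗ[BB k (2 * p) t] Th k t p),
      ∀ x, β x = de hp k t (z x) + w (Dl.map k (de hp k t) x) :=
  by
  have T := SES.ofKer (de_surj hp (k := k) (t := t))
  have S := T.dual (k := k)
  have a1 := EV_QQ hp htd H
  have a2 := EV_KK hp (k := k) (t := t)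
  exact SES.decomp S T a1 a2 β

end SN

section SC
open Equiv

variable {k : Type u} [Field k] {d t p : ℕ}

def gu (k : Type u) [Field k] (d : ℕ) (u : Perm (Fin t)) : BB k d t :=
  BB.mk (fun i j => if j = u ∘ i then 1 else 0) fun σ i j => by
    rw [← comp_assoc]; simp only [comp_perm_eq]

lemma gu_e (u : Perm (Fin t)) (i j) : (gu k d u).e i j = if j = u ∘ i then 1 else 0 := rfl

lemma gu_smul (u : Perm (Fin t)) (x : XX k d t) (i) : (gu k d u • x) i = x (u ∘ i) := by
  rw [XX.smul_apply]
  simp only [gu_e, ite_mul, one_mul, zero_mul]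
  rw [sum_ite_eq', if_pos (mem_univ _)]

lemma gu_star (a b : Fin t) : star (gu k d (swap a b)) = gu k d (swap a b) := BB.ext' fun i j => by
  rw [BB.star_apply, gu_e, gu_e]
  congr 1
  apply propext
  constructor
  · rintro rfl; funext c; simp
  · rintro rfl; funext c; simp

def co (W : Submodule (BB k d t) (XX k d t)) (i : Fin d → Fin t) : Dl k (BB k d t) W := Dl.map k W.subtype (xdl (ee i))

lemma co_apply (W : Submodule (BB k d t) (XX k d t)) (i) (y : W) : (co W i).1 y = y.1 i := by
  unfold co; rw [Dl.map_apply, xdl_apply, frm_ee]; rfl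

lemma gu_co (W : Submodule (BB k d t) (XX k d t)) (a b) (i) : gu k d (swap a b) • co W i = co W (swap a b ∘ i) :=
  Dl.ext' fun y => by
    rw [Dl.smul_apply, gu_star, co_apply, co_apply]
    exact gu_smul _ _ _

lemma swap_two {A : Type*} [DecidableEq A] {i : Fin d → A} {a b a' b' : Fin d} (hab : i a ≠ i b) (na : a ≠ a') (nb : b ≠ b')
    (ha : ∀ q, i q = i a ↔ q = a ∨ q = a') (hb : ∀ q, i q = i b ↔ q = b ∨ q = b') :
    swap (i a) (i b) ∘ i = (i ∘ swap a b) ∘ swap a' b' := by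
  have hh : i a' = i a := (ha a').2 (Or.inr rfl)
  have wh : i b' = i b := (hb b').2 (Or.inr rfl)
  have un : a ≠ b := fun h => hab (by rw [h])
  have n2 : a ≠ b' := fun h => hab (by rw [← wh, h])
  have n3 : a' ≠ b := fun h => hab (by rw [← hh, h])
  have n4 : a' ≠ b' := fun h => hab (by rw [← hh, ← wh, h])
  funext q
  simp only [Function.comp_apply]
  by_cases q1 : q = a
  · rw [q1, swap_apply_left, swap_apply_of_ne_of_ne na n2, swap_apply_left]
  by_cases q2 : q = b
  · rw [q2, swap_apply_right, swap_apply_of_ne_of_ne n3.symm nb, swap_apply_right]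
  by_cases q3 : q = a'
  · rw [q3, hh, swap_apply_left, swap_apply_left, swap_apply_of_ne_of_ne n2.symm nb.symm, wh]
  by_cases q4 : q = b'
  · rw [q4, wh, swap_apply_right, swap_apply_right, swap_apply_of_ne_of_ne na.symm n3, hh]
  rw [swap_apply_of_ne_of_ne q3 q4, swap_apply_of_ne_of_ne q1 q2, swap_apply_of_ne_of_ne]
  · rw [Ne, ha]; tauto
  · rw [Ne, hb]; tauto

def io (hpt : p ≤ t) (hp : 2 ≤ p) : Fin (2 * p) → Fin t := fun b => ⟨b.val % p, (Nat.mod_lt _ (by omega)).trans_le hpt⟩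

variable (hpt : p ≤ t) (hp : 2 ≤ p)

lemma i0_eq (a b : Fin (2 * p)) : io hpt hp a = io hpt hp b ↔ a.val = b.val ∨ a.val = b.val + p ∨ b.val = a.val + p := by
  unfold io
  rw [Fin.mk.injEq]
  have hh : ∀ c : Fin (2 * p), c.val % p = if c.val < p then c.val else c.val - p := fun c => by
    have := c.2
    split_ifs with h
    · exact Nat.mod_eq_of_lt h
    · rw [Nat.mod_eq_sub_mod (by omega), Nat.mod_eq_of_lt (by omega)]
  rw [hh, hh]
  have := a.2; have := b.2
  split_ifs <;> omega

lemma core [CharP k p] (x : XX k (2 * p) t) (e : Fin (2 * p)) (A : Finset (Fin (2 * p))) (hA : A.card + 1 = p) (B : Fin (2 * p) → Prop)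
    (hs : ∀ i a b, a ≠ b → B a → B b → x (i ∘ swap a b) = - x i)
    (H : ∀ o ∈ A, ∃ a b, a ≠ b ∧ B a ∧ B b ∧ swap (io hpt hp e) (io hpt hp o) ∘ io hpt hp = (io hpt hp ∘ swap e o) ∘ swap a b)
    (hu : ∀ o ∈ A, x (swap (io hpt hp e) (io hpt hp o) ∘ io hpt hp) = x (io hpt hp)) :
    x (io hpt hp) - ∑ o ∈ A, x (io hpt hp ∘ swap e o) = 0 := by
  have : ∀ o ∈ A, x (io hpt hp ∘ swap e o) = - x (io hpt hp) := fun o ho => by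
    obtain ⟨a, b, hab, ha, hb, h⟩ := H o ho
    rw [← hu o ho, h, hs _ a b hab ha hb, neg_neg]
  rw [sum_congr rfl this, Finset.sum_const, smul_neg, sub_neg_eq_add]
  have wh : ((A.card + 1 : ℕ) : k) = 0 := by rw [hA]; exact CharP.cast_eq_zero k p
  rw [nsmul_eq_mul]
  push_cast at wh
  linear_combination x (io hpt hp) * wh

lemma H1 : ∀ o ∈ A1 p, ∃ a b : Fin (2 * p), a ≠ b ∧ p ≤ a.val ∧ p ≤ b.val ∧
    swap (io hpt hp (pe hp)) (io hpt hp o) ∘ io hpt hp = (io hpt hp ∘ swap (pe hp) o) ∘ swap a b := by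
  intro o ho
  rw [A1, mem_filter] at ho
  have e0 : (pe hp).val = 0 := rfl
  refine ⟨pf hp, ⟨o.val + p, by omega⟩, fun h => ?_, le_rfl, by simp, swap_two ?_ ?_ ?_ ?_ ?_⟩
  · have : p = o.val + p := congrArg Fin.val h
    omega
  · rw [Ne, i0_eq]; omega
  · rw [Ne, Fin.ext_iff]; show ¬ (0 = p); omega
  · rw [Ne, Fin.ext_iff]; show ¬ (o.val = o.val + p); omega
  · intro q; rw [i0_eq, Fin.ext_iff, Fin.ext_iff]
    have : (pf hp).val = p := rfl
    omega
  · intro q; rw [i0_eq, Fin.ext_iff, Fin.ext_iff]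
    show _ ↔ _ ∨ _ = o.val + p
    omega

lemma H2 : ∀ o ∈ A2 p, ∃ a b : Fin (2 * p), a ≠ b ∧ a.val < p ∧ b.val < p ∧
    swap (io hpt hp (pf hp)) (io hpt hp o) ∘ io hpt hp = (io hpt hp ∘ swap (pf hp) o) ∘ swap a b := by
  intro o ho
  rw [A2, mem_filter] at ho
  have := o.2
  have e0 : (pf hp).val = p := rfl
  refine ⟨pe hp, ⟨o.val - p, by omega⟩, fun h => ?_, show 0 < p by omega, by show o.val - p < p; omega, swap_two ?_ ?_ ?_ ?_ ?_⟩
  · have : 0 = o.val - p := congrArg Fin.val h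
    omega
  · rw [Ne, i0_eq]; omega
  · rw [Ne, Fin.ext_iff]; show ¬ (p = 0); omega
  · rw [Ne, Fin.ext_iff]; show ¬ (o.val = o.val - p); omega
  · intro q; rw [i0_eq, Fin.ext_iff, Fin.ext_iff]
    have : (pe hp).val = 0 := rfl
    omega
  · intro q; rw [i0_eq, Fin.ext_iff, Fin.ext_iff]
    show _ ↔ _ ∨ _ = o.val - p
    omega

lemma A1_card (hp : 2 ≤ p) : (A1 p).card + 1 = p := by
  have : A1 p = (univ.filter fun x : Fin (2 * p) => x.val < p).erase (pe hp) := by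
    ext x; rw [A1, mem_erase, mem_filter, mem_filter]
    have : x ≠ pe hp ↔ x.val ≠ 0 := by rw [Ne, Fin.ext_iff]
    rw [this]; tauto
  rw [this, card_erase_add_one, card_lo]
  rw [mem_filter]; exact ⟨mem_univ _, show 0 < p by omega⟩

lemma A2_card (hp : 2 ≤ p) : (A2 p).card + 1 = p := by
  have : A2 p = (univ.filter fun x : Fin (2 * p) => ¬ x.val < p).erase (pf hp) := by
    ext x; rw [A2, mem_erase, mem_filter, mem_filter]
    have : x ≠ pf hp ↔ x.val ≠ p := by rw [Ne, Fin.ext_iff]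
    rw [this]
    have : p < x.val ↔ (x.val ≠ p ∧ ¬ x.val < p) := by omega
    tauto
  rw [this, card_erase_add_one, card_hi]
  rw [mem_filter]; exact ⟨mem_univ _, show ¬ p < p by omega⟩

lemma sw_hi {a' a : ℕ} {y : XX k (2 * p) t} (hy : y ∈ FF k t (lab p a' a 3 3)) (i a1 b1) (h : a1 ≠ b1) (hh : p ≤ a1.val) (wh : p ≤ b1.val) :
    y (i ∘ swap a1 b1) = - y i := by
  have e : ∀ c : Fin (2 * p), p ≤ c.val → lab p a' a 3 3 c = 3 := fun c hc => by
    unfold lab; rw [if_neg (by omega)]; split_ifs <;> rfl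
  exact (mem_FF.1 hy).od a1 b1 h (by rw [e _ hh, e _ wh]) (by rw [e _ hh]; decide) i

lemma sw_lo {b' b : ℕ} {y : XX k (2 * p) t} (hy : y ∈ FF k t (lab p 1 1 b' b)) (i a1 b1) (h : a1 ≠ b1) (hh : a1.val < p) (wh : b1.val < p) :
    y (i ∘ swap a1 b1) = - y i := by
  have e : ∀ c : Fin (2 * p), c.val < p → lab p 1 1 b' b c = 1 := fun c hc => by
    unfold lab; rw [if_pos hc]; split_ifs <;> rfl
  exact (mem_FF.1 hy).od a1 b1 h (by rw [e _ hh, e _ wh]) (by rw [e _ hh]; decide) i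

lemma inv1 (o) (ho : o ∈ A1 p) {y : XX k (2 * p) t} (hy : y ∈ FF k t (lab p 1 1 3 3)) :
    y (swap (io hpt hp (pe hp)) (io hpt hp o) ∘ io hpt hp) = y (io hpt hp) := by
  obtain ⟨a, b, hab, ha, hb, h⟩ := H1 hpt hp o ho
  rw [A1, mem_filter] at ho
  rw [h, sw_hi hy _ _ _ hab ha hb, sw_lo hy _ _ _ ?_ ?_ ho.2.1, neg_neg]
  · rintro rfl; exact ho.2.2 rfl
  · show 0 < p; omega

lemma inv2 (o) (ho : o ∈ A2 p) {y : XX k (2 * p) t} (hy : y ∈ FF k t (lab p 1 1 3 3)) :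
    y (swap (io hpt hp (pf hp)) (io hpt hp o) ∘ io hpt hp) = y (io hpt hp) := by
  obtain ⟨a, b, hab, ha, hb, h⟩ := H2 hpt hp o ho
  rw [A2, mem_filter] at ho
  rw [h, sw_lo hy _ _ _ hab ha hb, sw_hi hy _ _ _ ?_ ?_ ho.2.le, neg_neg]
  · rintro rfl; exact lt_irrefl _ ho.2
  · exact le_rfl

lemma beta1 : (sdE (k := k) (t := t) (Th_odd (p := p)) (co (Th k t p) (io hpt hp))).1 (io hpt hp) = 1 := by
  show (co (Th k t p) (io hpt hp)).1 ⟨al _ (ee (io hpt hp)), _⟩ = 1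
  rw [co_apply]
  show al _ (ee (io hpt hp)) (io hpt hp) = (1 : k)
  rw [al_apply, sum_eq_single 1]
  · rw [sg_one]; unfold ee; rw [one_mul]; exact if_pos rfl
  · intro σ hσ hh
    unfold ee
    rw [if_neg, mul_zero]
    intro h
    apply hh
    refine Equiv.ext fun q => ?_
    have wh := congrFun h q
    rw [Function.comp_apply, i0_eq] at wh
    have wr := congrFun (mem_St.1 hσ) q
    rw [Function.comp_apply] at wr
    unfold lab at wr
    rw [Perm.one_apply]
    refine Fin.ext ?_
    have := q.2; have := (σ q).2
    split_ifs at wr <;> omega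
  · intro h; exact absurd St_one h

end SC

section SD
open Equiv

variable {k : Type u} [Field k] {t p : ℕ}

lemma Dl_sum_apply {ι : Type*} {R M : Type u} [Ring R] [Algebra k R] [StarRing R] [SA k R] [AddCommGroup M] [Module R M]
    (s : Finset ι) (f : ι → Dl k R M) (m : M) : (∑ c ∈ s, f c).1 m = ∑ c ∈ s, (f c).1 m := by
  classical
  induction s using induction_on with
  | empty => rw [sum_empty, sum_empty]; rfl
  | insert a s ha ih => rw [sum_insert ha, sum_insert ha, Dl.add_apply, ih]

lemma FF_sum_apply {ι : Type*} {d : ℕ} {W : Submodule (BB k d t) (XX k d t)} (s : Finset ι) (f : ι → W) (i) :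
    (∑ c ∈ s, f c).1 i = ∑ c ∈ s, (f c).1 i := by
  rw [← XX.sum_apply]; exact congrFun (map_sum W.subtype f s) i

variable (hpt : p ≤ t) (hp : 2 ≤ p)

def ph1 (k : Type u) [Field k] (t p : ℕ) (i : Fin (2 * p) → Fin t) : Dl k (BB k (2 * p) t) (KK1 k t p × KK2 k t p) :=
  Dl.map k (LinearMap.fst _ _ _) (co (KK1 k t p) i)
def ph2 (k : Type u) [Field k] (t p : ℕ) (i : Fin (2 * p) → Fin t) : Dl k (BB k (2 * p) t) (KK1 k t p × KK2 k t p) :=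
  Dl.map k (LinearMap.snd _ _ _) (co (KK2 k t p) i)

lemma ph1_apply (i) (y : KK1 k t p × KK2 k t p) : (ph1 k t p i).1 y = y.1.1 i := co_apply _ _ _
lemma ph2_apply (i) (y : KK1 k t p × KK2 k t p) : (ph2 k t p i).1 y = y.2.1 i := co_apply _ _ _

lemma de_ph (i) : Dl.map k (de hp k t) (co (Th k t p) i) =
    (ph1 k t p i + - ∑ o ∈ A1 p, ph1 k t p (i ∘ swap (pe hp) o)) + (ph2 k t p i + - ∑ o ∈ A2 p, ph2 k t p (i ∘ swap (pf hp) o)) :=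
  Dl.ext' fun y => by
    have neg : ∀ q : Dl k (BB k (2 * p) t) (KK1 k t p × KK2 k t p), (-q).1 y = - q.1 y := fun q => rfl
    rw [Dl.map_apply, co_apply, Dl.add_apply, Dl.add_apply, Dl.add_apply, neg, neg, Dl_sum_apply, Dl_sum_apply]
    simp only [ph1_apply, ph2_apply]
    show Dm (pe hp) (A1 p) y.1.1 i + Dm (pf hp) (A2 p) y.2.1 i = _
    rw [Dm_apply, Dm_apply, sub_eq_add_neg, sub_eq_add_neg]

theorem lower (hpt : p ≤ t) (hp : 2 ≤ p) [CharP k p] (htd : t < 2 * p)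
    (H : EV (BB k (2 * p) t) (Dl k (BB k (2 * p) t) (FF k t (lab p 0 0 2 2))) (FF k t (lab p 0 0 2 2)) (4 * (p - 1))) : False := by
  obtain ⟨z, w, h⟩ := dec hp htd H (sdE (k := k) (t := t) (Th_odd (p := p))).toLinearMap
  have hh := congrArg (fun q : Th k t p => q.1 (io hpt hp)) (h (co (Th k t p) (io hpt hp)))
  have wh : (1 : k) = (de hp k t (z (co (Th k t p) (io hpt hp)))).1 (io hpt hp) +
      (w (Dl.map k (de hp k t) (co (Th k t p) (io hpt hp)))).1 (io hpt hp) := (beta1 hpt hp).symm.trans hh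
  clear hh h H
  have i1 : ∀ o ∈ A1 p, gu k (2 * p) (swap (io hpt hp (pe hp)) (io hpt hp o)) • co (Th k t p) (io hpt hp) = co (Th k t p) (io hpt hp) :=
    fun o ho => by
      rw [gu_co]; refine Dl.ext' fun y => ?_
      rw [co_apply, co_apply]; exact inv1 hpt hp o ho y.2
  have i2 : ∀ o ∈ A2 p, gu k (2 * p) (swap (io hpt hp (pf hp)) (io hpt hp o)) • co (Th k t p) (io hpt hp) = co (Th k t p) (io hpt hp) :=
    fun o ho => by
      rw [gu_co]; refine Dl.ext' fun y => ?_
      rw [co_apply, co_apply]; exact inv2 hpt hp o ho y.2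
  have a : (de hp k t (z (co (Th k t p) (io hpt hp)))).1 (io hpt hp) = 0 := by
    show Dm (pe hp) (A1 p) (z (co (Th k t p) (io hpt hp))).1.1 (io hpt hp) +
      Dm (pf hp) (A2 p) (z (co (Th k t p) (io hpt hp))).2.1 (io hpt hp) = 0
    rw [Dm_apply, Dm_apply, core hpt hp _ _ _ (A1_card hp) (fun q => p ≤ q.val) ?_ (H1 hpt hp) ?_,
      core hpt hp _ _ _ (A2_card hp) (fun q => q.val < p) ?_ (H2 hpt hp) ?_, add_zero]
    · intro i a b; exact sw_lo (Subtype.property _) i a b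
    · intro o ho
      have := congrArg z (i2 o ho)
      rw [map_smul] at this
      have := congrArg (fun q : KK1 k t p × KK2 k t p => q.2.1 (io hpt hp)) this
      exact (gu_smul _ _ _).symm.trans this
    · intro i a b; exact sw_hi (Subtype.property _) i a b
    · intro o ho
      have := congrArg z (i1 o ho)
      rw [map_smul] at this
      have := congrArg (fun q : KK1 k t p × KK2 k t p => q.1.1 (io hpt hp)) this
      exact (gu_smul _ _ _).symm.trans this
  have b : (w (Dl.map k (de hp k t) (co (Th k t p) (io hpt hp)))).1 (io hpt hp) = 0 := by
    rw [de_ph, map_add, map_add, map_add, map_neg, map_neg, map_sum, map_sum]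
    have c1 := core hpt hp (fun i => (w (ph1 k t p i)).1 (io hpt hp)) _ _ (A1_card hp) (fun q => p ≤ q.val) ?_ (H1 hpt hp) ?_
    have c2 := core hpt hp (fun i => (w (ph2 k t p i)).1 (io hpt hp)) _ _ (A2_card hp) (fun q => q.val < p) ?_ (H2 hpt hp) ?_
    · show ((w (ph1 k t p _)).1 (io hpt hp) + - (∑ o ∈ A1 p, w (ph1 k t p (io hpt hp ∘ swap (pe hp) o))).1 (io hpt hp)) +
        ((w (ph2 k t p _)).1 (io hpt hp) + - (∑ o ∈ A2 p, w (ph2 k t p (io hpt hp ∘ swap (pf hp) o))).1 (io hpt hp)) = 0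
      rw [FF_sum_apply, FF_sum_apply, ← sub_eq_add_neg, ← sub_eq_add_neg, c1, c2, add_zero]
    · intro i a b hab ha hb
      have : ph2 k t p (i ∘ swap a b) = - ph2 k t p i := Dl.ext' fun y => by
        show _ = - (ph2 k t p i).1 y
        rw [ph2_apply, ph2_apply]; exact sw_lo y.2.2 i a b hab ha hb
      show (w (ph2 k t p (i ∘ swap a b))).1 _ = _
      rw [this, map_neg]; rfl
    · intro o ho
      have : ph2 k t p (swap (io hpt hp (pf hp)) (io hpt hp o) ∘ io hpt hp) =
          gu k (2 * p) (swap (io hpt hp (pf hp)) (io hpt hp o)) • ph2 k t p (io hpt hp) := by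
        unfold ph2; rw [← map_smul, gu_co]
      show (w (ph2 k t p _)).1 _ = _
      rw [this, map_smul]
      exact (gu_smul _ _ _).trans (inv2 hpt hp o ho (Subtype.property _))
    · intro i a b hab ha hb
      have : ph1 k t p (i ∘ swap a b) = - ph1 k t p i := Dl.ext' fun y => by
        show _ = - (ph1 k t p i).1 y
        rw [ph1_apply, ph1_apply]; exact sw_hi y.1.2 i a b hab ha hb
      show (w (ph1 k t p (i ∘ swap a b))).1 _ = _
      rw [this, map_neg]; rfl
    · intro o ho
      have : ph1 k t p (swap (io hpt hp (pe hp)) (io hpt hp o) ∘ io hpt hp) =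
          gu k (2 * p) (swap (io hpt hp (pe hp)) (io hpt hp o)) • ph1 k t p (io hpt hp) := by
        unfold ph1; rw [← map_smul, gu_co]
      show (w (ph1 k t p _)).1 _ = _
      rw [this, map_smul]
      exact (gu_smul _ _ _).trans (inv1 hpt hp o ho (Subtype.property _))
  rw [a, b, add_zero] at wh
  exact one_ne_zero wh

end SD

section SX

lemma proj_tr {A B : Type u} [Ring A] [Ring B] (e : A ≃+* B) {M N : Type u} [AddCommGroup M] [Module A M] [AddCommGroup N] [Module B N]
    (f : M ≃+ N) (hf : ∀ (a : A) (m : M), f (a • m) = e a • f m) (h : Module.Projective B N) : Module.Projective A M := by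
  have hf' : ∀ (b : B) (n : N), f.symm (b • n) = e.symm b • f.symm n := fun b n => by
    apply f.injective; rw [hf]; simp
  have a1 : RingHomInvPair (e.symm : B →+* A) (e : A →+* B) := ⟨by ext; simp, by ext; simp⟩
  have a2 : RingHomInvPair (e : A →+* B) (e.symm : B →+* A) := ⟨by ext; simp, by ext; simp⟩
  have e2 : N ≃ₛₗ[(e.symm : B →+* A)] M := { f.symm with map_smul' := hf' }
  exact Module.Projective.of_equiv e2

lemma PDimLE.tr {A B : Type u} [Ring A] [Ring B] (e : A ≃+* B) (n : ℕ) : ∀ {M N : Type u} [AddCommGroup M] [Module A M]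
    [AddCommGroup N] [Module B N]
    (f : M ≃+ N) (hf : ∀ (a : A) (m : M), f (a • m) = e a • f m) (h : PDimLE B n N), PDimLE A n M := by
  induction n with
  | zero => intro M N _ _ _ _ f hf h; exact proj_tr e f hf h
  | succ n ih =>
    intro M N _ _ _ _ f hf h
    obtain ⟨P, i1, i2, g, hP, hg, hk⟩ := h
    let i3 : Module A P := Module.compHom P (e : A →+* B)
    have wr : ∀ (a : A) (x : P), a • x = e a • x := fun _ _ => rfl
    let g' : P →ₗ[A] M := ⟨⟨fun x => f.symm (g x), fun x y => by simp⟩, fun a x => by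
      apply f.injective
      simp [hf, wr]⟩
    have hg' : ∀ x, g' x = f.symm (g x) := fun _ => rfl
    refine ⟨P, i1, i3, g', proj_tr e (AddEquiv.refl P) (fun _ _ => rfl) hP, fun m => ?_, ?_⟩
    · obtain ⟨x, hx⟩ := hg (f m)
      exact ⟨x, by rw [hg', hx]; simp⟩
    · refine ih (N := LinearMap.ker g) ⟨⟨fun x => ⟨x.1, ?_⟩, fun x => ⟨x.1, ?_⟩, fun _ => rfl, fun _ => rfl⟩, fun _ _ => rfl⟩ (fun _ _ => rfl) hk
      · have := x.2
        rw [mem_ker, hg'] at this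
        rw [mem_ker]
        apply f.symm.injective; rw [this, map_zero]
      · rw [mem_ker, hg', mem_ker.1 x.2, map_zero]

lemma fin_tr {A B : Type u} [Ring A] [Ring B] (e : A ≃+* B) {M N : Type u} [AddCommGroup M] [Module A M] [AddCommGroup N] [Module B N]
    (f : M ≃+ N) (hf : ∀ (a : A) (m : M), f (a • m) = e a • f m) (h : Module.Finite B N) : Module.Finite A M := by
  have hf' : ∀ (b : B) (n : N), f.symm (b • n) = e.symm b • f.symm n := fun b n => by
    apply f.injective; rw [hf]; simp
  have : RingHomSurjective (e.symm : B →+* A) := ⟨e.symm.surjective⟩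
  let e2 : N →ₛₗ[(e.symm : B →+* A)] M := { f.symm with map_smul' := hf' }
  exact Module.Finite.of_surjective e2 f.symm.surjective

variable {k : Type u} [Field k] {d t : ℕ}

def tX (x : TensorSpace k t d) : XX k d t := x
def xT (x : XX k d t) : TensorSpace k t d := x

lemma single_smul' (σ : Equiv.Perm (Fin d)) (c : k) (x : TensorSpace k t d) (i) :
    ((MonoidAlgebra.single σ c : SymGroupAlgebra k d) • x : TensorSpace k t d) i = c * x (i ∘ σ) := by
  rw [tensorSpace_smul_def, Representation.asAlgebraHom_single]; rfl

def rF (k : Type u) [Field k] (d t : ℕ) : BB k d t →+* SchurAlgebra k t d where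
  toFun a :=
    { toFun := fun x => xT (a • tX x)
      map_add' := fun x y => smul_add a (tX x) (tX y)
      map_smul' := fun r x => by
        induction r using MonoidAlgebra.induction_linear with
        | zero => rw [zero_smul, RingHom.id_apply, zero_smul]; exact smul_zero (A := XX k d t) a
        | add f g hf hg =>
          rw [RingHom.id_apply] at hf hg ⊢
          rw [add_smul, add_smul, ← hf, ← hg]; exact smul_add a (tX _) (tX _)
        | single σ c =>
          rw [RingHom.id_apply]
          funext i
          rw [single_smul']
          show (a • tX _) i = c * (a • tX x) (i ∘ σ)
          rw [XX.smul_apply, XX.smul_apply, ← sum_perm σ (fun j => a.e (i ∘ σ) j * tX x j), mul_sum]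
          refine sum_congr rfl fun j _ => ?_
          rw [BB.inv]
          have : tX ((MonoidAlgebra.single σ c : SymGroupAlgebra k d) • x) j = c * tX x (j ∘ σ) := single_smul' σ c x j
          rw [this]; ring }
  map_one' := LinearMap.ext fun x => one_smul _ (tX x)
  map_mul' a b := LinearMap.ext fun x => mul_smul a b (tX x)
  map_zero' := LinearMap.ext fun x => zero_smul _ (tX x)
  map_add' a b := LinearMap.ext fun x => add_smul a b (tX x)

lemma rF_apply (a : BB k d t) (x : TensorSpace k t d) : rF k d t a x = xT (a • tX x) := rfl

lemma rF_bij : Bijective (rF k d t) := by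
  constructor
  · intro a b h
    refine BB.ext' fun i j => ?_
    have := congrFun (LinearMap.congr_fun h (xT (ee j))) i
    exact (sm_ee a j i).symm.trans (this.trans (sm_ee b j i))
  · intro φ
    refine ⟨BB.mk (fun i j => (φ (xT (ee j)) : XX k d t) i) fun σ i j => ?_, LinearMap.ext fun x => ?_⟩
    · have hh : (MonoidAlgebra.single σ (1 : k) : SymGroupAlgebra k d) • xT (k := k) (ee (j ∘ σ)) = xT (ee j) := by
        funext i
        refine (single_smul' _ _ _ _).trans ?_
        rw [one_mul]
        show ite _ _ _ = ite _ _ _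
        simp only [comp_perm_eq]
      have wh := congrFun (map_smul φ (MonoidAlgebra.single σ (1 : k)) (xT (ee (j ∘ σ)))) i
      rw [single_smul', one_mul] at wh
      exact wh.symm.trans (congrFun (congrArg φ hh) i)
    · have hx : x = ∑ j, (MonoidAlgebra.single 1 (tX x j) : SymGroupAlgebra k d) • xT (ee j) := by
        funext i
        refine Eq.trans ?_ (Finset.sum_apply (M := fun _ => k) i _ _).symm
        have : ∀ j, ((MonoidAlgebra.single 1 (tX x j) : SymGroupAlgebra k d) • xT (ee j)) i =
          tX x j * (ee j : XX k d t) i := fun j => single_smul' _ _ _ _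
        simp only [this]
        show tX x i = _
        unfold ee
        simp only [mul_ite, mul_one, mul_zero]
        rw [sum_ite_eq, if_pos (mem_univ _)]
      conv_rhs => rw [hx, map_sum]
      funext i
      refine Eq.trans ?_ (Finset.sum_apply (M := fun _ => k) i _ _).symm
      rw [rF_apply]
      refine (XX.smul_apply _ _ _).trans ?_
      refine sum_congr rfl fun j _ => ?_
      rw [map_smul]
      refine Eq.trans ?_ (single_smul' _ _ _ _).symm
      exact mul_comm _ _

noncomputable def rE (k : Type u) [Field k] (d t : ℕ) : BB k d t ≃+* SchurAlgebra k t d := RingEquiv.ofBijective (rF k d t) rF_bij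

end SX

/-- Let `k` be a field of prime characteristic `p` and `p ≤ t ≤ 2p - 1`. Then the Schur
algebra `S_k(t, 2p)` has global dimension exactly `4(p-1)`: every finitely generated
module has projective dimension at most `4(p-1)`, and some finitely generated module has
projective dimension exactly `4(p-1)`. -/
theorem globalDimension_schurAlgebra_eq (k : Type u) [Field k] (p t : ℕ) (hp : p.Prime)
    [CharP k p] (hpt : p ≤ t) (ht : t ≤ 2 * p - 1) :
    (∀ (M : Type u) [AddCommGroup M] [Module (SchurAlgebra k t (2 * p)) M],
      Module.Finite (SchurAlgebra k t (2 * p)) M →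
        PDimLE (SchurAlgebra k t (2 * p)) (4 * (p - 1)) M) ∧
    (∃ (M : Type u) (_ : AddCommGroup M) (_ : Module (SchurAlgebra k t (2 * p)) M),
      Module.Finite (SchurAlgebra k t (2 * p)) M ∧
      PDimLE (SchurAlgebra k t (2 * p)) (4 * (p - 1)) M ∧
      ∀ m : ℕ, PDimLE (SchurAlgebra k t (2 * p)) m M → 4 * (p - 1) ≤ m) := by
  have hp2 := hp.two_le
  have htd : t < 2 * p := by omega
  constructor
  · intro M _ _ hM
    let _ : Module (BB k (2 * p) t) M := Module.compHom M (rE k (2 * p) t : BB k (2 * p) t →+* SchurAlgebra k t (2 * p))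
    have : Module.Finite (BB k (2 * p) t) M := fin_tr (rE k (2 * p) t) (AddEquiv.refl M) (fun _ _ => rfl) hM
    refine PDimLE.tr (rE k (2 * p) t).symm _ (AddEquiv.refl M) (fun a m => ?_) (PD_all hp.pos htd rfl M)
    show a • m = (rE k (2 * p) t) ((rE k (2 * p) t).symm a) • m
    rw [RingEquiv.apply_symm_apply]
  · let M := Dl k (BB k (2 * p) t) (FF k t (lab p 0 0 2 2))
    let j : Module (SchurAlgebra k t (2 * p)) M := Module.compHom M ((rE k (2 * p) t).symm : SchurAlgebra k t (2 * p) →+* BB k (2 * p) t)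
    have hM : Module.Finite (BB k (2 * p) t) M := Dl_FF_fin _
    refine ⟨M, inferInstance, j, fin_tr (rE k (2 * p) t).symm (AddEquiv.refl M) (fun _ _ => rfl) hM,
      PDimLE.tr (rE k (2 * p) t).symm _ (AddEquiv.refl M) (fun _ _ => rfl) (PD_all hp.pos htd rfl M), fun m h => ?_⟩
    have wh : PDimLE (BB k (2 * p) t) m M := PDimLE.tr (rE k (2 * p) t) _ (AddEquiv.refl M) (fun a x => by
      show a • x = (rE k (2 * p) t).symm ((rE k (2 * p) t) a) • x
      rw [RingEquiv.symm_apply_apply]) h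
    by_contra hc
    exact lower hpt hp2 htd (PDimLE.ev wh _ _ (by omega))
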